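/- Let P and Q be nonzero elements of the polynomial ring Q̄[X,Y,Z] having no common irreducible factor. Then the holomorphic functions ψ_P and ψ_Q have no common zero in H. -/

import Mathlib

/-- The normalized Eisenstein series of even weight `k ≥ 4` (the definition also
makes sense for `k = 2`, giving the quasi-modular Eisenstein series `E₂`), defined by
its Fourier expansion `E_k(z) = 1 - (2k/B_k) ∑_{n≥1} σ_{k-1}(n) qⁿ`, `q = exp(2πiz)`. -/
noncomputable def Ek (k : ℕ) (z : ℂ) : ℂ :=
  1 - (2 * (k : ℂ) / ((bernoulli k : ℚ) : ℂ)) *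
    ∑' n : ℕ, (∑ d ∈ n.divisors, (d : ℂ) ^ (k - 1)) * Complex.exp (2 * Real.pi * Complex.I * z) ^ n

/-- `ψ_P = P(E₂, E₄, E₆)` as a function on the upper half-plane, for a polynomial `P`
in three variables. -/
noncomputable def psi (P : MvPolynomial (Fin 3) ℂ) (z : ℂ) : ℂ :=
  MvPolynomial.eval (![Ek 2 z, Ek 4 z, Ek 6 z]) P

namespace RamanujanTranscendence

section Gelfond

open Polynomial

/-- A determinant whose entries are dominated by `r i * c j`. -/
lemma norm_det_le_of_entry_le {ι : Type*} [Fintype ι] [DecidableEq ι] (A : Matrix ι ι ℂ)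
    (r c : ι → ℝ) (h : ∀ i j, ‖A i j‖ ≤ r i * c j) :
    ‖A.det‖ ≤ (Fintype.card ι).factorial * ((∏ i, r i) * ∏ j, c j) := by
  rw [Matrix.det_apply]
  have : ∀ σ : Equiv.Perm ι, ‖Equiv.Perm.sign σ • ∏ i, A (σ i) i‖ ≤ (∏ i, r i) * ∏ j, c j := by
    intro σ
    have h1 : ‖Equiv.Perm.sign σ • ∏ i, A (σ i) i‖ = ∏ i, ‖A (σ i) i‖ := by
      rcases Int.units_eq_one_or (Equiv.Perm.sign σ) with h | h <;> simp [h]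
    rw [h1, ← Equiv.prod_comp σ r, ← Finset.prod_mul_distrib]
    exact Finset.prod_le_prod (fun _ _ => norm_nonneg _) (fun i _ => h _ _)
  refine (norm_sum_le_of_le _ (fun σ _ => this σ)).trans ?_
  simp [Fintype.card_perm]

lemma mahlerMeasure_le_of_forall_norm_eval_le (p : ℂ[X]) {S : ℝ} (hS : 1 ≤ S)
    (h : ∀ x : ℂ, ‖x‖ = 1 → ‖p.eval x‖ ≤ S) : p.mahlerMeasure ≤ S := by
  by_cases hp : p = 0
  · simp [hp]; linarith
  rw [mahlerMeasure_def_of_ne_zero hp, ← Real.le_log_iff_exp_le (by linarith)]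
  have key : p.logMahlerMeasure ≤ Real.log S := by
    apply Real.circleAverage_mono_on_of_le_circle
    · exact p.intervalIntegrable_mahlerMeasure
    · intro x hx
      have hx' := h x (by simpa using hx)
      by_cases h0 : ‖p.eval x‖ = 0
      · rw [h0, Real.log_zero]; exact Real.log_nonneg hS
      · exact Real.log_le_log (lt_of_le_of_ne (norm_nonneg _) (Ne.symm h0)) hx'
  exact key

lemma norm_eval_le_mahlerMeasure (p : ℂ[X]) {ρ : ℝ} (hρ : 1 ≤ ρ) {x : ℂ} (hx : ‖x‖ ≤ ρ) :
    ‖p.eval x‖ ≤ (2 * ρ) ^ p.natDegree * p.mahlerMeasure := by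
  rw [eval_eq_sum_range]
  refine (norm_sum_le_of_le _ (f := fun i => p.coeff i * x ^ i)
    (n := fun i => (p.natDegree.choose i : ℝ) * (p.mahlerMeasure * ρ ^ p.natDegree)) ?_).trans ?_
  · intro i hi
    rw [norm_mul, norm_pow]
    have h1 := norm_coeff_le_choose_mul_mahlerMeasure i p
    have h2 : ‖x‖ ^ i ≤ ρ ^ p.natDegree :=
      (pow_le_pow_left₀ (norm_nonneg _) hx i).trans
        (pow_le_pow_right₀ hρ (by simp at hi; omega))
    calc ‖p.coeff i‖ * ‖x‖ ^ i ≤ (p.natDegree.choose i * p.mahlerMeasure) * ρ ^ p.natDegree := by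
          have := p.mahlerMeasure_nonneg
          gcongr
      _ = _ := by ring
  · rw [← Finset.sum_mul]
    have := Nat.sum_range_choose p.natDegree
    have h3 : (∑ i ∈ Finset.range (p.natDegree + 1), (p.natDegree.choose i : ℝ))
        = 2 ^ p.natDegree := by exact_mod_cast this
    rw [h3, mul_pow]
    apply le_of_eq; ring

lemma norm_taylor_coeff_le (p : ℂ[X]) (hp : 1 ≤ p.mahlerMeasure) (θ : ℂ) (k : ℕ) :
    ‖(taylor θ p).coeff k‖ ≤ (4 * (1 + ‖θ‖)) ^ p.natDegree * p.mahlerMeasure := by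
  have h1 := norm_coeff_le_choose_mul_mahlerMeasure k (taylor θ p)
  rw [natDegree_taylor] at h1
  have h2 : (p.natDegree.choose k : ℝ) ≤ 2 ^ p.natDegree := by
    exact_mod_cast Nat.choose_le_two_pow _ _
  have h3 : (taylor θ p).mahlerMeasure ≤ (2 * (1 + ‖θ‖)) ^ p.natDegree * p.mahlerMeasure := by
    apply mahlerMeasure_le_of_forall_norm_eval_le
    · exact one_le_mul_of_one_le_of_one_le
        (one_le_pow₀ (by linarith [norm_nonneg θ])) hp
    · intro x hx
      rw [taylor_eval]
      apply norm_eval_le_mahlerMeasure p (by linarith [norm_nonneg θ])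
      calc ‖x + θ‖ ≤ ‖x‖ + ‖θ‖ := norm_add_le _ _
        _ = _ := by rw [hx]
  calc _ ≤ _ := h1
    _ ≤ 2 ^ p.natDegree * ((2 * (1 + ‖θ‖)) ^ p.natDegree * p.mahlerMeasure) := by
      gcongr
      exact mahlerMeasure_nonneg _
    _ = _ := by rw [← mul_assoc, ← mul_pow]; ring

lemma norm_resultant_le (f g : ℂ[X]) (θ : ℂ) (hf : 0 < f.natDegree) {c c' ε : ℝ}
    (hε : 0 ≤ ε) (hc : 1 ≤ c) (hc' : 1 ≤ c')
    (h1 : ∀ k, ‖(taylor θ f).coeff k‖ ≤ c) (h2 : ∀ k, ‖(taylor θ g).coeff k‖ ≤ c')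
    (h3 : ‖f.eval θ‖ ≤ ε) (h4 : ‖g.eval θ‖ ≤ ε) :
    ‖f.resultant g‖ ≤
      (f.natDegree + g.natDegree).factorial * (ε * (c ^ g.natDegree * c' ^ f.natDegree)) := by
  rw [← resultant_taylor f g θ]
  have hpos : 0 < f.natDegree + g.natDegree := by omega
  have e1 : (taylor θ f).natDegree = f.natDegree := natDegree_taylor _ _
  have e2 : (taylor θ g).natDegree = g.natDegree := natDegree_taylor _ _
  rw [e1, e2, resultant]
  generalize hm : f.natDegree = m at *
  generalize hn : g.natDegree = n at *
  have : NeZero (m + n) := ⟨by omega⟩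
  have key := norm_det_le_of_entry_le (sylvester (taylor θ f) (taylor θ g) m n)
    (fun i => if i = 0 then ε else 1)
    (fun j => Fin.addCases (motive := fun _ => ℝ) (fun _ => c') (fun _ => c) j) ?_
  · refine key.trans (le_of_eq ?_)
    rw [Finset.prod_ite_eq' , Fin.prod_univ_add]
    simp
    ring_nf
    simp
  · intro i j
    induction j using Fin.addCases with
    | left j =>
      simp only [sylvester, Matrix.of_apply, Fin.addCases_left]
      by_cases hi : i = 0
      · subst hi
        simp only [if_true]
        split_ifs with h
        · have : ‖(taylor θ g).coeff ((0 : Fin (m + n)) - (j : ℕ))‖ ≤ ε := by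
            simpa [taylor_coeff_zero] using h4
          exact this.trans (le_mul_of_one_le_right hε hc')
        · simp; positivity
      · simp only [if_neg hi]
        split_ifs with h
        · simpa using h2 _
        · simp; positivity
    | right j =>
      simp only [sylvester, Matrix.of_apply, Fin.addCases_right]
      by_cases hi : i = 0
      · subst hi
        simp only [if_true]
        split_ifs with h
        · have : ‖(taylor θ f).coeff ((0 : Fin (m + n)) - (j : ℕ))‖ ≤ ε := by
            simpa [taylor_coeff_zero] using h3
          exact this.trans (le_mul_of_one_le_right hε hc)
        · simp; positivity
      · simp only [if_neg hi]
        split_ifs with h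
        · simpa using h1 _
        · simp; positivity

/-- Degree plus logarithmic Mahler measure of an integer polynomial. -/
noncomputable def polySize (Q : ℤ[X]) : ℝ :=
  Q.natDegree + (Q.map (Int.castRingHom ℂ)).logMahlerMeasure

lemma logMahlerMeasure_int_nonneg (Q : ℤ[X]) :
    0 ≤ (Q.map (Int.castRingHom ℂ)).logMahlerMeasure := by
  by_cases hQ : Q = 0
  · simp [hQ]
  rw [logMahlerMeasure_eq_log_MahlerMeasure]
  exact Real.log_nonneg (one_le_mahlerMeasure_of_ne_zero hQ)

lemma natDegree_le_polySize (Q : ℤ[X]) : (Q.natDegree : ℝ) ≤ polySize Q := by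
  have := logMahlerMeasure_int_nonneg Q
  unfold polySize; linarith

lemma polySize_nonneg (Q : ℤ[X]) : 0 ≤ polySize Q :=
  (Nat.cast_nonneg _).trans (natDegree_le_polySize Q)

lemma polySize_mul {P Q : ℤ[X]} (hP : P ≠ 0) (hQ : Q ≠ 0) :
    polySize (P * Q) = polySize P + polySize Q := by
  unfold polySize
  have hinj : Function.Injective (Int.castRingHom ℂ) := Int.cast_injective
  have h : P.map (Int.castRingHom ℂ) * Q.map (Int.castRingHom ℂ) ≠ 0 :=
    mul_ne_zero ((Polynomial.map_ne_zero_iff hinj).2 hP) ((Polynomial.map_ne_zero_iff hinj).2 hQ)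
  rw [natDegree_mul hP hQ, Polynomial.map_mul, logMahlerMeasure_mul_eq_add_logMahlerMeasure h]
  push_cast; ring

/-- Some irreducible factor inherits a small value. -/
lemma exists_irreducible_factor_small (θ : ℂ) {l : ℝ} (hl : 0 < l) (R : ℤ[X])
    (h0 : aeval θ R ≠ 0) (h : Real.log ‖aeval θ R‖ < -l * polySize R) :
    ∃ Q, Irreducible Q ∧ Q ∣ R ∧ Real.log ‖aeval θ Q‖ < -l * polySize Q := by
  induction R using WfDvdMonoid.induction_on_irreducible with
  | zero => simp at h0
  | unit u hu =>
    exfalso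
    have h1 : ‖aeval θ u‖ = 1 := by
      obtain ⟨r, hr, rfl⟩ := Polynomial.isUnit_iff.1 hu
      rcases Int.isUnit_iff.1 hr with rfl | rfl <;> simp
    have := polySize_nonneg u
    rw [h1, Real.log_one] at h
    nlinarith
  | mul a i ha hi ih =>
    by_cases hsm : Real.log ‖aeval θ i‖ < -l * polySize i
    · exact ⟨i, hi, dvd_mul_right _ _, hsm⟩
    · rw [map_mul] at h0 h
      obtain ⟨hi0, ha0⟩ := mul_ne_zero_iff.1 h0
      rw [norm_mul, Real.log_mul (norm_ne_zero_iff.2 hi0) (norm_ne_zero_iff.2 ha0),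
        polySize_mul hi.ne_zero ha] at h
      obtain ⟨Q, hQ, hQd, hQs⟩ := ih ha0 (by push Not at hsm; linarith)
      exact ⟨Q, hQ, hQd.mul_left _, hQs⟩

lemma natDegree_pos_of_small (θ : ℂ) {l : ℝ} (hl : 0 < l) {Q : ℤ[X]} (h0 : aeval θ Q ≠ 0)
    (h : Real.log ‖aeval θ Q‖ < -l * polySize Q) : 0 < Q.natDegree := by
  by_contra hd
  obtain ⟨a, rfl⟩ := Polynomial.natDegree_eq_zero.1 (Nat.eq_zero_of_not_pos hd)
  have ha : a ≠ 0 := by rintro rfl; simp at h0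
  have h1 : 0 ≤ Real.log ‖aeval θ (C a : ℤ[X])‖ := by
    apply Real.log_nonneg
    rw [aeval_C, algebraMap_int_eq, eq_intCast, Complex.norm_intCast]
    exact_mod_cast Int.one_le_abs ha
  have := polySize_nonneg (C a)
  nlinarith

lemma resultant_ne_zero_of_not_associated {P Q : ℤ[X]} (hP : Irreducible P) (hQ : Irreducible Q)
    (hPd : 0 < P.natDegree) (hQd : 0 < Q.natDegree) (h : ¬ Associated P Q) :
    P.resultant Q ≠ 0 := by
  have hPp := hP.isPrimitive hPd.ne'
  have hQp := hQ.isPrimitive hQd.ne'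
  have hinj : Function.Injective (Int.castRingHom ℚ) := Int.cast_injective
  intro hres
  have h1 := resultant_map_map P Q P.natDegree Q.natDegree (Int.castRingHom ℚ)
  rw [hres, map_zero] at h1
  have h2 : (P.map (Int.castRingHom ℚ)).resultant (Q.map (Int.castRingHom ℚ)) = 0 := by
    rw [natDegree_map_eq_of_injective hinj, natDegree_map_eq_of_injective hinj]
    exact h1
  rw [resultant_eq_zero_iff] at h2
  have h3 := (IsPrimitive.Int.irreducible_iff_irreducible_map_cast hPp).1 hP
  rw [h3.coprime_iff_not_dvd, not_not, ← IsPrimitive.Int.dvd_iff_map_cast_dvd_map_cast P Q hPp]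
    at h2
  exact h (hP.associated_of_dvd hQ h2.2)

lemma resultant_bound_contradiction {d d' p q e F K T l : ℝ} (hd : 1 ≤ d) (hd' : 1 ≤ d')
    (hp : 0 ≤ p) (hq : 0 ≤ q) (hPT : d + p ≤ T) (hQT : d' + q ≤ T) (hK1 : 1 ≤ K)
    (hlT : 2 * T * (Real.log (2 * T) + K) ≤ l) (he : e < -l * min (d + p) (d' + q))
    (hF : F ≤ (d + d') * Real.log (d + d'))
    (h : 0 ≤ F + (e + (d' * (d * K + p) + d * (d' * K + q)))) : False := by
  have hT : 0 ≤ T := by linarith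
  have hlogT : 0 ≤ Real.log (2 * T) := Real.log_nonneg (by linarith)
  have hfac2 : (d + d') * Real.log (d + d') ≤ 2 * T * Real.log (2 * T) := by
    have hle : d + d' ≤ 2 * T := by linarith
    have := Real.log_le_log (by positivity) hle
    have h3 := Real.log_nonneg (by linarith : (1 : ℝ) ≤ d + d')
    gcongr
  have b1 : d * K + p ≤ K * (d + p) := by nlinarith
  have b2 : d' * K + q ≤ K * (d' + q) := by nlinarith
  have b3 : d' * (d * K + p) + d * (d' * K + q) ≤ K * (d' * (d + p) + d * (d' + q)) := by
    nlinarith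
  have b4 : d' * (d + p) + d * (d' + q) ≤ 2 * T * min (d + p) (d' + q) := by
    rcases min_cases (d + p) (d' + q) with ⟨h, h'⟩ | ⟨h, h'⟩ <;> rw [h]
    · have : d' * (d + p) ≤ T * (d + p) := by gcongr; linarith
      have : d * (d' + q) ≤ (d + p) * T := by gcongr; linarith
      linarith
    · have : d' * (d + p) ≤ (d' + q) * T := by gcongr; linarith
      have : d * (d' + q) ≤ T * (d' + q) := by gcongr; linarith
      linarith
  have hmin : 1 ≤ min (d + p) (d' + q) := le_min (by linarith) (by linarith)
  have b5 : 2 * T * (Real.log (2 * T) + K) * min (d + p) (d' + q)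
    ≤ l * min (d + p) (d' + q) := by gcongr
  have b6 : 2 * T * Real.log (2 * T) ≤ 2 * T * Real.log (2 * T) * min (d + p) (d' + q) :=
    le_mul_of_one_le_right (by positivity) hmin
  have b7 : K * (d' * (d + p) + d * (d' + q)) ≤ K * (2 * T * min (d + p) (d' + q)) := by gcongr
  linarith

lemma associated_of_small (θ : ℂ) {l T : ℝ} (hl : 0 < l) {P Q : ℤ[X]} (hP : Irreducible P)
    (hQ : Irreducible Q) (hP0 : aeval θ P ≠ 0) (hQ0 : aeval θ Q ≠ 0)
    (hPs : Real.log ‖aeval θ P‖ < -l * polySize P) (hQs : Real.log ‖aeval θ Q‖ < -l * polySize Q)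
    (hPT : polySize P ≤ T) (hQT : polySize Q ≤ T)
    (hlT : 2 * T * (Real.log (2 * T) + Real.log (4 * (1 + ‖θ‖))) ≤ l) : Associated P Q := by
  by_contra hass
  have hPd := natDegree_pos_of_small θ hl hP0 hPs
  have hQd := natDegree_pos_of_small θ hl hQ0 hQs
  have hres := resultant_ne_zero_of_not_associated hP hQ hPd hQd hass
  have hinj : Function.Injective (Int.castRingHom ℂ) := Int.cast_injective
  set f := P.map (Int.castRingHom ℂ) with hf
  set g := Q.map (Int.castRingHom ℂ) with hg
  have hfd : f.natDegree = P.natDegree := natDegree_map_eq_of_injective hinj _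
  have hgd : g.natDegree = Q.natDegree := natDegree_map_eq_of_injective hinj _
  have hfM : 1 ≤ f.mahlerMeasure := one_le_mahlerMeasure_of_ne_zero hP.ne_zero
  have hgM : 1 ≤ g.mahlerMeasure := one_le_mahlerMeasure_of_ne_zero hQ.ne_zero
  have hfe : f.eval θ = aeval θ P := by rw [hf, eval_map, aeval_def]; rfl
  have hge : g.eval θ = aeval θ Q := by rw [hg, eval_map, aeval_def]; rfl
  have hK : (1 : ℝ) ≤ 4 * (1 + ‖θ‖) := by linarith [norm_nonneg θ]
  set ε := max ‖aeval θ P‖ ‖aeval θ Q‖ with hε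
  have hε0 : 0 < ε := lt_max_of_lt_left (norm_pos_iff.2 hP0)
  have key := norm_resultant_le f g θ (hfd ▸ hPd) hε0.le
    (one_le_mul_of_one_le_of_one_le (one_le_pow₀ hK (n := f.natDegree)) hfM)
    (one_le_mul_of_one_le_of_one_le (one_le_pow₀ hK (n := g.natDegree)) hgM)
    (norm_taylor_coeff_le f hfM θ) (norm_taylor_coeff_le g hgM θ)
    (by rw [hfe]; exact le_max_left _ _) (by rw [hge]; exact le_max_right _ _)
  have h1 : 1 ≤ ‖f.resultant g‖ := by
    have h1 := resultant_map_map P Q P.natDegree Q.natDegree (Int.castRingHom ℂ)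
    rw [hfd, hgd, h1]
    simp only [eq_intCast, Complex.norm_intCast]
    exact_mod_cast Int.one_le_abs hres
  have h2 := Real.log_nonneg (h1.trans key)
  rw [hfd, hgd] at h2
  set d := P.natDegree
  set d' := Q.natDegree
  have hfac : Real.log ((d + d').factorial : ℝ) ≤ (d + d' : ℝ) * Real.log (d + d') := by
    have : ((d + d').factorial : ℝ) ≤ ((d + d' : ℕ) : ℝ) ^ (d + d') := by
      exact_mod_cast Nat.factorial_le_pow _
    calc _ ≤ Real.log (((d + d' : ℕ) : ℝ) ^ (d + d')) :=
          Real.log_le_log (by exact_mod_cast Nat.factorial_pos _) this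
      _ = _ := by rw [Real.log_pow]; push_cast; ring
  have hp1 : 0 < (4 * (1 + ‖θ‖)) ^ d * f.mahlerMeasure := by positivity
  have hp2 : 0 < (4 * (1 + ‖θ‖)) ^ d' * g.mahlerMeasure := by positivity
  rw [Real.log_mul (by positivity) (by positivity), Real.log_mul (by positivity) (by positivity),
    Real.log_mul (by positivity) (by positivity), Real.log_pow, Real.log_pow,
    Real.log_mul (by positivity) (by positivity), Real.log_mul (by positivity) (by positivity),
    Real.log_pow, Real.log_pow] at h2
  have tP : polySize P = d + Real.log f.mahlerMeasure := by
    rw [polySize, logMahlerMeasure_eq_log_MahlerMeasure]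
  have tQ : polySize Q = d' + Real.log g.mahlerMeasure := by
    rw [polySize, logMahlerMeasure_eq_log_MahlerMeasure]
  set K := Real.log (4 * (1 + ‖θ‖)) with hKdef
  have hK1 : 1 ≤ K := by
    rw [hKdef, Real.le_log_iff_exp_le (by positivity)]
    linarith [Real.exp_one_lt_d9, norm_nonneg θ]
  have hLf := Real.log_nonneg hfM
  have hLg := Real.log_nonneg hgM
  have hd1 : (1 : ℝ) ≤ d := by exact_mod_cast hPd
  have hd1' : (1 : ℝ) ≤ d' := by exact_mod_cast hQd
  have hεlog : Real.log ε < -l * min (polySize P) (polySize Q) := by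
    rw [hε]
    rcases max_choice ‖aeval θ P‖ ‖aeval θ Q‖ with h | h <;> rw [h]
    · exact hPs.trans_le (by nlinarith [min_le_left (polySize P) (polySize Q)])
    · exact hQs.trans_le (by nlinarith [min_le_right (polySize P) (polySize Q)])
  exact resultant_bound_contradiction hd1 hd1' hLf hLg (tP ▸ hPT) (tQ ▸ hQT) hK1 hlT
    (by rwa [tP, tQ] at hεlog) hfac h2

/-- A form of Gelfond's criterion. -/
theorem gelfond_criterion (θ : ℂ) (R : ℕ → ℤ[X]) (n₀ : ℕ)
    (hsize : ∀ n ≥ n₀, polySize (R n) ≤ (n : ℝ) ^ 20)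
    (hne : ∀ n ≥ n₀, aeval θ (R n) ≠ 0)
    (hsmall : ∀ n ≥ n₀, ‖aeval θ (R n)‖ ≤ Real.exp (-(n : ℝ) ^ 44)) : False := by
  set K := Real.log (4 * (1 + ‖θ‖)) with hKdef
  have hK0 : 0 ≤ K := Real.log_nonneg (by linarith [norm_nonneg θ])
  obtain ⟨n₁, hn₁⟩ := exists_nat_gt (2 ^ 21 * (21 + K))
  set m := max (max n₀ n₁) 2
  have hQ : ∀ n : ℕ, ∃ Q : ℤ[X], m ≤ n → Irreducible Q ∧ aeval θ Q ≠ 0 ∧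
      polySize Q ≤ (n : ℝ) ^ 20 ∧ Real.log ‖aeval θ Q‖ < -(n : ℝ) ^ 23 * polySize Q := by
    intro n
    by_cases hn : m ≤ n
    swap
    · exact ⟨0, fun h => absurd h hn⟩
    have hn0 : n₀ ≤ n := le_trans (by simp [m]) hn
    have hn2 : (2 : ℝ) ≤ n := by exact_mod_cast le_trans (le_max_right _ _) hn
    have hR := hne n hn0
    obtain ⟨Q, hQi, hQd, hQs⟩ := exists_irreducible_factor_small θ
      (l := (n : ℝ) ^ 23) (by positivity) (R n) hR (by
        have h1 := Real.log_le_log (norm_pos_iff.2 hR) (hsmall n hn0)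
        rw [Real.log_exp] at h1
        have h2 := hsize n hn0
        have h3 : (n : ℝ) ^ 23 * polySize (R n) ≤ (n : ℝ) ^ 23 * n ^ 20 := by gcongr
        have h4 : (n : ℝ) ^ 23 * n ^ 20 < n ^ 44 := by
          have : 0 < (n : ℝ) ^ 43 := by positivity
          calc (n : ℝ) ^ 23 * (n : ℝ) ^ 20 = (n : ℝ) ^ 43 * 1 := by ring
            _ < (n : ℝ) ^ 43 * n := by gcongr; linarith
            _ = (n : ℝ) ^ 44 := by ring
        linarith)
    obtain ⟨S, hS⟩ := hQd
    have hR0 : R n ≠ 0 := by intro h; simp [h] at hR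
    rw [hS] at hR0
    obtain ⟨a0, b0⟩ := mul_ne_zero_iff.1 hR0
    refine ⟨Q, fun _ => ⟨hQi, ?_, ?_, hQs⟩⟩
    · intro h; apply hR; rw [hS, map_mul, h, zero_mul]
    · have h5 := hsize n hn0
      rw [hS, polySize_mul a0 b0] at h5
      linarith [polySize_nonneg S]
  choose Q hQ using hQ
  have hstep : ∀ n, m ≤ n → Associated (Q n) (Q (n + 1)) := by
    intro n hn
    obtain ⟨a1, a2, a3, a4⟩ := hQ n hn
    obtain ⟨b1, b2, b3, b4⟩ := hQ (n + 1) (by omega)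
    have hn2 : (2 : ℝ) ≤ n := by exact_mod_cast le_trans (le_max_right _ _) hn
    have hnn1 : (n₁ : ℝ) ≤ n := by exact_mod_cast le_trans (by simp [m]) hn
    push_cast at b3 b4
    refine associated_of_small θ (l := (n : ℝ) ^ 23) (T := ((n : ℝ) + 1) ^ 20) (by positivity)
      a1 b1 a2 b2 a4 ?_ ?_ b3 ?_
    · refine b4.trans_le ?_
      have : (n : ℝ) ^ 23 ≤ ((n : ℝ) + 1) ^ 23 := by gcongr; linarith
      nlinarith [polySize_nonneg (Q (n + 1))]
    · exact a3.trans (by gcongr; linarith)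
    · have h1 : Real.log (2 * ((n : ℝ) + 1) ^ 20) ≤ 20 * n + 1 := by
        rw [Real.log_mul (by positivity) (by positivity), Real.log_pow]
        have := Real.log_le_sub_one_of_pos (by positivity : (0 : ℝ) < n + 1)
        have := Real.log_two_lt_d9
        push_cast
        linarith
      have h2 : ((n : ℝ) + 1) ^ 20 ≤ 2 ^ 20 * n ^ 20 := by
        rw [← mul_pow]; gcongr; linarith
      calc 2 * ((n : ℝ) + 1) ^ 20 * (Real.log (2 * ((n : ℝ) + 1) ^ 20) + K)
          ≤ 2 * (2 ^ 20 * n ^ 20) * ((21 + K) * n) := by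
            have : Real.log (2 * ((n : ℝ) + 1) ^ 20) + K ≤ (21 + K) * n := by nlinarith
            have h3 : 0 ≤ Real.log (2 * ((n : ℝ) + 1) ^ 20) := Real.log_nonneg (by
              have : (1 : ℝ) ≤ ((n : ℝ) + 1) ^ 20 := one_le_pow₀ (by linarith)
              linarith)
            gcongr
        _ = n ^ 21 * (2 ^ 21 * (21 + K)) := by ring
        _ ≤ n ^ 21 * n ^ 2 := by gcongr; nlinarith
        _ = _ := by ring
  have hnorm : ∀ n, m ≤ n → ‖aeval θ (Q n)‖ = ‖aeval θ (Q m)‖ := by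
    intro n hn
    induction n, hn using Nat.le_induction with
    | base => rfl
    | succ n hn ih =>
      rw [← ih]
      obtain ⟨u, hu⟩ := hstep n hn
      have h1 : ‖aeval θ (u : ℤ[X])‖ = 1 := by
        obtain ⟨r, hr, hru⟩ := Polynomial.isUnit_iff.1 u.isUnit
        rw [← hru]
        rcases Int.isUnit_iff.1 hr with rfl | rfl <;> simp
      rw [← hu, map_mul, norm_mul, h1, mul_one]
  obtain ⟨a1, a2, a3, a4⟩ := hQ m le_rfl
  obtain ⟨k, hk⟩ := exists_nat_gt (-Real.log ‖aeval θ (Q m)‖)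
  have hmn : m ≤ max m k := le_max_left _ _
  obtain ⟨b1, b2, b3, b4⟩ := hQ (max m k) hmn
  rw [hnorm _ hmn] at b4
  have hd : 0 < (Q (max m k)).natDegree := by
    have h2 : 2 ≤ max m k := le_trans (le_max_right _ _) hmn
    have h2' : (0 : ℝ) < ((max m k : ℕ) : ℝ) := by exact_mod_cast (by omega : 0 < max m k)
    refine natDegree_pos_of_small θ (l := ((max m k : ℕ) : ℝ) ^ 23) (by positivity) b2 ?_
    rw [hnorm _ hmn]; exact b4
  have hs : 1 ≤ polySize (Q (max m k)) :=
    le_trans (by exact_mod_cast hd) (natDegree_le_polySize _)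
  have hkk : (k : ℝ) ≤ ((max m k : ℕ) : ℝ) := by exact_mod_cast le_max_right _ _
  have h2' : (1 : ℝ) ≤ ((max m k : ℕ) : ℝ) := by
    have h2 : 2 ≤ max m k := le_trans (le_max_right _ _) hmn
    exact_mod_cast (by omega : 1 ≤ max m k)
  have h5 : ((max m k : ℕ) : ℝ) ≤ ((max m k : ℕ) : ℝ) ^ 23 := le_self_pow₀ h2' (by norm_num)
  nlinarith

end Gelfond

section NormReduction

open Polynomial

lemma polySize_le_of_norm_le {R : ℤ[X]} (hR : R ≠ 0) {S : ℝ} (hS : 1 ≤ S)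
    (h : ∀ x : ℂ, ‖x‖ ≤ 3 → ‖aeval x R‖ ≤ S) : polySize R ≤ 2 * Real.log S := by
  have hinj : Function.Injective (Int.castRingHom ℂ) := Int.cast_injective
  set f := R.map (Int.castRingHom ℂ) with hf
  have hev : ∀ x, f.eval x = aeval x R := fun x => by rw [hf, eval_map, aeval_def]; rfl
  have hfd : f.natDegree = R.natDegree := natDegree_map_eq_of_injective hinj _
  have h1 : f.logMahlerMeasure ≤ Real.log S := by
    rw [logMahlerMeasure_eq_log_MahlerMeasure]
    apply Real.log_le_log (by linarith [one_le_mahlerMeasure_of_ne_zero hR])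
    exact mahlerMeasure_le_of_forall_norm_eval_le f hS
      (fun x hx => by rw [hev]; exact h x (by rw [hx]; norm_num))
  have h2 : (3 : ℝ) ^ R.natDegree ≤ S := by
    have h3 : (f.comp (C 3 * X)).mahlerMeasure ≤ S := by
      apply mahlerMeasure_le_of_forall_norm_eval_le _ hS
      intro x hx
      rw [eval_comp, hev]
      apply h
      simp [hx]
    refine le_trans ?_ ((leadingCoeff_le_mahlerMeasure _).trans h3)
    rw [leadingCoeff_comp (by rw [natDegree_C_mul_X _ (by norm_num)]; norm_num),
      leadingCoeff_C_mul_X, hfd, norm_mul, norm_pow]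
    have h4 : 1 ≤ ‖f.leadingCoeff‖ := by
      rw [hf, leadingCoeff_map_of_injective hinj, eq_intCast, Complex.norm_intCast]
      exact_mod_cast Int.one_le_abs (leadingCoeff_ne_zero.2 hR)
    have h5 : ‖(3 : ℂ)‖ = 3 := by norm_num
    rw [h5]
    exact le_mul_of_one_le_left (by positivity) h4
  have h3 : (R.natDegree : ℝ) ≤ Real.log S := by
    rw [Real.le_log_iff_exp_le (by linarith)]
    refine le_trans ?_ h2
    rw [← Real.exp_one_pow]
    gcongr
    linarith [Real.exp_one_lt_d9]
  unfold polySize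
  linarith

/-- Sum of the absolute values of the coefficients. -/
noncomputable def mvLength (B : MvPolynomial (Fin 3) ℤ) : ℝ := ∑ e ∈ B.support, |((B.coeff e : ℤ) : ℝ)|

/-- A homogenised substitution of matrices into a polynomial. -/
noncomputable def mvMatrix {S ι : Type*} [CommRing S] [Fintype ι] [DecidableEq ι]
    (B : MvPolynomial (Fin 3) ℤ) (D : ℕ) (b : S) (μ : Fin 3 → Matrix ι ι S) : Matrix ι ι S :=
  ∑ e ∈ B.support, (((B.coeff e : ℤ) : S) * b ^ (D - (e 0 + e 1 + e 2))) •
    (μ 0 ^ e 0 * μ 1 ^ e 1 * μ 2 ^ e 2)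

lemma mvMatrix_map {S S' ι : Type*} [CommRing S] [CommRing S'] [Fintype ι] [DecidableEq ι]
    (B : MvPolynomial (Fin 3) ℤ) (D : ℕ) (b : S) (μ : Fin 3 → Matrix ι ι S) (f : S →+* S') :
    (mvMatrix B D b μ).map f = mvMatrix B D (f b) (fun j => (μ j).map f) := by
  have hs : ∀ (c : S) (A : Matrix ι ι S), f.mapMatrix (c • A) = f c • f.mapMatrix A := by
    intro c A; ext; simp
  change f.mapMatrix (mvMatrix B D b μ) = mvMatrix B D (f b) (fun j => f.mapMatrix (μ j))
  simp only [mvMatrix, map_sum, hs, map_mul, map_pow, map_intCast]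

lemma mvDegree_le {B : MvPolynomial (Fin 3) ℤ} {D : ℕ} (hD : B.totalDegree ≤ D)
    {e : Fin 3 →₀ ℕ} (he : e ∈ B.support) : e 0 + e 1 + e 2 ≤ D := by
  have := (MvPolynomial.le_totalDegree he).trans hD
  rwa [Finsupp.sum_fintype _ _ (by simp), Fin.sum_univ_three] at this

lemma pow_mulVec_eigen {ι : Type*} [Fintype ι] [DecidableEq ι] {A : Matrix ι ι ℂ} {v : ι → ℂ}
    {c : ℂ} (h : A.mulVec v = c • v) (k : ℕ) : (A ^ k).mulVec v = c ^ k • v := by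
  induction k with
  | zero => simp
  | succ k ih =>
    rw [pow_succ, ← Matrix.mulVec_mulVec, h, Matrix.mulVec_smul, ih, smul_smul, pow_succ']

lemma mvMatrix_mulVec {ι : Type*} [Fintype ι] [DecidableEq ι] {B : MvPolynomial (Fin 3) ℤ} {D : ℕ}
    (hD : B.totalDegree ≤ D) (b : ℂ) (μ : Fin 3 → Matrix ι ι ℂ) (ω : Fin 3 → ℂ) (v : ι → ℂ)
    (h : ∀ j, (μ j).mulVec v = (b * ω j) • v) :
    (mvMatrix B D b μ).mulVec v = (b ^ D * MvPolynomial.aeval ω B) • v := by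
  rw [mvMatrix, Matrix.sum_mulVec, MvPolynomial.aeval_def, MvPolynomial.eval₂_eq', Finset.mul_sum,
    Finset.sum_smul]
  refine Finset.sum_congr rfl fun e he => ?_
  rw [Matrix.smul_mulVec, ← Matrix.mulVec_mulVec, ← Matrix.mulVec_mulVec,
    pow_mulVec_eigen (h 2), Matrix.mulVec_smul, pow_mulVec_eigen (h 1), Matrix.mulVec_smul,
    Matrix.mulVec_smul, pow_mulVec_eigen (h 0)]
  simp only [smul_smul]
  congr 1
  have hd := mvDegree_le hD he
  obtain ⟨k, rfl⟩ := Nat.exists_eq_add_of_le hd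
  rw [Nat.add_sub_cancel_left, Fin.prod_univ_three]
  simp only [mul_pow, pow_add, algebraMap_int_eq, eq_intCast]
  ring

lemma norm_mul_entry_le {n : ℕ} {A A' : Matrix (Fin n) (Fin n) ℂ} {E E' : ℝ}
    (hE : 0 ≤ E) (h : ∀ i j, ‖A i j‖ ≤ E) (h' : ∀ i j, ‖A' i j‖ ≤ E') (i j : Fin n) :
    ‖(A * A') i j‖ ≤ n * (E * E') := by
  rw [Matrix.mul_apply]
  refine (norm_sum_le_of_le _ (n := fun _ => E * E') fun k _ => ?_).trans (by simp)
  rw [norm_mul]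
  exact mul_le_mul (h _ _) (h' _ _) (norm_nonneg _) hE

lemma norm_pow_entry_le {n : ℕ} {A : Matrix (Fin n) (Fin n) ℂ} {E : ℝ} (hE : 0 ≤ E)
    (h : ∀ i j, ‖A i j‖ ≤ E) (k : ℕ) (i j : Fin n) : ‖(A ^ k) i j‖ ≤ (n * E) ^ k := by
  induction k generalizing i j with
  | zero =>
    rw [pow_zero, pow_zero, Matrix.one_apply]
    split_ifs <;> simp
  | succ k ih =>
    rw [pow_succ]
    refine (norm_mul_entry_le (by positivity) ih h i j).trans (le_of_eq ?_)
    ring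

lemma norm_mvMatrix_entry_le {n : ℕ} (hn : 1 ≤ n) {B : MvPolynomial (Fin 3) ℤ} {D : ℕ}
    (hD : B.totalDegree ≤ D) {b : ℂ} {μ : Fin 3 → Matrix (Fin n) (Fin n) ℂ} {E : ℝ} (hE : 1 ≤ E)
    (hb : ‖b‖ ≤ E) (h : ∀ l i j, ‖μ l i j‖ ≤ E) (i j : Fin n) :
    ‖mvMatrix B D b μ i j‖ ≤ mvLength B * (n ^ 2 * (n * E) ^ D) := by
  rw [mvMatrix, Matrix.sum_apply, mvLength, Finset.sum_mul]
  refine norm_sum_le_of_le _ fun e he => ?_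
  have hn' : (1 : ℝ) ≤ n := by exact_mod_cast hn
  have hE0 : 0 ≤ E := by linarith
  rw [Matrix.smul_apply, smul_eq_mul, norm_mul, norm_mul, Complex.norm_intCast, norm_pow, mul_assoc]
  refine mul_le_mul_of_nonneg_left ?_ (abs_nonneg _)
  have h1 := norm_mul_entry_le (by positivity) (norm_mul_entry_le (by positivity)
    (norm_pow_entry_le hE0 (h 0) (e 0)) (norm_pow_entry_le hE0 (h 1) (e 1)))
    (norm_pow_entry_le hE0 (h 2) (e 2)) i j
  have hd := mvDegree_le hD he
  obtain ⟨k, rfl⟩ := Nat.exists_eq_add_of_le hd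
  rw [Nat.add_sub_cancel_left]
  have h2 : ‖b‖ ^ k ≤ (n * E) ^ k := by
    gcongr
    exact hb.trans (le_mul_of_one_le_left hE0 hn')
  calc _ ≤ (n * E) ^ k * (n * (n * ((n * E) ^ e 0 * (n * E) ^ e 1) * (n * E) ^ e 2)) := by gcongr
    _ = _ := by ring

lemma norm_charpoly_coeff_le {n : ℕ} (A : Matrix (Fin n) (Fin n) ℂ) {W : ℝ} (hW : 1 ≤ W)
    (h : ∀ i j, ‖A i j‖ ≤ W) (s : ℕ) :
    ‖A.charpoly.coeff s‖ ≤ 2 ^ n * (n.factorial * (2 * W) ^ n) := by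
  have h1 := norm_coeff_le_choose_mul_mahlerMeasure s A.charpoly
  rw [Matrix.charpoly_natDegree_eq_dim, Fintype.card_fin] at h1
  have h2 : (n.choose s : ℝ) ≤ 2 ^ n := by exact_mod_cast Nat.choose_le_two_pow _ _
  refine h1.trans (mul_le_mul h2 ?_ (mahlerMeasure_nonneg _) (by positivity))
  apply mahlerMeasure_le_of_forall_norm_eval_le
  · exact one_le_mul_of_one_le_of_one_le (by exact_mod_cast Nat.factorial_pos n)
      (one_le_pow₀ (by linarith))
  · intro y hy
    rw [Matrix.eval_charpoly]
    refine (norm_det_le_of_entry_le _ (fun _ => 2 * W) (fun _ => 1) fun i j => ?_).trans (by simp)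
    rw [Matrix.sub_apply, mul_one]
    have : ‖(Matrix.scalar (Fin n)) y i j‖ ≤ 1 := by
      rw [Matrix.scalar_apply, Matrix.diagonal_apply]
      split_ifs <;> simp [hy]
    linarith [norm_sub_le ((Matrix.scalar (Fin n)) y i j) (A i j), h i j]

/-- The lowest nonzero coefficient of a polynomial having `β ≠ 0` as a root is small. -/
lemma norm_trailingCoeff_le_of_root {p : ℂ[X]} {β : ℂ} (hβ : β ≠ 0) (hp : p.eval β = 0)
    {S V : ℝ} (hV : 1 ≤ V) (hβV : ‖β‖ ≤ V) (hS : ∀ k, ‖p.coeff k‖ ≤ S) :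
    ‖p.trailingCoeff‖ ≤ ‖β‖ * ((p.natDegree + 1) * (S * V ^ p.natDegree)) := by
  set s := p.natTrailingDegree with hs
  have hS0 : 0 ≤ S := (norm_nonneg _).trans (hS 0)
  have h1 : p.coeff s * β ^ s = - ∑ k ∈ (Finset.range (p.natDegree + 1)).erase s,
      p.coeff k * β ^ k := by
    rw [eval_eq_sum_range, ← Finset.add_sum_erase _ _ (a := s)] at hp
    · exact eq_neg_of_add_eq_zero_left hp
    · simp [hs, natTrailingDegree_le_natDegree]
  have h2 : ‖p.coeff s * β ^ s‖ ≤ (p.natDegree + 1) * (S * V ^ p.natDegree * ‖β‖ * ‖β‖ ^ s) := by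
    rw [h1, norm_neg]
    refine (norm_sum_le_of_le _ (n := fun _ => S * V ^ p.natDegree * ‖β‖ * ‖β‖ ^ s)
      fun k hk => ?_).trans ?_
    · rw [Finset.mem_erase, Finset.mem_range] at hk
      by_cases hks : k < s
      · rw [coeff_eq_zero_of_lt_natTrailingDegree hks]
        simp; positivity
      · obtain ⟨j, rfl⟩ := Nat.exists_eq_add_of_lt (lt_of_le_of_ne (not_lt.1 hks) (Ne.symm hk.1))
        rw [norm_mul, norm_pow]
        calc ‖p.coeff (s + j + 1)‖ * ‖β‖ ^ (s + j + 1) ≤ S * ‖β‖ ^ (s + j + 1) := by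
              gcongr; exact hS _
          _ = S * ‖β‖ ^ j * ‖β‖ * ‖β‖ ^ s := by ring
          _ ≤ S * V ^ p.natDegree * ‖β‖ * ‖β‖ ^ s := by
              gcongr
              exact (pow_le_pow_left₀ (norm_nonneg _) hβV j).trans
                (pow_le_pow_right₀ hV (by omega))
    · rw [Finset.sum_const, nsmul_eq_mul]
      gcongr
      refine le_trans (Nat.cast_le.2 (Finset.card_le_card (Finset.erase_subset _ _))) ?_
      simp
  rw [norm_mul, norm_pow] at h2
  have h3 : 0 < ‖β‖ ^ s := pow_pos (norm_pos_iff.2 hβ) _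
  rw [trailingCoeff, ← hs]
  refine le_of_mul_le_mul_right (h2.trans (le_of_eq ?_)) h3
  ring

lemma exists_matrices (θ : ℂ) (ω : Fin 3 → ℂ)
    (halg : ∀ j, IsAlgebraic (Algebra.adjoin ℤ {θ}) (ω j)) :
    ∃ (n : ℕ) (v : Fin n → ℂ) (b : ℤ[X]) (μ : Fin 3 → Matrix (Fin n) (Fin n) ℤ[X]),
      v ≠ 0 ∧ aeval θ b ≠ 0 ∧
      ∀ j, ((μ j).map (aeval θ)).mulVec v = (aeval θ b * ω j) • v := by
  set R₀ := Algebra.adjoin ℤ {θ} with hR₀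
  have hrep : ∀ c : R₀, ∃ p : ℤ[X], aeval θ p = (c : ℂ) := by
    intro c
    exact (Algebra.adjoin_singleton_eq_range_aeval ℤ θ).le c.2
  choose rep hrep using hrep
  choose y hy0 hyi using fun j => (halg j).exists_integral_multiple
  set c : R₀ := ∏ j, y j with hc
  have hc0 : c ≠ 0 := Finset.prod_ne_zero_iff.2 fun j _ => hy0 j
  have hintegral : ∀ j, IsIntegral R₀ ((c : ℂ) * ω j) := by
    intro j
    have h2 := IsIntegral.mul (isIntegral_algebraMap (R := R₀) (A := ℂ)
      (x := ∏ i ∈ Finset.univ.erase j, y i)) (hyi j)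
    have h3 : (c : ℂ) * ω j
        = algebraMap R₀ ℂ (∏ i ∈ Finset.univ.erase j, y i) * y j • ω j := by
      rw [hc, ← Finset.mul_prod_erase _ _ (Finset.mem_univ j), Algebra.smul_def, Subalgebra.coe_mul]
      simp only [Subalgebra.algebraMap_def, Algebra.algebraMap_self, RingHom.id_apply]
      ring
    rw [h3]; exact h2
  set S := Algebra.adjoin R₀ (Set.range fun j => (c : ℂ) * ω j)
  have hfg := fg_adjoin_of_finite (R := R₀) (Set.finite_range fun j => (c : ℂ) * ω j)
    (by rintro _ ⟨j, rfl⟩; exact hintegral j)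
  obtain ⟨n, v, hv⟩ := Submodule.fg_iff_exists_fin_generating_family.1 hfg
  have hmem : ∀ j i, ∃ a : Fin n → R₀, ∑ k, a k • v k = (c : ℂ) * ω j * v i := by
    intro j i
    rw [← Submodule.mem_span_range_iff_exists_fun, hv, Subalgebra.mem_toSubmodule]
    refine Subalgebra.mul_mem _ (Algebra.subset_adjoin ⟨j, rfl⟩) ?_
    rw [← Subalgebra.mem_toSubmodule, ← hv]
    exact Submodule.subset_span ⟨i, rfl⟩
  choose a ha using hmem
  refine ⟨n, v, rep c, fun j => Matrix.of fun i k => rep (a j i k), ?_, ?_, ?_⟩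
  · rintro rfl
    have h1 : (1 : ℂ) ∈ Subalgebra.toSubmodule S := S.one_mem
    rw [← hv] at h1
    have : Set.range (0 : Fin n → ℂ) ⊆ {0} := by rintro _ ⟨i, rfl⟩; simp
    have h3 := Submodule.span_mono (R := R₀) this h1
    simp at h3
  · rw [hrep]; simpa using hc0
  · intro j
    ext i
    rw [Pi.smul_apply, smul_eq_mul, hrep, ← ha j i]
    simp only [Matrix.mulVec, dotProduct, Matrix.map_apply, Matrix.of_apply, hrep]
    rfl

lemma norm_aeval_le_mvLength {B : MvPolynomial (Fin 3) ℤ} {D : ℕ} (hD : B.totalDegree ≤ D)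
    {ω : Fin 3 → ℂ} {E : ℝ} (hE : 1 ≤ E) (h : ∀ j, ‖ω j‖ ≤ E) :
    ‖MvPolynomial.aeval ω B‖ ≤ mvLength B * E ^ D := by
  rw [MvPolynomial.aeval_def, MvPolynomial.eval₂_eq', mvLength, Finset.sum_mul]
  refine norm_sum_le_of_le _ fun e he => ?_
  rw [norm_mul, algebraMap_int_eq, eq_intCast, Complex.norm_intCast, Fin.prod_univ_three, norm_mul,
    norm_mul, norm_pow, norm_pow, norm_pow]
  gcongr
  calc _ ≤ E ^ e 0 * E ^ e 1 * E ^ e 2 := by gcongr <;> exact h _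
    _ = E ^ (e 0 + e 1 + e 2) := by ring
    _ ≤ _ := pow_le_pow_right₀ hE (mvDegree_le hD he)

lemma exists_bound_aeval (ρ : ℝ) (p : ℤ[X]) : ∃ E : ℝ, ∀ x : ℂ, ‖x‖ ≤ ρ → ‖aeval x p‖ ≤ E := by
  have hc : Continuous fun x : ℂ => aeval x p := by
    have : (fun x : ℂ => aeval x p) = fun x => (p.map (Int.castRingHom ℂ)).eval x := by
      ext x; rw [eval_map, aeval_def]; rfl
    rw [this]; fun_prop
  obtain ⟨E, hE⟩ := (isCompact_closedBall (0 : ℂ) ρ).exists_bound_of_continuousOn hc.continuousOn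
  exact ⟨E, fun x hx => hE x (by simpa using hx)⟩

lemma size_bound {n A h D : ℝ} (hn : 0 ≤ n) (hA : 0 ≤ A) (hh : 0 ≤ h) (hD : 0 ≤ D) :
    D * A + (A + (A + n * (A + (h + A + D * A)) + n * (h + 2 * (D * A))))
      ≤ 10 * (n + 1) * (A + 1) * (D + h + 1) := by
  rw [← sub_nonneg]
  ring_nf
  positivity

lemma size_bound_two {n A h D : ℝ} (hn : 0 ≤ n) (hA : 0 ≤ A) (hh : 0 ≤ h) (hD : 0 ≤ D) :
    2 * (A + n * (A + (h + A + D * A))) ≤ 10 * (n + 1) * (A + 1) * (D + h + 1) := by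
  rw [← sub_nonneg]
  ring_nf
  positivity

theorem norm_reduction (θ : ℂ) (ω : Fin 3 → ℂ)
    (halg : ∀ j, IsAlgebraic (Algebra.adjoin ℤ {θ}) (ω j)) :
    ∃ K : ℝ, 1 ≤ K ∧ ∀ (D : ℕ) (h : ℝ) (B : MvPolynomial (Fin 3) ℤ), 0 ≤ h →
      B.totalDegree ≤ D → mvLength B ≤ Real.exp h → MvPolynomial.aeval ω B ≠ 0 →
      ∃ R : ℤ[X], aeval θ R ≠ 0 ∧ polySize R ≤ K * (D + h + 1) ∧
        ‖aeval θ R‖ ≤ ‖MvPolynomial.aeval ω B‖ * Real.exp (K * (D + h + 1)) := by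
  obtain ⟨n, v, b, μ, hv, hb, hμ⟩ := exists_matrices θ ω halg
  have hn : 1 ≤ n := by
    by_contra h0
    obtain rfl : n = 0 := by omega
    exact hv (Subsingleton.elim _ _)
  choose Eμ hEμ using fun l i j => exists_bound_aeval (3 + ‖θ‖) (μ l i j)
  obtain ⟨Eb, hEb⟩ := exists_bound_aeval (3 + ‖θ‖) b
  set E : ℝ := 1 + |Eb| + ∑ l, ∑ i, ∑ j, |Eμ l i j| + ∑ j, ‖ω j‖ with hE
  have hsum0 : 0 ≤ ∑ l, ∑ i, ∑ j, |Eμ l i j| := by positivity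
  have hsum1 : 0 ≤ ∑ j, ‖ω j‖ := by positivity
  have hE1 : 1 ≤ E := by linarith [abs_nonneg Eb]
  have hbE : ∀ x : ℂ, ‖x‖ ≤ 3 + ‖θ‖ → ‖aeval x b‖ ≤ E := fun x hx => by
    linarith [hEb x hx, le_abs_self Eb]
  have hμE : ∀ x : ℂ, ‖x‖ ≤ 3 + ‖θ‖ → ∀ l i j, ‖aeval x (μ l i j)‖ ≤ E := by
    intro x hx l i j
    have h1 : |Eμ l i j| ≤ ∑ l, ∑ i, ∑ j, |Eμ l i j| :=
      (Finset.single_le_sum (f := fun j => |Eμ l i j|) (fun _ _ => abs_nonneg _)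
        (Finset.mem_univ j)).trans
      ((Finset.single_le_sum (f := fun i => ∑ j, |Eμ l i j|)
        (fun _ _ => by positivity) (Finset.mem_univ i)).trans
      (Finset.single_le_sum (f := fun l => ∑ i, ∑ j, |Eμ l i j|)
        (fun _ _ => by positivity) (Finset.mem_univ l)))
    linarith [hEμ l i j x hx, le_abs_self (Eμ l i j), abs_nonneg Eb]
  have hωE : ∀ j, ‖ω j‖ ≤ E := fun j => by
    have := Finset.single_le_sum (f := fun j => ‖ω j‖) (fun _ _ => norm_nonneg _)
      (Finset.mem_univ j)
    linarith [abs_nonneg Eb]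
  have hn' : (1 : ℝ) ≤ n := by exact_mod_cast hn
  obtain ⟨A, hA⟩ : ∃ A : ℝ, A = Real.log (2 ^ n * n.factorial * (n + 1) * 2 * n ^ 2 * (n * E)) :=
    ⟨_, rfl⟩
  have hfac : (1 : ℝ) ≤ n.factorial := by exact_mod_cast Nat.factorial_pos n
  have hprod : ∀ a c : ℝ, 1 ≤ a → 1 ≤ c → 1 ≤ a * c := fun a c => one_le_mul_of_one_le_of_one_le
  have hexpA : Real.exp A = 2 ^ n * n.factorial * (n + 1) * 2 * n ^ 2 * (n * E) := by
    rw [hA, Real.exp_log (by positivity)]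
  have h2n : (1 : ℝ) ≤ 2 ^ n := one_le_pow₀ (by norm_num)
  have hn2 : (1 : ℝ) ≤ (n : ℝ) ^ 2 := one_le_pow₀ hn'
  have hnE : 1 ≤ n * E := hprod _ _ hn' hE1
  have hA0 : 0 ≤ A := by
    rw [hA]; apply Real.log_nonneg
    repeat' first | assumption | linarith | apply hprod
  have hAnE : n * E ≤ Real.exp A := by
    rw [hexpA]; refine le_mul_of_one_le_left (by positivity) ?_
    repeat' first | assumption | linarith | apply hprod
  have hAE : E ≤ Real.exp A := le_trans (le_mul_of_one_le_left (by positivity) hn') hAnE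
  have hAn2 : (n : ℝ) ^ 2 ≤ Real.exp A := by
    rw [hexpA, mul_comm _ (n ^ 2 : ℝ), mul_assoc]; refine le_mul_of_one_le_right (by positivity) ?_
    repeat' first | assumption | linarith | apply hprod
  have hA2 : (2 : ℝ) ≤ Real.exp A := by
    rw [hexpA, mul_comm _ (2 : ℝ), mul_assoc, mul_assoc]
    refine le_mul_of_one_le_right (by positivity) ?_
    repeat' first | assumption | linarith | apply hprod
  have hAn1 : (n : ℝ) + 1 ≤ Real.exp A := by
    rw [hexpA, mul_comm _ ((n : ℝ) + 1), mul_assoc, mul_assoc, mul_assoc]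
    refine le_mul_of_one_le_right (by positivity) ?_
    repeat' first | assumption | linarith | apply hprod
  have hA2n : 2 ^ n * (n.factorial : ℝ) ≤ Real.exp A := by
    rw [hexpA]
    simp only [mul_assoc]
    refine mul_le_mul_of_nonneg_left ?_ (by positivity)
    refine le_mul_of_one_le_right (by positivity) ?_
    repeat' first | assumption | linarith | apply hprod
  refine ⟨10 * (n + 1) * (A + 1), ?_, ?_⟩
  · have : (1 : ℝ) ≤ (n + 1) * (A + 1) := hprod _ _ (by linarith) (by linarith)
    linarith
  intro D h B hh hD hL hB
  set m := mvMatrix B D b μ with hm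
  obtain ⟨W, hW⟩ : ∃ W : ℝ, W = Real.exp (h + A + D * A) := ⟨_, rfl⟩
  have hW1 : 1 ≤ W := by rw [hW]; exact Real.one_le_exp (by positivity)
  have hmx : ∀ x : ℂ, ‖x‖ ≤ 3 + ‖θ‖ → ∀ i j, ‖(m.map (aeval x)) i j‖ ≤ W := by
    intro x hx i j
    have e1 : m.map (aeval x) = mvMatrix B D (aeval x b) (fun j => (μ j).map (aeval x)) :=
      mvMatrix_map B D b μ (aeval x : ℤ[X] →ₐ[ℤ] ℂ).toRingHom
    rw [e1]
    refine (norm_mvMatrix_entry_le hn hD hE1 (hbE x hx) (fun l i j => hμE x hx l i j) i j).trans ?_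
    rw [hW, add_assoc, Real.exp_add, Real.exp_add, Real.exp_nat_mul]
    gcongr
  obtain ⟨S, hS⟩ : ∃ S : ℝ, S = Real.exp (A + n * (A + (h + A + D * A))) := ⟨_, rfl⟩
  have hS1 : 1 ≤ S := by rw [hS]; exact Real.one_le_exp (by positivity)
  have hcoef : ∀ x : ℂ, ‖x‖ ≤ 3 + ‖θ‖ → ∀ s, ‖aeval x (m.charpoly.coeff s)‖ ≤ S := by
    intro x hx s
    have e1 : aeval x (m.charpoly.coeff s) = (m.map (aeval x)).charpoly.coeff s := by
      have := Matrix.charpoly_map m (aeval x : ℤ[X] →ₐ[ℤ] ℂ).toRingHom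
      erw [this]
      rw [coeff_map]; rfl
    rw [e1]
    refine (norm_charpoly_coeff_le _ hW1 (hmx x hx) s).trans ?_
    rw [hS, Real.exp_add, Real.exp_nat_mul, Real.exp_add A, ← hW, ← mul_assoc]
    gcongr
  set p := (m.map (aeval θ)).charpoly with hp
  set β := (aeval θ b) ^ D * MvPolynomial.aeval ω B with hβ
  have hβ0 : β ≠ 0 := mul_ne_zero (pow_ne_zero _ hb) hB
  have hroot : p.eval β = 0 := by
    rw [hp, Matrix.eval_charpoly, ← Matrix.exists_mulVec_eq_zero_iff]
    refine ⟨v, hv, ?_⟩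
    have e1 : m.map (aeval θ) = mvMatrix B D (aeval θ b) (fun j => (μ j).map (aeval θ)) :=
      mvMatrix_map B D b μ (aeval θ : ℤ[X] →ₐ[ℤ] ℂ).toRingHom
    rw [Matrix.sub_mulVec, e1, mvMatrix_mulVec hD _ _ ω v hμ, sub_eq_zero, ← hβ]
    ext i
    simp [Matrix.scalar_apply, Matrix.mulVec_diagonal]
  have hθρ : ‖θ‖ ≤ 3 + ‖θ‖ := by linarith
  have hpc : ∀ s, p.coeff s = aeval θ (m.charpoly.coeff s) := by
    intro s
    have := Matrix.charpoly_map m (aeval θ : ℤ[X] →ₐ[ℤ] ℂ).toRingHom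
    rw [hp]
    erw [this]
    rw [coeff_map]; rfl
  have hpd : p.natDegree = n := by simp [hp, Matrix.charpoly_natDegree_eq_dim]
  have hp0 : p ≠ 0 := (Matrix.charpoly_monic _).ne_zero
  have htr : aeval θ (m.charpoly.coeff p.natTrailingDegree) = p.trailingCoeff := (hpc _).symm
  have htr0 : aeval θ (m.charpoly.coeff p.natTrailingDegree) ≠ 0 := by
    rw [htr]; exact trailingCoeff_nonzero_iff_nonzero.2 hp0
  refine ⟨m.charpoly.coeff p.natTrailingDegree, htr0, ?_, ?_⟩
  · have h1 := polySize_le_of_norm_le (R := m.charpoly.coeff p.natTrailingDegree)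
      (fun h0 => htr0 (by rw [h0, map_zero])) hS1
      (fun x hx => hcoef x (by linarith [norm_nonneg θ]) _)
    refine h1.trans ?_
    rw [hS, Real.log_exp]
    have hD0 : (0 : ℝ) ≤ D := Nat.cast_nonneg _
    exact size_bound_two (by linarith) hA0 hh hD0
  · obtain ⟨V, hV⟩ : ∃ V : ℝ, V = Real.exp (h + 2 * (D * A)) := ⟨_, rfl⟩
    have hV1 : 1 ≤ V := by rw [hV]; exact Real.one_le_exp (by positivity)
    have hbD : ‖aeval θ b‖ ^ D ≤ Real.exp (D * A) := by
      rw [Real.exp_nat_mul]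
      gcongr
      exact (hbE θ hθρ).trans hAE
    have hβV : ‖β‖ ≤ V := by
      rw [hβ, norm_mul, norm_pow, hV]
      have h1 := norm_aeval_le_mvLength hD hE1 hωE
      have h2 : E ^ D ≤ Real.exp (D * A) := by
        rw [Real.exp_nat_mul]; gcongr
      calc _ ≤ Real.exp (D * A) * (Real.exp h * Real.exp (D * A)) := by
            gcongr
            exact h1.trans (by gcongr)
        _ = _ := by rw [← Real.exp_add, ← Real.exp_add]; congr 1; ring
    have h1 := norm_trailingCoeff_le_of_root hβ0 hroot hV1 hβV
      (fun k => by rw [hpc]; exact hcoef θ hθρ k)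
    rw [htr]
    refine h1.trans ?_
    rw [hβ, norm_mul, norm_pow, hpd, mul_comm (‖aeval θ b‖ ^ D), mul_assoc]
    gcongr
    calc _ ≤ Real.exp (D * A) * (Real.exp A * (S * V ^ n)) := by gcongr
      _ = Real.exp (D * A + (A + (A + n * (A + (h + A + D * A)) + n * (h + 2 * (D * A))))) := by
          rw [hS, hV, ← Real.exp_nat_mul]; simp only [Real.exp_add]
      _ ≤ _ := by
          apply Real.exp_le_exp.2
          have hD0 : (0 : ℝ) ≤ D := Nat.cast_nonneg _
          exact size_bound (by linarith) hA0 hh hD0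

end NormReduction

section CommonZero

open Polynomial

lemma exists_irreducible_dvd_of_root {A : Type*} [CommRing A] [IsDomain A]
    [UniqueFactorizationMonoid A] [Algebra A ℂ] {z : ℂ} (p : A[X]) :
    p ≠ 0 → aeval z p = 0 → ∃ r, Irreducible r ∧ r ∣ p ∧ aeval z r = 0 := by
  induction p using WfDvdMonoid.induction_on_irreducible with
  | zero => intro h; exact absurd rfl h
  | unit u hu =>
    intro _ h
    exact absurd h (hu.map (aeval z)).ne_zero
  | mul a i ha hi ih =>
    intro _ h
    rw [map_mul] at h
    rcases mul_eq_zero.mp h with h | h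
    · exact ⟨i, hi, dvd_mul_right _ _, h⟩
    · obtain ⟨r, hr, hd, hz⟩ := ih ha h
      exact ⟨r, hr, hd.mul_left _, hz⟩

lemma dvd_of_irreducible_of_common_root {A : Type*} [CommRing A] [IsDomain A]
    [UniqueFactorizationMonoid A] [Algebra A ℂ] [FaithfulSMul A ℂ] {z : ℂ} {r s : A[X]}
    (hr : Irreducible r) (hs : Irreducible s) (hrz : aeval z r = 0) (hsz : aeval z s = 0) :
    r ∣ s := by
  let := FractionRing.liftAlgebra A ℂ
  have := FractionRing.isScalarTower_liftAlgebra A ℂ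
  have hinj : Function.Injective (algebraMap A ℂ) := FaithfulSMul.algebraMap_injective A ℂ
  have key : ∀ t : A[X], Irreducible t → aeval z t = 0 → t.IsPrimitive ∧
      Associated (t.map (algebraMap A (FractionRing A))) (minpoly (FractionRing A) z) := by
    intro t ht htz
    have hdeg : t.natDegree ≠ 0 := by
      intro h0
      rw [natDegree_eq_zero] at h0
      obtain ⟨c, rfl⟩ := h0
      rw [aeval_C] at htz
      have : c = 0 := hinj (by rw [htz, map_zero])
      exact ht.ne_zero (by rw [this, C_0])
    have hp : t.IsPrimitive := ht.isPrimitive hdeg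
    refine ⟨hp, ?_⟩
    have hirr := (hp.irreducible_iff_irreducible_map_fraction_map (K := FractionRing A)).mp ht
    have h0 : aeval z (t.map (algebraMap A (FractionRing A))) = 0 := by
      rw [aeval_map_algebraMap, htz]
    have hintegral : IsIntegral (FractionRing A) z :=
      IsAlgebraic.isIntegral ⟨_, hirr.ne_zero, h0⟩
    exact ((minpoly.irreducible hintegral).associated_of_dvd hirr (minpoly.dvd _ _ h0)).symm
  let : NormalizedGCDMonoid A := Classical.choice inferInstance
  obtain ⟨hrp, hra⟩ := key r hr hrz
  obtain ⟨hsp, hsa⟩ := key s hs hsz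
  exact hrp.dvd_of_fraction_map_dvd_fraction_map (hra.trans hsa.symm).dvd

lemma exists_common_irreducible_factor {k : Type*} [Field k] [Algebra k ℂ] {σ : Type*}
    {x : σ → ℂ} (hx : AlgebraicIndependent k x) (z : ℂ)
    {P Q : MvPolynomial (Option σ) k} (hP : P ≠ 0) (hQ : Q ≠ 0)
    (hPz : MvPolynomial.aeval (fun o : Option σ => o.elim z x) P = 0)
    (hQz : MvPolynomial.aeval (fun o : Option σ => o.elim z x) Q = 0) :
    ∃ R, Irreducible R ∧ R ∣ P ∧ R ∣ Q := by
  let : Algebra (MvPolynomial σ k) ℂ := (MvPolynomial.aeval x).toRingHom.toAlgebra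
  have : FaithfulSMul (MvPolynomial σ k) ℂ := by
    rw [faithfulSMul_iff_algebraMap_injective]
    exact hx
  let e := MvPolynomial.optionEquivLeft k σ
  have : IsScalarTower k (MvPolynomial σ k) ℂ := IsScalarTower.of_algebraMap_eq' <| by
    ext c
    exact ((MvPolynomial.aeval x).commutes c).symm
  have hev : ∀ S : MvPolynomial (Option σ) k,
      MvPolynomial.aeval (fun o : Option σ => o.elim z x) S = aeval z (e S) := by
    intro S
    have : MvPolynomial.aeval (fun o : Option σ => o.elim z x) =
        ((aeval z : (MvPolynomial σ k)[X] →ₐ[MvPolynomial σ k] ℂ).restrictScalars k).comp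
          (e : MvPolynomial (Option σ) k →ₐ[k] (MvPolynomial σ k)[X]) := by
      apply MvPolynomial.algHom_ext
      rintro (_ | i)
      · simp [e]
      · have h : e (MvPolynomial.X (some i)) = C (MvPolynomial.X i) :=
          MvPolynomial.optionEquivLeft_X_some k σ i
        have h' : aeval z (e (MvPolynomial.X (some i))) = x i := by
          rw [h, aeval_C]
          exact MvPolynomial.aeval_X (R := k) x i
        rw [MvPolynomial.aeval_X]
        exact h'.symm
    rw [this]; rfl
  obtain ⟨r, hr, hrp, hrz⟩ := exists_irreducible_dvd_of_root (z := z) (e P)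
    (by simpa using hP) (by rw [← hev, hPz])
  obtain ⟨s, hs, hsp, hsz⟩ := exists_irreducible_dvd_of_root (z := z) (e Q)
    (by simpa using hQ) (by rw [← hev, hQz])
  have hrs := dvd_of_irreducible_of_common_root hr hs hrz hsz
  refine ⟨e.symm r, (MulEquiv.irreducible_iff e.symm).mpr hr, ?_, ?_⟩
  · simpa using map_dvd e.symm hrp
  · simpa using map_dvd e.symm (hrs.trans hsp)

lemma exists_common_irreducible_factor_of_equiv {k : Type*} [Field k] [Algebra k ℂ] {σ τ : Type*}
    {x : σ → ℂ} (hx : AlgebraicIndependent k x) (ω : τ → ℂ) (f : Option σ ≃ τ)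
    (hf : ∀ i, ω (f (some i)) = x i)
    {P Q : MvPolynomial τ k} (hP : P ≠ 0) (hQ : Q ≠ 0)
    (hPz : MvPolynomial.aeval ω P = 0) (hQz : MvPolynomial.aeval ω Q = 0) :
    ∃ R, Irreducible R ∧ R ∣ P ∧ R ∣ Q := by
  let e := MvPolynomial.renameEquiv k f.symm
  have hev : ∀ S : MvPolynomial τ k,
      MvPolynomial.aeval (fun o : Option σ => o.elim (ω (f none)) x) (e S) =
        MvPolynomial.aeval ω S := by
    intro S
    simp only [e, MvPolynomial.renameEquiv_apply, MvPolynomial.aeval_rename]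
    congr 2
    funext t
    obtain ⟨o, rfl⟩ := f.surjective t
    rcases o with _ | i <;> simp [hf]
  obtain ⟨R, hR, hRP, hRQ⟩ := exists_common_irreducible_factor hx (ω (f none))
    (P := e P) (Q := e Q) (by simpa using hP) (by simpa using hQ)
    (by rw [hev, hPz]) (by rw [hev, hQz])
  refine ⟨e.symm R, (MulEquiv.irreducible_iff e.symm).mpr hR, ?_, ?_⟩
  · simpa using map_dvd e.symm hRP
  · simpa using map_dvd e.symm hRQ

/-- The coordinates of a common zero of two coprime polynomials in three variables with
algebraic coefficients generate a field of transcendence degree at most one. -/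
theorem exists_isAlgebraic_adjoin_of_common_zero (ι : AlgebraicClosure ℚ →+* ℂ)
    (P Q : MvPolynomial (Fin 3) (AlgebraicClosure ℚ)) (hP : P ≠ 0) (hQ : Q ≠ 0)
    (hPQ : ∀ R : MvPolynomial (Fin 3) (AlgebraicClosure ℚ),
      Irreducible R → R ∣ P → ¬ R ∣ Q) (ω : Fin 3 → ℂ)
    (hPω : MvPolynomial.eval ω (P.map ι) = 0) (hQω : MvPolynomial.eval ω (Q.map ι) = 0) :
    ∃ θ : ℂ, ∀ j, IsAlgebraic (Algebra.adjoin ℤ {θ}) (ω j) := by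
  by_cases hall : ∀ j, IsAlgebraic ℤ (ω j)
  · exact ⟨ω 0, fun j => (hall j).extendScalars (FaithfulSMul.algebraMap_injective _ _)⟩
  push Not at hall
  obtain ⟨i, hi⟩ := hall
  refine ⟨ω i, fun j => ?_⟩
  by_contra hj
  let : Algebra (AlgebraicClosure ℚ) ℂ := ι.toAlgebra
  have hone : AlgebraicIndependent ℤ (fun _ : PUnit.{1} => ω i) :=
    algebraicIndependent_unique_type_iff.mpr hi
  have htwo : AlgebraicIndependent ℤ
      (fun o : Option PUnit.{1} => o.elim (ω j) (fun _ => ω i)) := by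
    rw [AlgebraicIndependent.option_iff_transcendental hone, Set.range_const]
    exact hj
  have hij : i ≠ j := by
    rintro rfl
    have h := htwo.injective (a₁ := none) (a₂ := some PUnit.unit) rfl
    simp at h
  obtain ⟨l, hli, hlj⟩ : ∃ l : Fin 3, l ≠ i ∧ l ≠ j := by
    have : ∀ i j : Fin 3, ∃ l : Fin 3, l ≠ i ∧ l ≠ j := by decide
    exact this i j
  have : Algebra.IsAlgebraic ℤ (AlgebraicClosure ℚ) := ⟨fun c => by
    rw [IsFractionRing.isAlgebraic_iff ℤ ℚ]
    obtain ⟨p, hp, h⟩ := (AlgebraicClosure.isAlgebraic ℚ).isAlgebraic c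
    refine ⟨p, hp, ?_⟩
    rw [aeval_def] at h ⊢
    rw [← h]
    congr 1⟩
  have htwo' := htwo.extendScalars (AlgebraicClosure ℚ)
  let g : Option (Option PUnit.{1}) → Fin 3 := fun o => o.elim l (fun o => o.elim j (fun _ => i))
  have hg : Function.Bijective g := by
    rw [Fintype.bijective_iff_injective_and_card]
    refine ⟨?_, by simp⟩
    rintro (_ | _ | _) (_ | _ | _) h <;> simp_all [g]
  have hev : ∀ S : MvPolynomial (Fin 3) (AlgebraicClosure ℚ),
      MvPolynomial.aeval ω S = MvPolynomial.eval ω (S.map ι) := fun S => by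
    rw [MvPolynomial.eval_map]; rfl
  obtain ⟨R, hR, hRP, hRQ⟩ := exists_common_irreducible_factor_of_equiv htwo' ω
    (Equiv.ofBijective g hg) (by rintro (_ | _) <;> rfl) hP hQ
    (by rw [hev, hPω]) (by rw [hev, hQω])
  exact hPQ R hR hRP hRQ

end CommonZero

section PowerSeriesEvaluation

open PowerSeries

/-- Absolute convergence on the open unit disc. -/
def QSummable (f : ℤ⟦X⟧) : Prop :=
  ∀ r : ℝ, 0 ≤ r → r < 1 → Summable fun n => |((coeff n f : ℤ) : ℝ)| * r ^ n

/-- The value of an integral power series at a complex number. -/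
noncomputable def qEval (f : ℤ⟦X⟧) (q : ℂ) : ℂ := ∑' n, ((coeff n f : ℤ) : ℂ) * q ^ n

/-- The majorant norm of an integral power series at radius `r`. -/
noncomputable def qNorm (f : ℤ⟦X⟧) (r : ℝ) : ℝ := ∑' n, |((coeff n f : ℤ) : ℝ)| * r ^ n

lemma qNorm_nonneg (f : ℤ⟦X⟧) {r : ℝ} (hr : 0 ≤ r) : 0 ≤ qNorm f r :=
  tsum_nonneg fun n => by positivity

lemma QSummable.summable_norm {f : ℤ⟦X⟧} (hf : QSummable f) {q : ℂ} (hq : ‖q‖ < 1) :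
    Summable fun n => ‖((coeff n f : ℤ) : ℂ) * q ^ n‖ := by
  refine (hf ‖q‖ (norm_nonneg _) hq).congr fun n => ?_
  rw [norm_mul, norm_pow, Complex.norm_intCast]

lemma norm_qEval_le {f : ℤ⟦X⟧} (hf : QSummable f) {q : ℂ} (hq : ‖q‖ < 1) :
    ‖qEval f q‖ ≤ qNorm f ‖q‖ := by
  refine (norm_tsum_le_tsum_norm (hf.summable_norm hq)).trans (le_of_eq ?_)
  refine tsum_congr fun n => ?_
  rw [norm_mul, norm_pow, Complex.norm_intCast]

lemma qSummable_C (a : ℤ) : QSummable (C a) := by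
  intro r hr hr1
  apply summable_of_ne_finset_zero (s := {0})
  intro n hn
  simp only [Finset.mem_singleton] at hn
  rw [coeff_C, if_neg hn]; simp

lemma qEval_C (a : ℤ) (q : ℂ) : qEval (C a) q = a := by
  rw [qEval, tsum_eq_single 0]
  · simp
  · intro n hn; rw [coeff_C, if_neg hn]; simp

lemma qNorm_C (a : ℤ) (r : ℝ) : qNorm (C a) r = |(a : ℝ)| := by
  rw [qNorm, tsum_eq_single 0]
  · simp
  · intro n hn; rw [coeff_C, if_neg hn]; simp

lemma QSummable.add {f g : ℤ⟦X⟧} (hf : QSummable f) (hg : QSummable g) : QSummable (f + g) := by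
  intro r hr hr1
  refine Summable.of_nonneg_of_le (fun n => by positivity) (fun n => ?_)
    ((hf r hr hr1).add (hg r hr hr1))
  rw [← add_mul, map_add]
  push_cast
  gcongr
  exact abs_add_le _ _

lemma qEval_add {f g : ℤ⟦X⟧} (hf : QSummable f) (hg : QSummable g) {q : ℂ} (hq : ‖q‖ < 1) :
    qEval (f + g) q = qEval f q + qEval g q := by
  rw [qEval, qEval, qEval,
    ← (hf.summable_norm hq).of_norm.tsum_add (hg.summable_norm hq).of_norm]
  refine tsum_congr fun n => ?_
  rw [map_add]; push_cast; ring

lemma qNorm_add_le {f g : ℤ⟦X⟧} (hf : QSummable f) (hg : QSummable g) {r : ℝ} (hr : 0 ≤ r)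
    (hr1 : r < 1) : qNorm (f + g) r ≤ qNorm f r + qNorm g r := by
  rw [qNorm, qNorm, qNorm, ← (hf r hr hr1).tsum_add (hg r hr hr1)]
  refine (hf.add hg r hr hr1).tsum_le_tsum (fun n => ?_) ((hf r hr hr1).add (hg r hr hr1))
  rw [← add_mul, map_add]
  push_cast
  gcongr
  exact abs_add_le _ _

lemma abs_coeff_mul_le (f g : ℤ⟦X⟧) {r : ℝ} (hr : 0 ≤ r) (n : ℕ) :
    |((coeff n (f * g) : ℤ) : ℝ)| * r ^ n ≤ ∑ p ∈ Finset.HasAntidiagonal.antidiagonal n,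
      (|((coeff p.1 f : ℤ) : ℝ)| * r ^ p.1) * (|((coeff p.2 g : ℤ) : ℝ)| * r ^ p.2) := by
  rw [coeff_mul]
  push_cast
  calc _ ≤ (∑ p ∈ Finset.HasAntidiagonal.antidiagonal n,
        |((coeff p.1 f : ℤ) : ℝ) * ((coeff p.2 g : ℤ) : ℝ)|) * r ^ n := by
        gcongr; exact Finset.abs_sum_le_sum_abs _ _
    _ = _ := by
        rw [Finset.sum_mul]
        refine Finset.sum_congr rfl fun p hp => ?_
        rw [Finset.HasAntidiagonal.mem_antidiagonal] at hp
        rw [abs_mul, ← hp, pow_add]; ring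

lemma summable_abs_antidiagonal {f g : ℤ⟦X⟧} (hf : QSummable f) (hg : QSummable g) {r : ℝ}
    (hr : 0 ≤ r) (hr1 : r < 1) :
    Summable fun n => ∑ p ∈ Finset.HasAntidiagonal.antidiagonal n,
      (|((coeff p.1 f : ℤ) : ℝ)| * r ^ p.1) * (|((coeff p.2 g : ℤ) : ℝ)| * r ^ p.2) := by
  have h1 := (hf r hr hr1).norm
  have h2 := (hg r hr hr1).norm
  have h := summable_norm_sum_mul_antidiagonal_of_summable_norm h1 h2
  exact h.of_norm

lemma QSummable.mul {f g : ℤ⟦X⟧} (hf : QSummable f) (hg : QSummable g) : QSummable (f * g) :=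
  fun _ hr hr1 => Summable.of_nonneg_of_le (fun n => by positivity)
    (abs_coeff_mul_le f g hr) (summable_abs_antidiagonal hf hg hr hr1)

lemma qNorm_mul_le {f g : ℤ⟦X⟧} (hf : QSummable f) (hg : QSummable g) {r : ℝ} (hr : 0 ≤ r)
    (hr1 : r < 1) : qNorm (f * g) r ≤ qNorm f r * qNorm g r := by
  rw [qNorm, qNorm, qNorm, tsum_mul_tsum_eq_tsum_sum_antidiagonal_of_summable_norm
    (by simpa using (hf r hr hr1).norm) (by simpa using (hg r hr hr1).norm)]
  exact (hf.mul hg r hr hr1).tsum_le_tsum (abs_coeff_mul_le f g hr)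
    (summable_abs_antidiagonal hf hg hr hr1)

lemma qEval_mul {f g : ℤ⟦X⟧} (hf : QSummable f) (hg : QSummable g) {q : ℂ} (hq : ‖q‖ < 1) :
    qEval (f * g) q = qEval f q * qEval g q := by
  rw [qEval, qEval, qEval, tsum_mul_tsum_eq_tsum_sum_antidiagonal_of_summable_norm
    (hf.summable_norm hq) (hg.summable_norm hq)]
  refine tsum_congr fun n => ?_
  rw [coeff_mul]
  push_cast
  rw [Finset.sum_mul]
  refine Finset.sum_congr rfl fun p hp => ?_
  rw [Finset.HasAntidiagonal.mem_antidiagonal] at hp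
  rw [← hp, pow_add]; ring

lemma QSummable.pow {f : ℤ⟦X⟧} (hf : QSummable f) (n : ℕ) : QSummable (f ^ n) := by
  induction n with
  | zero => simpa using qSummable_C 1
  | succ n ih => rw [pow_succ]; exact ih.mul hf

lemma qNorm_pow_le {f : ℤ⟦X⟧} (hf : QSummable f) {r : ℝ} (hr : 0 ≤ r) (hr1 : r < 1) (n : ℕ) :
    qNorm (f ^ n) r ≤ qNorm f r ^ n := by
  induction n with
  | zero => simpa using (qNorm_C 1 r).le
  | succ n ih =>
    rw [pow_succ, pow_succ]
    refine (qNorm_mul_le (hf.pow n) hf hr hr1).trans ?_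
    gcongr
    exact qNorm_nonneg f hr

lemma qSummable_sum {ι : Type*} (s : Finset ι) {f : ι → ℤ⟦X⟧} (hf : ∀ i ∈ s, QSummable (f i)) :
    QSummable (∑ i ∈ s, f i) := by
  classical
  induction s using Finset.induction_on with
  | empty => simpa using qSummable_C 0
  | insert a s ha ih =>
    rw [Finset.sum_insert ha]
    exact (hf a (Finset.mem_insert_self _ _)).add
      (ih fun i hi => hf i (Finset.mem_insert_of_mem hi))

lemma qNorm_sum_le {ι : Type*} (s : Finset ι) {f : ι → ℤ⟦X⟧} (hf : ∀ i ∈ s, QSummable (f i))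
    {r : ℝ} (hr : 0 ≤ r) (hr1 : r < 1) :
    qNorm (∑ i ∈ s, f i) r ≤ ∑ i ∈ s, qNorm (f i) r := by
  classical
  induction s using Finset.induction_on with
  | empty => simpa using (qNorm_C 0 r).le
  | insert a s ha ih =>
    rw [Finset.sum_insert ha, Finset.sum_insert ha]
    have h : ∀ i ∈ s, QSummable (f i) := fun i hi => hf i (Finset.mem_insert_of_mem hi)
    exact (qNorm_add_le (hf a (Finset.mem_insert_self _ _)) (qSummable_sum s h) hr hr1).trans
      (add_le_add le_rfl (ih h))

lemma qSummable_aeval {v : Fin 3 → ℤ⟦X⟧} (hv : ∀ j, QSummable (v j))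
    (A : MvPolynomial (Fin 3) ℤ) : QSummable (MvPolynomial.aeval v A) := by
  induction A using MvPolynomial.induction_on with
  | C a => simpa using qSummable_C a
  | add p q hp hq => rw [map_add]; exact hp.add hq
  | mul_X p i hp => rw [map_mul, MvPolynomial.aeval_X]; exact hp.mul (hv i)

lemma qEval_aeval {v : Fin 3 → ℤ⟦X⟧} (hv : ∀ j, QSummable (v j))
    (A : MvPolynomial (Fin 3) ℤ) {q : ℂ} (hq : ‖q‖ < 1) :
    qEval (MvPolynomial.aeval v A) q = MvPolynomial.aeval (fun j => qEval (v j) q) A := by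
  induction A using MvPolynomial.induction_on with
  | C a => simpa using qEval_C a q
  | add f g hf hg =>
    rw [map_add, map_add, qEval_add (qSummable_aeval hv f) (qSummable_aeval hv g) hq, hf, hg]
  | mul_X f i hf =>
    rw [map_mul, map_mul, qEval_mul (qSummable_aeval hv f) (by simpa using hv i) hq, hf]
    simp

lemma qNorm_monomial_le {v : Fin 3 → ℤ⟦X⟧} (hv : ∀ j, QSummable (v j)) {r S : ℝ} (hr : 0 ≤ r)
    (hr1 : r < 1) (hS : 1 ≤ S) (hvS : ∀ j, qNorm (v j) r ≤ S) {i j l D : ℕ}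
    (hD : i + j + l ≤ D) : qNorm (v 0 ^ i * v 1 ^ j * v 2 ^ l) r ≤ S ^ D := by
  have h1 : ∀ m (n : ℕ), qNorm (v m ^ n) r ≤ S ^ n := fun m n =>
    (qNorm_pow_le (hv m) hr hr1 n).trans (pow_le_pow_left₀ (qNorm_nonneg _ hr) (hvS m) n)
  have hSp : 0 ≤ S := by linarith
  calc qNorm (v 0 ^ i * v 1 ^ j * v 2 ^ l) r
      ≤ qNorm (v 0 ^ i * v 1 ^ j) r * qNorm (v 2 ^ l) r :=
        qNorm_mul_le (((hv 0).pow i).mul ((hv 1).pow j)) ((hv 2).pow l) hr hr1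
    _ ≤ (qNorm (v 0 ^ i) r * qNorm (v 1 ^ j) r) * qNorm (v 2 ^ l) r := by
        gcongr
        · exact qNorm_nonneg _ hr
        · exact qNorm_mul_le ((hv 0).pow i) ((hv 1).pow j) hr hr1
    _ ≤ (S ^ i * S ^ j) * S ^ l := by
        gcongr
        · exact qNorm_nonneg _ hr
        · exact qNorm_nonneg _ hr
        · exact h1 0 i
        · exact h1 1 j
        · exact h1 2 l
    _ = S ^ (i + j + l) := by rw [pow_add, pow_add]
    _ ≤ S ^ D := pow_le_pow_right₀ hS hD

lemma qNorm_aeval_le {v : Fin 3 → ℤ⟦X⟧} (hv : ∀ j, QSummable (v j)) {r S : ℝ} (hr : 0 ≤ r)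
    (hr1 : r < 1) (hS : 1 ≤ S) (hvS : ∀ j, qNorm (v j) r ≤ S) {A : MvPolynomial (Fin 3) ℤ} {D : ℕ}
    (hD : A.totalDegree ≤ D) : qNorm (MvPolynomial.aeval v A) r ≤ mvLength A * S ^ D := by
  have hexp : MvPolynomial.aeval v A =
      ∑ e ∈ A.support, C (A.coeff e) * (v 0 ^ e 0 * v 1 ^ e 1 * v 2 ^ e 2) := by
    rw [MvPolynomial.aeval_def, MvPolynomial.eval₂_eq']
    refine Finset.sum_congr rfl fun e _ => ?_
    rw [Fin.prod_univ_three]; rfl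
  have hm : ∀ e : Fin 3 →₀ ℕ, QSummable (v 0 ^ e 0 * v 1 ^ e 1 * v 2 ^ e 2) := fun e =>
    (((hv 0).pow _).mul ((hv 1).pow _)).mul ((hv 2).pow _)
  rw [hexp]
  refine (qNorm_sum_le _ (fun e _ => (qSummable_C _).mul (hm e)) hr hr1).trans ?_
  rw [mvLength, Finset.sum_mul]
  refine Finset.sum_le_sum fun e he => ?_
  refine (qNorm_mul_le (qSummable_C _) (hm e) hr hr1).trans ?_
  rw [qNorm_C]
  gcongr
  exact qNorm_monomial_le hv hr hr1 hS hvS (mvDegree_le hD he)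

lemma abs_coeff_mul_pow_le_qNorm {f : ℤ⟦X⟧} (hf : QSummable f) {r : ℝ} (hr : 0 ≤ r) (hr1 : r < 1)
    (n : ℕ) : |((coeff n f : ℤ) : ℝ)| * r ^ n ≤ qNorm f r :=
  (hf r hr hr1).le_tsum n fun m _ => by positivity

lemma qNorm_le_of_coeff_eq_zero {f : ℤ⟦X⟧} (hf : QSummable f) {M : ℕ}
    (hM : ∀ n < M, coeff n f = 0) {s r : ℝ} (hs : 0 ≤ s) (hsr : s ≤ r) (hr : 0 < r) (hr1 : r < 1) :
    qNorm f s ≤ (s / r) ^ M * qNorm f r := by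
  rw [qNorm, qNorm, ← tsum_mul_left]
  refine (hf s hs (hsr.trans_lt hr1)).tsum_le_tsum (fun n => ?_) ((hf r hr.le hr1).mul_left _)
  rcases lt_or_ge n M with h | h
  · simp [hM n h]
  · have h1 : s ^ n = (s / r) ^ n * r ^ n := by rw [← mul_pow, div_mul_cancel₀ _ hr.ne']
    have h2 : (s / r) ^ n ≤ (s / r) ^ M :=
      pow_le_pow_of_le_one (by positivity) ((div_le_one hr).mpr hsr) h
    rw [h1]
    calc _ = (s / r) ^ n * (|((coeff n f : ℤ) : ℝ)| * r ^ n) := by ring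
      _ ≤ _ := by gcongr

/-- A power series vanishing to order `M` is small at small arguments. -/
lemma norm_qEval_le_of_coeff_eq_zero {f : ℤ⟦X⟧} (hf : QSummable f) {M : ℕ}
    (hM : ∀ n < M, coeff n f = 0) {q : ℂ} {r : ℝ} (hqr : ‖q‖ ≤ r) (hr : 0 < r) (hr1 : r < 1) :
    ‖qEval f q‖ ≤ (‖q‖ / r) ^ M * qNorm f r :=
  (norm_qEval_le hf (hqr.trans_lt hr1)).trans
    (qNorm_le_of_coeff_eq_zero hf hM (norm_nonneg _) hqr hr hr1)

end PowerSeriesEvaluation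

section ThetaOperator

open PowerSeries

/-- The derivation `q d/dq` on integral power series. -/
noncomputable def qTheta : Derivation ℤ ℤ⟦X⟧ ℤ⟦X⟧ := (X : ℤ⟦X⟧) • PowerSeries.derivative ℤ

lemma coeff_qTheta (f : ℤ⟦X⟧) (n : ℕ) : coeff n (qTheta f) = n * coeff n f := by
  have h : qTheta f = X * PowerSeries.derivative ℤ f := rfl
  rw [h]
  cases n with
  | zero => simp
  | succ n =>
    rw [mul_comm X, coeff_succ_mul_X, PowerSeries.coeff_derivative]
    push_cast; ring

lemma natCast_mul_pow_le {x : ℝ} (hx : 0 ≤ x) (hx1 : x < 1) (n : ℕ) :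
    (n : ℝ) * x ^ n ≤ (1 - x)⁻¹ := by
  calc (n : ℝ) * x ^ n = ∑ _k ∈ Finset.range n, x ^ n := by simp
    _ ≤ ∑ k ∈ Finset.range n, x ^ k := Finset.sum_le_sum fun k hk =>
        pow_le_pow_of_le_one hx hx1.le (Finset.mem_range.mp hk).le
    _ ≤ ∑' k, x ^ k := (summable_geometric_of_lt_one hx hx1).sum_le_tsum _
        fun k _ => by positivity
    _ = (1 - x)⁻¹ := tsum_geometric_of_lt_one hx hx1

lemma QSummable.qTheta {f : ℤ⟦X⟧} (hf : QSummable f) : QSummable (qTheta f) := by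
  intro r hr hr1
  set s := (1 + r) / 2 with hs
  have hs0 : 0 < s := by positivity
  have hrs : r < s := by rw [hs]; linarith
  have hs1 : s < 1 := by rw [hs]; linarith
  refine Summable.of_nonneg_of_le (fun n => by positivity) (fun n => ?_)
    ((hf s hs0.le hs1).mul_left (1 - r / s)⁻¹)
  rw [coeff_qTheta]
  push_cast
  rw [abs_mul, Nat.abs_cast]
  have h1 := natCast_mul_pow_le (x := r / s) (by positivity) ((div_lt_one hs0).mpr hrs) n
  have h2 : r ^ n = (r / s) ^ n * s ^ n := by rw [← mul_pow, div_mul_cancel₀ _ hs0.ne']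
  calc (n : ℝ) * |((coeff n f : ℤ) : ℝ)| * r ^ n
      = ((n : ℝ) * (r / s) ^ n) * (|((coeff n f : ℤ) : ℝ)| * s ^ n) := by rw [h2]; ring
    _ ≤ _ := by gcongr

lemma hasDerivAt_qEval {f : ℤ⟦X⟧} (hf : QSummable f) {q : ℂ} (hq : ‖q‖ < 1) :
    HasDerivAt (qEval f) (∑' n : ℕ, ((coeff n f : ℤ) : ℂ) * (n * q ^ (n - 1))) q := by
  obtain ⟨r, hqr, hr1⟩ := exists_between hq
  have hr : 0 < r := (norm_nonneg q).trans_lt hqr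
  have hu : Summable fun n : ℕ => |((coeff n f : ℤ) : ℝ)| * (n * r ^ (n - 1)) := by
    refine ((hf.qTheta r hr.le hr1).mul_left r⁻¹).congr fun n => ?_
    rw [coeff_qTheta]
    push_cast
    rw [abs_mul, Nat.abs_cast]
    rcases n with _ | n
    · simp
    · rw [Nat.add_sub_cancel, pow_succ]; field_simp
  have := hasDerivAt_tsum_of_isPreconnected (t := Metric.ball (0 : ℂ) r)
    (g := fun n q => ((coeff n f : ℤ) : ℂ) * q ^ n)
    (g' := fun n q => ((coeff n f : ℤ) : ℂ) * (n * q ^ (n - 1))) (y₀ := 0) (y := q)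
    hu Metric.isOpen_ball (convex_ball _ _).isPreconnected
    (fun n y _ => (hasDerivAt_pow n y).const_mul _)
    (fun n y hy => by
      rw [norm_mul, norm_mul, norm_pow, Complex.norm_intCast, Complex.norm_natCast]
      have : ‖y‖ ≤ r := by simpa using (mem_ball_zero_iff.mp hy).le
      gcongr)
    (Metric.mem_ball_self hr) (hf.summable_norm (by simp)).of_norm
    (by simpa using hqr)
  exact this

lemma qEval_qTheta (f : ℤ⟦X⟧) (q : ℂ) :
    qEval (qTheta f) q = q * ∑' n : ℕ, ((coeff n f : ℤ) : ℂ) * (n * q ^ (n - 1)) := by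
  rw [qEval, ← tsum_mul_left]
  refine tsum_congr fun n => ?_
  rw [coeff_qTheta]
  rcases n with _ | n
  · simp
  · rw [Nat.add_sub_cancel, pow_succ]; push_cast; ring

/-- The nome `exp (2πiz)`. -/
noncomputable def nome (z : ℂ) : ℂ := Complex.exp (2 * Real.pi * Complex.I * z)

lemma norm_nome (z : ℂ) : ‖nome z‖ = Real.exp (-(2 * Real.pi * z.im)) := by
  rw [nome, Complex.norm_exp]
  congr 1
  simp

lemma norm_nome_lt_one {z : ℂ} (hz : 0 < z.im) : ‖nome z‖ < 1 := by
  rw [norm_nome, Real.exp_lt_one_iff]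
  have := Real.pi_pos
  have : 0 < 2 * Real.pi * z.im := by positivity
  linarith

lemma nome_add_natCast (z : ℂ) (n : ℕ) : nome (z + n) = nome z := by
  rw [nome, nome, mul_add, show 2 * (Real.pi : ℂ) * Complex.I * n = n * (2 * Real.pi * Complex.I)
    by ring, Complex.exp_periodic.nat_mul]

lemma hasDerivAt_nome (z : ℂ) :
    HasDerivAt nome (2 * Real.pi * Complex.I * nome z) z := by
  have := ((hasDerivAt_id z).const_mul (2 * Real.pi * Complex.I)).cexp
  exact this.congr_deriv (by simp only [nome, id]; ring)

lemma hasDerivAt_qEval_nome {f : ℤ⟦X⟧} (hf : QSummable f) {z : ℂ} (hz : 0 < z.im) :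
    HasDerivAt (fun w => qEval f (nome w))
      (2 * Real.pi * Complex.I * qEval (qTheta f) (nome z)) z := by
  have := (hasDerivAt_qEval hf (norm_nome_lt_one hz)).comp z (hasDerivAt_nome z)
  refine this.congr_deriv ?_
  rw [qEval_qTheta]; ring

end ThetaOperator

section Modular

open PowerSeries UpperHalfPlane ModularForm Derivative
open scoped MatrixGroups Manifold

lemma nome_eq_qParam (z : ℂ) : Function.Periodic.qParam 1 z = nome z := by
  simp [Function.Periodic.qParam, nome]

lemma hasSum_qEval {f : ℤ⟦X⟧} (hf : QSummable f) {q : ℂ} (hq : ‖q‖ < 1) :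
    HasSum (fun n => ((coeff n f : ℤ) : ℂ) * q ^ n) (qEval f q) :=
  (hf.summable_norm hq).of_norm.hasSum

lemma mdifferentiable_of_eq_qEval {F : ℍ → ℂ} {f : ℤ⟦X⟧} (hf : QSummable f)
    (h : ∀ τ : ℍ, F τ = qEval f (nome τ)) : MDiff F := by
  rw [UpperHalfPlane.mdifferentiable_iff]
  have hd : DifferentiableOn ℂ (fun w => qEval f (nome w)) upperHalfPlaneSet := fun z hz =>
    (hasDerivAt_qEval_nome hf hz).differentiableAt.differentiableWithinAt
  refine hd.congr fun z hz => ?_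
  simp only [Function.comp_apply]
  rw [h, ofComplex_apply_of_im_pos hz]

/-- An integral power series without constant term that defines a modular form of level one and
weight less than twelve vanishes. -/
lemma eq_zero_of_modular {F : ℍ → ℂ} {f : ℤ⟦X⟧} (hf : QSummable f)
    (h : ∀ τ : ℍ, F τ = qEval f (nome τ)) {k : ℕ} (hk : k < 12)
    (hslash : ∀ γ : SL(2, ℤ), F ∣[(k : ℤ)] γ = F) (h0 : coeff 0 f = 0) : f = 0 := by
  have hsum : ∀ τ : ℍ, HasSum (fun m => ((coeff m f : ℤ) : ℂ) •
      Function.Periodic.qParam 1 (τ : ℂ) ^ m) (F τ) := fun τ => by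
    rw [h, nome_eq_qParam]
    exact hasSum_qEval hf (norm_nome_lt_one τ.im_pos)
  let G : ModularForm 𝒮ℒ (k : ℤ) :=
    { toFun := F
      slash_action_eq' := by
        rintro A ⟨A, rfl⟩
        exact hslash A
      holo' := mdifferentiable_of_eq_qEval hf h
      bdd_at_cusps' := by
        intro c hc
        rw [Subgroup.IsArithmetic.isCusp_iff_isCusp_SL2Z] at hc
        rw [OnePoint.isBoundedAt_iff_forall_SL2Z hc]
        intro γ _
        rw [hslash]
        exact isBoundedAtImInfty_of_hasSum_qExpansion one_pos hsum }
  have hG : ∀ m, ((coeff m f : ℤ) : ℂ) = coeff m (qExpansion 1 G) :=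
    ModularFormClass.qExpansion_coeff_unique one_pos one_mem_strictPeriods_SL hsum
  have hG0 : G = 0 := by
    apply sturm_bound_levelOne_nat
    rw [Nat.div_eq_of_lt hk]
    rw [Nat.cast_zero, ← not_le]
    intro hle
    have h1 : (qExpansion 1 G).order = 0 := le_antisymm hle bot_le
    by_cases hz : qExpansion 1 G = 0
    · rw [hz, PowerSeries.order_zero] at h1; simp at h1
    · have h2 := PowerSeries.coeff_order hz
      rw [h1] at h2
      apply h2
      rw [ENat.toNat_zero, ← hG 0, h0, Int.cast_zero]
  ext m
  have h3 := hG m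
  rw [hG0] at h3
  have h4 : qExpansion 1 ((0 : ModularForm 𝒮ℒ (k : ℤ)) : ℍ → ℂ) = 0 := qExpansion_zero 1
  rw [h4] at h3
  simpa using h3

end Modular

section Eisenstein

open PowerSeries

/-- The power series `1 + c * ∑ n ≥ 1, σ_k(n) X ^ n`. -/
noncomputable def divisorSeries (c : ℤ) (k : ℕ) : ℤ⟦X⟧ :=
  PowerSeries.mk fun n => if n = 0 then 1 else c * ∑ d ∈ n.divisors, (d : ℤ) ^ k

lemma abs_coeff_divisorSeries_le {c : ℤ} {k : ℕ} (hc : |c| ≤ 504) (hk : k ≤ 5) (n : ℕ) :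
    |((coeff n (divisorSeries c k) : ℤ) : ℝ)| ≤ 362880 * ((n + 6).choose 6 : ℝ) := by
  have hch : (n + 1) ^ 6 ≤ 720 * (n + 6).choose 6 := by
    have h1 := Nat.pow_succ_le_ascFactorial (n + 1) 6
    rwa [Nat.ascFactorial_eq_factorial_mul_choose, show Nat.factorial 6 = 720 from rfl] at h1
  have hch' : ((n : ℤ) + 1) ^ 6 ≤ 720 * ((n + 6).choose 6 : ℤ) := by exact_mod_cast hch
  have key : |coeff n (divisorSeries c k)| ≤ 504 * ((n : ℤ) + 1) ^ 6 := by
    rw [divisorSeries, coeff_mk]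
    split_ifs with h
    · subst h; norm_num
    · rw [abs_mul]
      refine mul_le_mul hc ?_ (abs_nonneg _) (by norm_num)
      calc |∑ d ∈ n.divisors, (d : ℤ) ^ k| = ∑ d ∈ n.divisors, (d : ℤ) ^ k :=
            abs_of_nonneg (Finset.sum_nonneg fun d _ => by positivity)
        _ ≤ ∑ d ∈ n.divisors, ((n : ℤ) + 1) ^ 5 := by
            refine Finset.sum_le_sum fun d hd => ?_
            have h1 : (d : ℤ) ≤ n + 1 := by
              have := Nat.divisor_le hd
              exact_mod_cast Nat.le_succ_of_le this
            calc (d : ℤ) ^ k ≤ ((n : ℤ) + 1) ^ k := by gcongr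
              _ ≤ ((n : ℤ) + 1) ^ 5 := pow_le_pow_right₀ (by linarith [Int.natCast_nonneg n]) hk
        _ = n.divisors.card * ((n : ℤ) + 1) ^ 5 := by rw [Finset.sum_const, nsmul_eq_mul]
        _ ≤ ((n : ℤ) + 1) * ((n : ℤ) + 1) ^ 5 := by
            have : (n.divisors.card : ℤ) ≤ n + 1 := by
              exact_mod_cast (Nat.card_divisors_le_self n).trans (Nat.le_succ n)
            gcongr
        _ = ((n : ℤ) + 1) ^ 6 := by ring
  have h2 : |coeff n (divisorSeries c k)| ≤ 362880 * ((n + 6).choose 6 : ℤ) := by linarith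
  exact_mod_cast h2

lemma qSummable_divisorSeries {c : ℤ} {k : ℕ} (hc : |c| ≤ 504) (hk : k ≤ 5) :
    QSummable (divisorSeries c k) := by
  intro r hr hr1
  have hs := (summable_choose_mul_geometric_of_norm_lt_one 6
    (show ‖r‖ < 1 by rwa [Real.norm_of_nonneg hr])).mul_left 362880
  refine Summable.of_nonneg_of_le (fun n => by positivity) (fun n => ?_) hs
  rw [← mul_assoc]
  exact mul_le_mul_of_nonneg_right (abs_coeff_divisorSeries_le hc hk n) (by positivity)

lemma qNorm_divisorSeries_le {c : ℤ} {k : ℕ} (hc : |c| ≤ 504) (hk : k ≤ 5) {r : ℝ} (hr : 0 ≤ r)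
    (hr1 : r < 1) : qNorm (divisorSeries c k) r ≤ 362880 / (1 - r) ^ 7 := by
  have hn : ‖r‖ < 1 := by rwa [Real.norm_of_nonneg hr]
  have hs := (summable_choose_mul_geometric_of_norm_lt_one 6 hn).mul_left 362880
  have h1 : qNorm (divisorSeries c k) r ≤ ∑' n : ℕ, 362880 * (((n + 6).choose 6 : ℝ) * r ^ n) := by
    refine Summable.tsum_le_tsum (fun n => ?_) (qSummable_divisorSeries hc hk r hr hr1) hs
    rw [← mul_assoc]
    exact mul_le_mul_of_nonneg_right (abs_coeff_divisorSeries_le hc hk n) (by positivity)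
  rwa [tsum_mul_left, tsum_choose_mul_geometric_of_norm_lt_one 6 hn, mul_one_div] at h1

lemma qEval_divisorSeries {c : ℤ} {k : ℕ} (hc : |c| ≤ 504) (hk : k ≤ 5) {q : ℂ} (hq : ‖q‖ < 1) :
    qEval (divisorSeries c k) q =
      1 + c * ∑' n : ℕ, (∑ d ∈ n.divisors, (d : ℂ) ^ k) * q ^ n := by
  have h := hasSum_qEval (qSummable_divisorSeries hc hk) hq
  have h1 : ∀ n, ((coeff n (divisorSeries c k) : ℤ) : ℂ) * q ^ n =
      (if n = 0 then 1 else 0) + c * ((∑ d ∈ n.divisors, (d : ℂ) ^ k) * q ^ n) := by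
    intro n
    rw [divisorSeries, coeff_mk]
    split_ifs with h
    · subst h; simp
    · push_cast; ring
  simp_rw [h1] at h
  have h3 := h.sub (hasSum_ite_eq 0 (1 : ℂ))
  simp only [add_sub_cancel_left] at h3
  rw [← tsum_mul_left, h3.tsum_eq]
  ring

/-- The `q`-expansions of `E₂`, `E₄`, `E₆`. -/
noncomputable def eis : Fin 3 → ℤ⟦X⟧ :=
  ![divisorSeries (-24) 1, divisorSeries 240 3, divisorSeries (-504) 5]

lemma qSummable_eis (j : Fin 3) : QSummable (eis j) := by
  fin_cases j <;> exact qSummable_divisorSeries (by norm_num) (by norm_num)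

lemma qNorm_eis_le (j : Fin 3) {r : ℝ} (hr : 0 ≤ r) (hr1 : r < 1) :
    qNorm (eis j) r ≤ 362880 / (1 - r) ^ 7 := by
  fin_cases j <;> exact qNorm_divisorSeries_le (by norm_num) (by norm_num) hr hr1

lemma coeff_zero_eis (j : Fin 3) : coeff 0 (eis j) = 1 := by
  fin_cases j <;> simp [eis, divisorSeries]

lemma Ek_eq_qEval {z : ℂ} (hz : 0 < z.im) :
    ![Ek 2 z, Ek 4 z, Ek 6 z] = fun j => qEval (eis j) (nome z) := by
  have hq := norm_nome_lt_one hz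
  have b4 : bernoulli 4 = -1/30 := by decide +kernel
  have b6 : bernoulli 6 = 1/42 := by decide +kernel
  ext j
  fin_cases j
  · simp only [eis, Fin.zero_eta, Matrix.cons_val_zero]
    rw [qEval_divisorSeries (by norm_num) (by norm_num) hq, Ek, bernoulli_two]
    norm_num [nome]
    ring
  · simp only [eis, Fin.mk_one, Matrix.cons_val_one, Matrix.cons_val_zero]
    rw [qEval_divisorSeries (by norm_num) (by norm_num) hq, Ek, b4]
    norm_num [nome]
  · simp only [eis, Fin.reduceFinMk, Matrix.cons_val]
    rw [qEval_divisorSeries (by norm_num) (by norm_num) hq, Ek, b6]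
    norm_num [nome]
    ring

end Eisenstein

section Ramanujan

open PowerSeries UpperHalfPlane ModularForm ModularFormClass SlashInvariantForm
open scoped MatrixGroups

/-- The values `E₂(z)`, `E₄(z)`, `E₆(z)`. -/
noncomputable def eisVal (j : Fin 3) (z : ℂ) : ℂ := qEval (eis j) (nome z)

lemma E2_eq_eisVal (τ : ℍ) : EisensteinSeries.E2 τ = eisVal 0 τ := by
  refine (EisensteinSeries.hasSum_qExpansion_E2 τ).unique ?_
  have h := hasSum_qEval (qSummable_eis 0) (norm_nome_lt_one τ.im_pos)
  refine h.congr_fun fun n => ?_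
  simp only [eis, Matrix.cons_val_zero, divisorSeries, coeff_mk, nome, smul_eq_mul,
    ArithmeticFunction.sigma_apply]
  split_ifs <;> simp

lemma eisenstein_eq_qEval {k : ℕ} (hk : 3 ≤ k) (hk2 : Even k) {c : ℤ} (hc : |c| ≤ 504)
    (hk5 : k - 1 ≤ 5) (hb : (2 * k / bernoulli k : ℂ) = -c) (τ : ℍ) :
    E hk τ = qEval (divisorSeries c (k - 1)) (nome τ) := by
  rw [EisensteinSeries.q_expansion_bernoulli hk hk2, hb,
    qEval_divisorSeries hc hk5 (norm_nome_lt_one τ.im_pos), neg_mul, sub_neg_eq_add]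
  congr 2
  have hs := EisensteinSeries.summable_sigma_mul_cexp_pow (k := k) (by lia) τ
  change Summable fun n => (ArithmeticFunction.sigma (k - 1) n : ℂ) * nome τ ^ n at hs
  change ∑' n : ℕ+, (ArithmeticFunction.sigma (k - 1) n : ℂ) * nome τ ^ (n : ℕ) = _
  rw [tsum_pnat_eq_tsum_succ
      (f := fun n => (ArithmeticFunction.sigma (k - 1) n : ℂ) * nome τ ^ n)]
  rw [show (∑' n : ℕ, (∑ d ∈ n.divisors, (d : ℂ) ^ (k - 1)) * nome τ ^ n) =
    ∑' n : ℕ, (ArithmeticFunction.sigma (k - 1) n : ℂ) * nome τ ^ n by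
      simp [ArithmeticFunction.sigma_apply]]
  rw [hs.tsum_eq_zero_add]
  simp

lemma E₄_eq_eisVal (τ : ℍ) : E₄ τ = eisVal 1 τ := by
  have b4 : bernoulli 4 = -1/30 := by decide +kernel
  exact eisenstein_eq_qEval (k := 4) (c := 240) (by norm_num) (by decide) (by norm_num)
    (by norm_num) (by rw [b4]; norm_num) τ

lemma E₆_eq_eisVal (τ : ℍ) : E₆ τ = eisVal 2 τ := by
  have b6 : bernoulli 6 = 1/42 := by decide +kernel
  exact eisenstein_eq_qEval (k := 6) (c := -504) (by norm_num) (by decide) (by norm_num)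
    (by norm_num) (by rw [b6]; norm_num) τ

lemma im_neg_inv_pos {z : ℂ} (hz : 0 < z.im) : 0 < ((-z)⁻¹).im := by
  have := (ModularGroup.S • (⟨z, hz⟩ : ℍ)).im_pos
  rwa [modular_S_smul] at this

lemma slash_S_apply_eq (F : ℍ → ℂ) (k : ℕ) {z : ℂ} (hz : 0 < z.im) :
    F ⟨(-z)⁻¹, im_neg_inv_pos hz⟩ = z ^ k * (F ∣[(k : ℤ)] ModularGroup.S) ⟨z, hz⟩ := by
  have hz0 : z ≠ 0 := by rintro rfl; simp at hz
  rw [SL_slash_apply, ModularGroup.denom_S, modular_S_smul]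
  simp only [zpow_neg, zpow_natCast]
  field_simp

lemma eisVal_one_neg_inv {z : ℂ} (hz : 0 < z.im) : eisVal 1 (-z)⁻¹ = z ^ 4 * eisVal 1 z := by
  have h := slash_S_apply_eq E₄ 4 hz
  have h2 : (E₄ : ℍ → ℂ) ∣[((4 : ℕ) : ℤ)] ModularGroup.S = E₄ :=
    E₄.slash_action_eq' _ ⟨ModularGroup.S, rfl⟩
  rw [h2, E₄_eq_eisVal, E₄_eq_eisVal] at h
  exact h

lemma eisVal_two_neg_inv {z : ℂ} (hz : 0 < z.im) : eisVal 2 (-z)⁻¹ = z ^ 6 * eisVal 2 z := by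
  have h := slash_S_apply_eq E₆ 6 hz
  have h2 : (E₆ : ℍ → ℂ) ∣[((6 : ℕ) : ℤ)] ModularGroup.S = E₆ :=
    E₆.slash_action_eq' _ ⟨ModularGroup.S, rfl⟩
  rw [h2, E₆_eq_eisVal, E₆_eq_eisVal] at h
  exact h

lemma eisVal_zero_neg_inv {z : ℂ} (hz : 0 < z.im) :
    eisVal 0 (-z)⁻¹ = z ^ 2 * eisVal 0 z + 6 / (Real.pi * Complex.I) * z := by
  have hz0 : z ≠ 0 := by rintro rfl; simp at hz
  have h := slash_S_apply_eq EisensteinSeries.E2 2 hz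
  rw [Nat.cast_ofNat, EisensteinSeries.E2_slash_action, Pi.sub_apply, Pi.smul_apply,
    EisensteinSeries.D2_S, riemannZeta_two, E2_eq_eisVal, E2_eq_eisVal] at h
  refine h.trans ?_
  have := Real.pi_ne_zero
  simp only [smul_eq_mul]
  field_simp
  linear_combination -6 * Complex.I_sq

lemma eisVal_add_natCast (j : Fin 3) (z : ℂ) (n : ℕ) : eisVal j (z + n) = eisVal j z := by
  rw [eisVal, nome_add_natCast, eisVal]

/-- An integral power series without constant term whose value transforms like a modular form of
weight less than twelve vanishes. -/
lemma eq_zero_of_neg_inv {f : ℤ⟦X⟧} (hf : QSummable f) {k : ℕ} (hk : k < 12)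
    (hS : ∀ z : ℂ, 0 < z.im → qEval f (nome (-z)⁻¹) = z ^ k * qEval f (nome z))
    (h0 : coeff 0 f = 0) : f = 0 := by
  refine eq_zero_of_modular (F := fun τ => qEval f (nome τ)) hf (fun _ => rfl) hk
    (slash_action_generators_SL2Z ?_ ?_) h0
  · ext τ
    have hτ : (τ : ℂ) ≠ 0 := τ.ne_zero
    rw [SL_slash_apply, ModularGroup.denom_S, modular_S_smul]
    simp only [zpow_neg, zpow_natCast]
    rw [hS _ τ.im_pos]
    field_simp
  · ext τ
    rw [SL_slash_apply, modular_T_smul]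
    have := nome_add_natCast (τ : ℂ) 1
    simp only [coe_vadd]
    rw [show ((1 : ℝ) : ℂ) + (τ : ℂ) = τ + (1 : ℕ) by push_cast; ring, this]
    have hT : denom ModularGroup.T τ = 1 := by
      rw [ModularGroup.denom_apply]; simp [ModularGroup.T]
    rw [hT]
    simp

lemma hasDerivAt_neg_inv {z : ℂ} (hz : z ≠ 0) : HasDerivAt (fun w : ℂ => (-w)⁻¹) (1 / z ^ 2) z := by
  have := (hasDerivAt_neg z).inv (neg_ne_zero.mpr hz)
  refine this.congr_deriv ?_
  simp

lemma qEval_qTheta_neg_inv {f : ℤ⟦X⟧} (hf : QSummable f) {g g' : ℂ → ℂ}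
    (hg : ∀ z : ℂ, 0 < z.im → HasDerivAt g (g' z) z)
    (h : ∀ z : ℂ, 0 < z.im → qEval f (nome (-z)⁻¹) = g z) {z : ℂ} (hz : 0 < z.im) :
    2 * Real.pi * Complex.I * qEval (qTheta f) (nome (-z)⁻¹) = z ^ 2 * g' z := by
  have hz0 : z ≠ 0 := by rintro rfl; simp at hz
  have h1 := (hasDerivAt_qEval_nome hf (im_neg_inv_pos hz)).comp z (hasDerivAt_neg_inv hz0)
  have h2 := h1.congr_of_eventuallyEq (f₁ := g) (by
    filter_upwards [isOpen_upperHalfPlaneSet.mem_nhds hz] with w hw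
    exact (h w hw).symm)
  rw [← (hg z hz).unique h2 |>.symm]
  field_simp

lemma constantCoeff_qTheta (f : ℤ⟦X⟧) : constantCoeff (qTheta f) = 0 := by
  rw [← coeff_zero_eq_constantCoeff_apply, coeff_qTheta]; simp

lemma constantCoeff_eis (j : Fin 3) : constantCoeff (eis j) = 1 := by
  rw [← coeff_zero_eq_constantCoeff_apply, coeff_zero_eis]

lemma qTheta_eis_zero : 12 * qTheta (eis 0) = eis 0 ^ 2 - eis 1 := by
  have hpi : (Real.pi : ℂ) ≠ 0 := by exact_mod_cast Real.pi_ne_zero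
  have hI := Complex.I_ne_zero
  have he := qSummable_eis
  have hθ := (qSummable_eis 0).qTheta
  have key : C 12 * qTheta (eis 0) + (C (-1) * (eis 0 * eis 0) + eis 1) = 0 := by
    have hs1 := (qSummable_C 12).mul hθ
    have hs2 := (he 0).mul (he 0)
    have hs3 := (qSummable_C (-1)).mul hs2
    refine eq_zero_of_neg_inv (k := 4) (hs1.add (hs3.add (he 1))) (by norm_num) (fun z hz => ?_) ?_
    · have hd := qEval_qTheta_neg_inv (he 0) (fun w hw =>
        ((hasDerivAt_pow 2 w).mul (hasDerivAt_qEval_nome (he 0) hw)).add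
          ((hasDerivAt_id w).const_mul (6 / (Real.pi * Complex.I))))
        (fun w hw => eisVal_zero_neg_inv hw) hz
      have hz' := im_neg_inv_pos hz
      have h0 := eisVal_zero_neg_inv hz
      have h1 := eisVal_one_neg_inv hz
      simp only [eisVal] at h0 h1
      have hn := norm_nome_lt_one hz
      have hn' := norm_nome_lt_one hz'
      simp only [qEval_add hs1 (hs3.add (he 1)), qEval_add hs3 (he 1),
        qEval_mul (qSummable_C 12) hθ, qEval_mul (qSummable_C (-1)) hs2, qEval_mul (he 0) (he 0),
        qEval_C, hn, hn', h0, h1]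
      field_simp at hd ⊢
      push_cast at hd ⊢
      linear_combination (6 : ℂ) * hd
    · simp [constantCoeff_qTheta, constantCoeff_eis]
  simp only [map_neg, map_one, map_ofNat] at key
  linear_combination key

lemma qTheta_eis_one : 3 * qTheta (eis 1) = eis 0 * eis 1 - eis 2 := by
  have hpi : (Real.pi : ℂ) ≠ 0 := by exact_mod_cast Real.pi_ne_zero
  have hI := Complex.I_ne_zero
  have he := qSummable_eis
  have hθ := (qSummable_eis 1).qTheta
  have key : C 3 * qTheta (eis 1) + (C (-1) * (eis 0 * eis 1) + eis 2) = 0 := by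
    have hs1 := (qSummable_C 3).mul hθ
    have hs2 := (he 0).mul (he 1)
    have hs3 := (qSummable_C (-1)).mul hs2
    refine eq_zero_of_neg_inv (k := 6) (hs1.add (hs3.add (he 2))) (by norm_num) (fun z hz => ?_) ?_
    · have hd := qEval_qTheta_neg_inv (he 1) (fun w hw =>
        (hasDerivAt_pow 4 w).mul (hasDerivAt_qEval_nome (he 1) hw))
        (fun w hw => eisVal_one_neg_inv hw) hz
      have hz' := im_neg_inv_pos hz
      have h0 := eisVal_zero_neg_inv hz
      have h1 := eisVal_one_neg_inv hz
      have h2 := eisVal_two_neg_inv hz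
      simp only [eisVal] at h0 h1 h2
      have hn := norm_nome_lt_one hz
      have hn' := norm_nome_lt_one hz'
      simp only [qEval_add hs1 (hs3.add (he 2)), qEval_add hs3 (he 2),
        qEval_mul (qSummable_C 3) hθ, qEval_mul (qSummable_C (-1)) hs2, qEval_mul (he 0) (he 1),
        qEval_C, hn, hn', h0, h1, h2]
      field_simp at hd ⊢
      push_cast at hd ⊢
      linear_combination (3 / 2 : ℂ) * hd
    · simp [constantCoeff_qTheta, constantCoeff_eis]
  simp only [map_neg, map_one, map_ofNat] at key
  linear_combination key

lemma qTheta_eis_two : 2 * qTheta (eis 2) = eis 0 * eis 2 - eis 1 ^ 2 := by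
  have hpi : (Real.pi : ℂ) ≠ 0 := by exact_mod_cast Real.pi_ne_zero
  have hI := Complex.I_ne_zero
  have he := qSummable_eis
  have hθ := (qSummable_eis 2).qTheta
  have key : C 2 * qTheta (eis 2) + (C (-1) * (eis 0 * eis 2) + eis 1 * eis 1) = 0 := by
    have hs1 := (qSummable_C 2).mul hθ
    have hs2 := (he 0).mul (he 2)
    have hs3 := (qSummable_C (-1)).mul hs2
    have hs4 := (he 1).mul (he 1)
    refine eq_zero_of_neg_inv (k := 8) (hs1.add (hs3.add hs4)) (by norm_num) (fun z hz => ?_) ?_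
    · have hd := qEval_qTheta_neg_inv (he 2) (fun w hw =>
        (hasDerivAt_pow 6 w).mul (hasDerivAt_qEval_nome (he 2) hw))
        (fun w hw => eisVal_two_neg_inv hw) hz
      have hz' := im_neg_inv_pos hz
      have h0 := eisVal_zero_neg_inv hz
      have h1 := eisVal_one_neg_inv hz
      have h2 := eisVal_two_neg_inv hz
      simp only [eisVal] at h0 h1 h2
      have hn := norm_nome_lt_one hz
      have hn' := norm_nome_lt_one hz'
      simp only [qEval_add hs1 (hs3.add hs4), qEval_add hs3 hs4,
        qEval_mul (qSummable_C 2) hθ, qEval_mul (qSummable_C (-1)) hs2, qEval_mul (he 0) (he 2),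
        qEval_mul (he 1) (he 1), qEval_C, hn, hn', h0, h1, h2]
      field_simp at hd ⊢
      push_cast at hd ⊢
      linear_combination hd
    · simp [constantCoeff_qTheta, constantCoeff_eis]
  simp only [map_neg, map_one, map_ofNat] at key
  linear_combination key

end Ramanujan

section RamanujanDerivation

open MvPolynomial

lemma mvLength_eq_sum {B : MvPolynomial (Fin 3) ℤ} {s : Finset (Fin 3 →₀ ℕ)}
    (hs : B.support ⊆ s) : mvLength B = ∑ e ∈ s, |((B.coeff e : ℤ) : ℝ)| := by
  refine Finset.sum_subset hs fun e _ he => ?_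
  rw [notMem_support_iff.mp he]; simp

lemma mvLength_nonneg (B : MvPolynomial (Fin 3) ℤ) : 0 ≤ mvLength B :=
  Finset.sum_nonneg fun _ _ => abs_nonneg _

lemma mvLength_add_le (A B : MvPolynomial (Fin 3) ℤ) :
    mvLength (A + B) ≤ mvLength A + mvLength B := by
  rw [mvLength_eq_sum (support_add (p := A) (q := B)),
    mvLength_eq_sum (B := A) (s := A.support ∪ B.support) Finset.subset_union_left,
    mvLength_eq_sum (B := B) (s := A.support ∪ B.support) Finset.subset_union_right,
    ← Finset.sum_add_distrib]
  refine Finset.sum_le_sum fun e _ => ?_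
  rw [coeff_add]; push_cast; exact abs_add_le _ _

lemma mvLength_sum_le {ι : Type*} (s : Finset ι) (f : ι → MvPolynomial (Fin 3) ℤ) :
    mvLength (∑ i ∈ s, f i) ≤ ∑ i ∈ s, mvLength (f i) :=
  Finset.le_sum_of_subadditive mvLength (by simp [mvLength]) mvLength_add_le s f

lemma mvLength_monomial_mul_le (e : Fin 3 →₀ ℕ) (a : ℤ) (B : MvPolynomial (Fin 3) ℤ) :
    mvLength (monomial e a * B) ≤ |(a : ℝ)| * mvLength B := by
  classical
  have hs : (monomial e a * B).support ⊆ B.support.map (addLeftEmbedding e) := by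
    intro m hm
    rw [mem_support_iff, coeff_monomial_mul'] at hm
    simp only [Finset.mem_map, addLeftEmbedding_apply]
    split_ifs at hm with h
    · exact ⟨m - e, mem_support_iff.mpr (right_ne_zero_of_mul hm), add_tsub_cancel_of_le h⟩
    · exact absurd rfl hm
  rw [mvLength_eq_sum hs, Finset.sum_map, mvLength, Finset.mul_sum]
  refine Finset.sum_le_sum fun m _ => ?_
  rw [addLeftEmbedding_apply, coeff_monomial_mul]
  push_cast
  rw [abs_mul]

lemma mvLength_neg (B : MvPolynomial (Fin 3) ℤ) : mvLength (-B) = mvLength B := by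
  rw [mvLength, mvLength, support_neg]; simp

lemma mvLength_X (i : Fin 3) : mvLength (X i) = 1 := by
  rw [mvLength, support_X]; simp

/-- The images of the variables under the Ramanujan derivation. -/
noncomputable def ramanujanField : Fin 3 → MvPolynomial (Fin 3) ℤ :=
  ![X 0 ^ 2 - X 1, 4 * (X 0 * X 1 - X 2), 6 * (X 0 * X 2 - X 1 ^ 2)]

/-- The derivation of `ℤ[X₀, X₁, X₂]` corresponding to twelve times the theta operator. -/
noncomputable def ramanujanDeriv : Derivation ℤ (MvPolynomial (Fin 3) ℤ) (MvPolynomial (Fin 3) ℤ) :=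
  mkDerivation ℤ ramanujanField

lemma aeval_ramanujanDeriv (A : MvPolynomial (Fin 3) ℤ) :
    aeval eis (ramanujanDeriv A) = 12 * qTheta (aeval eis A) := by
  induction A using MvPolynomial.induction_on with
  | C a => simp [ramanujanDeriv]
  | add p q hp hq => rw [map_add, map_add, map_add, map_add, hp, hq]; ring
  | mul_X p j hp =>
    have hX : aeval eis (ramanujanDeriv (X j)) = 12 * qTheta (eis j) := by
      rw [ramanujanDeriv, mkDerivation_X]
      fin_cases j
      · simp only [ramanujanField, Fin.zero_eta, Matrix.cons_val_zero, map_sub, map_pow, aeval_X]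
        rw [qTheta_eis_zero]
      · simp only [ramanujanField, Fin.mk_one, Matrix.cons_val_one, Matrix.cons_val_zero, map_sub,
          map_mul, map_ofNat, aeval_X]
        linear_combination (-4) * qTheta_eis_one
      · simp only [ramanujanField, Fin.reduceFinMk, Matrix.cons_val, map_sub,
          map_mul, map_ofNat, map_pow, aeval_X]
        linear_combination (-6) * qTheta_eis_two
    rw [Derivation.leibniz, map_mul, map_add, smul_eq_mul, smul_eq_mul, map_mul, map_mul, hp, hX,
      Derivation.leibniz, aeval_X, smul_eq_mul, smul_eq_mul]
    ring

lemma mvLength_ramanujanField_le (i : Fin 3) : mvLength (ramanujanField i) ≤ 12 := by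
  have hX : ∀ (j : Fin 3) (B : MvPolynomial (Fin 3) ℤ), mvLength (X j * B) ≤ mvLength B := by
    intro j B
    have := mvLength_monomial_mul_le (Finsupp.single j 1) 1 B
    simpa [X] using this
  have hC : ∀ (a : ℤ) (B : MvPolynomial (Fin 3) ℤ), mvLength (C a * B) ≤ |(a : ℝ)| * mvLength B :=
    fun a B => mvLength_monomial_mul_le 0 a B
  have h2 : ∀ j k l : Fin 3, mvLength (X j * X k - X l) ≤ 2 := by
    intro j k l
    rw [sub_eq_add_neg]
    have h1 := mvLength_add_le (X j * X k) (-X l)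
    rw [mvLength_neg, mvLength_X] at h1
    have h3 := hX j (X k)
    rw [mvLength_X] at h3
    linarith
  have h3 : ∀ j k l m : Fin 3, mvLength (X j * X k - X l * X m) ≤ 2 := by
    intro j k l m
    rw [sub_eq_add_neg]
    have h1 := mvLength_add_le (X j * X k) (-(X l * X m))
    rw [mvLength_neg] at h1
    have h3 := hX j (X k)
    have h4 := hX l (X m)
    rw [mvLength_X] at h3 h4
    linarith
  fin_cases i
  · simp only [ramanujanField, Fin.zero_eta, Matrix.cons_val_zero, pow_two]
    linarith [h2 0 0 1]
  · simp only [ramanujanField, Fin.mk_one, Matrix.cons_val_one, Matrix.cons_val_zero]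
    have h := hC 4 (X 0 * X 1 - X 2)
    rw [map_ofNat] at h
    norm_num at h
    linarith [h2 0 1 2]
  · simp only [ramanujanField, Fin.reduceFinMk, Matrix.cons_val, pow_two]
    have h := hC 6 (X 0 * X 2 - X 1 * X 1)
    rw [map_ofNat] at h
    norm_num at h
    linarith [h3 0 2 1 1]

lemma totalDegree_ramanujanField_le (i : Fin 3) : (ramanujanField i).totalDegree ≤ 2 := by
  have hXX : ∀ j k : Fin 3, (X j * X k : MvPolynomial (Fin 3) ℤ).totalDegree ≤ 2 := fun j k => by
    have := totalDegree_mul (X j : MvPolynomial (Fin 3) ℤ) (X k)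
    simpa [totalDegree_X] using this
  have hC : ∀ (a : ℤ) (B : MvPolynomial (Fin 3) ℤ), B.totalDegree ≤ 2 →
      (C a * B).totalDegree ≤ 2 := fun a B h => by
    have := totalDegree_mul (C a) B
    rw [totalDegree_C, zero_add] at this
    exact this.trans h
  have hsub : ∀ A B : MvPolynomial (Fin 3) ℤ, A.totalDegree ≤ 2 → B.totalDegree ≤ 2 →
      (A - B).totalDegree ≤ 2 := fun A B hA hB => (totalDegree_sub A B).trans (max_le hA hB)
  have hX : ∀ j : Fin 3, (X j : MvPolynomial (Fin 3) ℤ).totalDegree ≤ 2 := fun j => by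
    rw [totalDegree_X]; norm_num
  fin_cases i
  · simp only [ramanujanField, Fin.zero_eta, Matrix.cons_val_zero, pow_two]
    exact hsub _ _ (hXX _ _) (hX _)
  · simp only [ramanujanField, Fin.mk_one, Matrix.cons_val_one, Matrix.cons_val_zero]
    have h := hC 4 _ (hsub _ _ (hXX 0 1) (hX 2))
    rwa [map_ofNat] at h
  · simp only [ramanujanField, Fin.reduceFinMk, Matrix.cons_val, pow_two]
    have h := hC 6 _ (hsub _ _ (hXX 0 2) (hXX 1 1))
    rwa [map_ofNat] at h

lemma ramanujanDeriv_eq_sum (A : MvPolynomial (Fin 3) ℤ) :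
    ramanujanDeriv A = ∑ e ∈ A.support, ∑ i : Fin 3,
      monomial (e - Finsupp.single i 1) (A.coeff e * (e i : ℤ)) * ramanujanField i := by
  conv_lhs => rw [A.as_sum, map_sum]
  refine Finset.sum_congr rfl fun e _ => ?_
  rw [ramanujanDeriv, mkDerivation_monomial, Finsupp.sum_fintype _ _ (by simp), Finset.smul_sum]
  refine Finset.sum_congr rfl fun i _ => ?_
  rw [smul_eq_mul, ← smul_mul_assoc, smul_monomial, smul_eq_mul]

lemma totalDegree_ramanujanDeriv_le {A : MvPolynomial (Fin 3) ℤ} {D : ℕ}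
    (hD : A.totalDegree ≤ D) : (ramanujanDeriv A).totalDegree ≤ D + 1 := by
  rw [ramanujanDeriv_eq_sum]
  refine totalDegree_finsetSum_le fun e he => totalDegree_finsetSum_le fun i _ => ?_
  have hdeg := mvDegree_le hD he
  by_cases hi : e i = 0
  · simp [hi]
  · refine (totalDegree_mul _ _).trans ?_
    have h1 := totalDegree_ramanujanField_le i
    have h2 := totalDegree_monomial_le (e - Finsupp.single i 1) (A.coeff e * (e i : ℤ))
    rw [Finsupp.sum_fintype _ _ (by simp)] at h2
    have h3 : (∑ j, (e - Finsupp.single i 1 : Fin 3 →₀ ℕ) j) + 1 ≤ D := by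
      fin_cases i <;> simp [Fin.sum_univ_three] at hi ⊢ <;> lia
    simp only [id] at h2
    lia

lemma mvLength_ramanujanDeriv_le {A : MvPolynomial (Fin 3) ℤ} {D : ℕ}
    (hD : A.totalDegree ≤ D) : mvLength (ramanujanDeriv A) ≤ 12 * D * mvLength A := by
  rw [ramanujanDeriv_eq_sum]
  refine (mvLength_sum_le _ _).trans ?_
  conv_rhs => rw [mvLength, Finset.mul_sum]
  refine Finset.sum_le_sum fun e he => ?_
  refine (mvLength_sum_le _ _).trans ?_
  have hdeg : ((e 0 + e 1 + e 2 : ℕ) : ℝ) ≤ D := by exact_mod_cast mvDegree_le hD he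
  calc ∑ i : Fin 3, mvLength (monomial (e - Finsupp.single i 1) (A.coeff e * (e i : ℤ)) *
          ramanujanField i)
      ≤ ∑ i : Fin 3, |((A.coeff e : ℤ) : ℝ)| * (e i : ℝ) * 12 := by
        refine Finset.sum_le_sum fun i _ => ?_
        refine (mvLength_monomial_mul_le _ _ _).trans ?_
        push_cast
        rw [abs_mul, Nat.abs_cast]
        exact mul_le_mul_of_nonneg_left (mvLength_ramanujanField_le i) (by positivity)
    _ = 12 * ((e 0 + e 1 + e 2 : ℕ) : ℝ) * |((A.coeff e : ℤ) : ℝ)| := by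
        rw [Fin.sum_univ_three]; push_cast; ring
    _ ≤ 12 * D * |((A.coeff e : ℤ) : ℝ)| := by gcongr

lemma coeff_aeval_iterate_ramanujanDeriv (A : MvPolynomial (Fin 3) ℤ) (t n : ℕ) :
    PowerSeries.coeff n (aeval eis (ramanujanDeriv^[t] A)) =
      (12 * n : ℤ) ^ t * PowerSeries.coeff n (aeval eis A) := by
  induction t with
  | zero => simp
  | succ t ih =>
    rw [Function.iterate_succ_apply', aeval_ramanujanDeriv,
      show (12 : PowerSeries ℤ) = PowerSeries.C 12 from (map_ofNat _ 12).symm,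
      PowerSeries.coeff_C_mul, coeff_qTheta, ih]
    ring

lemma totalDegree_iterate_ramanujanDeriv_le {A : MvPolynomial (Fin 3) ℤ} {D : ℕ}
    (hD : A.totalDegree ≤ D) (t : ℕ) : (ramanujanDeriv^[t] A).totalDegree ≤ D + t := by
  induction t with
  | zero => simpa
  | succ t ih =>
    rw [Function.iterate_succ_apply']
    exact totalDegree_ramanujanDeriv_le ih

lemma mvLength_iterate_ramanujanDeriv_le {A : MvPolynomial (Fin 3) ℤ} {D : ℕ}
    (hD : A.totalDegree ≤ D) (t : ℕ) :
    mvLength (ramanujanDeriv^[t] A) ≤ (12 * (D + t)) ^ t * mvLength A := by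
  induction t with
  | zero => simp
  | succ t ih =>
    rw [Function.iterate_succ_apply']
    have h0 := mvLength_nonneg A
    refine (mvLength_ramanujanDeriv_le (totalDegree_iterate_ramanujanDeriv_le hD t)).trans ?_
    push_cast
    calc 12 * ((D : ℝ) + t) * mvLength (ramanujanDeriv^[t] A)
        ≤ (12 * ((D : ℝ) + (t + 1))) * ((12 * (D + (t + 1))) ^ t * mvLength A) := by
          gcongr
          · exact mvLength_nonneg _
          · linarith
          · refine ih.trans ?_
            gcongr
            linarith
      _ = _ := by ring

end RamanujanDerivation

section Multiplicity

open PowerSeries Metric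

lemma differentiableOn_qEval {f : ℤ⟦X⟧} (hf : QSummable f) :
    DifferentiableOn ℂ (qEval f) (ball 0 1) := fun q hq =>
  (hasDerivAt_qEval hf (by simpa using hq)).differentiableAt.differentiableWithinAt

lemma analyticAt_qEval {f : ℤ⟦X⟧} (hf : QSummable f) {q : ℂ} (hq : ‖q‖ < 1) :
    AnalyticAt ℂ (qEval f) q :=
  (differentiableOn_qEval hf).analyticAt (isOpen_ball.mem_nhds (by simpa using hq))

lemma le_analyticOrderAt_qEval {T : ℕ} {f : ℤ⟦X⟧} (hf : QSummable f) {q : ℂ} (hq : ‖q‖ < 1)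
    (hq0 : q ≠ 0) (h : ∀ t < T, qEval (qTheta^[t] f) q = 0) :
    (T : ℕ∞) ≤ analyticOrderAt (qEval f) q := by
  induction T generalizing f with
  | zero => simp
  | succ T ih =>
    have h1 := ih hf.qTheta fun t ht => h (t + 1) (by lia)
    have h0 : qEval f q = 0 := h 0 (by lia)
    have ha := analyticAt_qEval hf hq
    have hm : analyticOrderAt (qEval (qTheta f)) q = analyticOrderAt (deriv (qEval f)) q := by
      have he : qEval (qTheta f) =ᶠ[nhds q] id * deriv (qEval f) := by
        filter_upwards [isOpen_ball.mem_nhds (show q ∈ ball 0 1 by simpa using hq)] with w hw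
        rw [Pi.mul_apply, id, qEval_qTheta, (hasDerivAt_qEval hf (by simpa using hw)).deriv]
      rw [analyticOrderAt_congr he, analyticOrderAt_mul analyticAt_id ha.deriv]
      have : analyticOrderAt (id : ℂ → ℂ) q = 0 :=
        (analyticAt_id (𝕜 := ℂ) (z := q)).analyticOrderAt_eq_zero.mpr hq0
      rw [this, zero_add]
    have h2 := ha.analyticOrderAt_deriv_add_one
    simp only [h0, sub_zero] at h2
    rw [← h2, ← hm, Nat.cast_add, Nat.cast_one]
    gcongr

lemma exists_eq_pow_mul {T : ℕ} {G : ℂ → ℂ} {U : Set ℂ} (hU : IsOpen U)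
    (hG : DifferentiableOn ℂ G U) {q : ℂ} (hq : q ∈ U) (h : (T : ℕ∞) ≤ analyticOrderAt G q) :
    ∃ K : ℂ → ℂ, DifferentiableOn ℂ K U ∧ ∀ w, G w = (w - q) ^ T * K w := by
  induction T generalizing G with
  | zero => exact ⟨G, hG, by simp⟩
  | succ T ih =>
    have hn := hU.mem_nhds hq
    have hd : DifferentiableOn ℂ (dslope G q) U := (Complex.differentiableOn_dslope hn).mpr hG
    have h0 : G q = 0 := by
      by_contra hne
      rw [(hG.analyticAt hn).analyticOrderAt_eq_zero.mpr hne] at h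
      simp at h
    have hG' : G = (fun w => w - q) * dslope G q := by
      ext w
      have := sub_smul_dslope G q w
      rw [h0, sub_zero, smul_eq_mul] at this
      exact this.symm
    have ha : AnalyticAt ℂ (fun w : ℂ => w - q) q := by fun_prop
    have ho : analyticOrderAt (fun w : ℂ => w - q) q = 1 := by
      have := (analyticAt_id (𝕜 := ℂ) (z := q)).analyticOrderAt_sub_eq_one_of_deriv_ne_zero
        (by simp)
      simpa using this
    have h1 : (T : ℕ∞) ≤ analyticOrderAt (dslope G q) q := by
      rw [hG', analyticOrderAt_mul ha (hd.analyticAt hn), ho, Nat.cast_add, Nat.cast_one,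
        add_comm] at h
      exact (ENat.add_le_add_iff_left (by simp)).mp h
    obtain ⟨K, hK, hKG⟩ := ih hd h1
    refine ⟨K, hK, fun w => ?_⟩
    rw [hG', Pi.mul_apply, hKG]; ring

lemma norm_sq_sub_conj_mul {r : ℝ} {w : ℂ} (hw : ‖w‖ = r) (q : ℂ) :
    ‖(r : ℂ) ^ 2 - (starRingEnd ℂ) q * w‖ = r * ‖w - q‖ := by
  have h1 : (r : ℂ) ^ 2 = w * (starRingEnd ℂ) w := by
    rw [Complex.mul_conj, Complex.normSq_eq_norm_sq, hw]; push_cast; rfl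
  rw [h1, show w * (starRingEnd ℂ) w - (starRingEnd ℂ) q * w = w * (starRingEnd ℂ) (w - q) by
    rw [map_sub]; ring, norm_mul, RCLike.norm_conj, hw]

/-- A quantitative Schwarz lemma with a zero of multiplicity `T`. -/
lemma norm_zero_le_of_analyticOrderAt {T : ℕ} {G : ℂ → ℂ} (hG : DifferentiableOn ℂ G (ball 0 1))
    {q : ℂ} {r : ℝ} (hqr : ‖q‖ < r) (hr1 : r < 1) (h : (T : ℕ∞) ≤ analyticOrderAt G q) {C : ℝ}
    (hC : ∀ w : ℂ, ‖w‖ = r → ‖G w‖ ≤ C) : ‖G 0‖ ≤ (‖q‖ / r) ^ T * C := by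
  have hr : 0 < r := (norm_nonneg q).trans_lt hqr
  obtain ⟨K, hK, hKG⟩ := exists_eq_pow_mul isOpen_ball hG
    (show q ∈ ball 0 1 by simpa using hqr.trans hr1) h
  let H : ℂ → ℂ := fun w => K w * ((r : ℂ) ^ 2 - (starRingEnd ℂ) q * w) ^ T
  have hH : DifferentiableOn ℂ H (ball 0 1) := by
    refine hK.mul (Differentiable.differentiableOn ?_)
    fun_prop
  have hb : ∀ w ∈ frontier (ball (0 : ℂ) r), ‖H w‖ ≤ r ^ T * C := by
    intro w hw
    rw [frontier_ball _ hr.ne', mem_sphere_zero_iff_norm] at hw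
    have h1 := hC w hw
    rw [hKG, norm_mul, norm_pow] at h1
    simp only [H, norm_mul, norm_pow]
    rw [norm_sq_sub_conj_mul hw, mul_pow]
    calc ‖K w‖ * (r ^ T * ‖w - q‖ ^ T) = r ^ T * (‖w - q‖ ^ T * ‖K w‖) := by ring
      _ ≤ r ^ T * C := by gcongr
  have h0 := Complex.norm_le_of_forall_mem_frontier_norm_le isBounded_ball
    (hH.diffContOnCl_ball (closedBall_subset_ball hr1)) hb
    (subset_closure (mem_ball_self hr))
  simp only [H, mul_zero, sub_zero, norm_mul, norm_pow, Complex.norm_real,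
    Real.norm_of_nonneg hr.le] at h0
  have h2 : ‖K 0‖ * r ^ T ≤ C := by
    have : r ^ T * (‖K 0‖ * r ^ T) ≤ r ^ T * C := by
      calc _ = ‖K 0‖ * (r ^ 2) ^ T := by ring
        _ ≤ _ := h0
    exact le_of_mul_le_mul_left this (by positivity)
  rw [hKG, zero_sub, norm_mul, norm_pow, norm_neg, div_pow]
  calc ‖q‖ ^ T * ‖K 0‖ = ‖q‖ ^ T / r ^ T * (‖K 0‖ * r ^ T) := by field_simp
    _ ≤ _ := by gcongr

lemma QSummable.of_X_pow_mul {M : ℕ} {g : ℤ⟦X⟧} (h : QSummable (X ^ M * g)) : QSummable g := by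
  intro r hr hr1
  set s := (1 + r) / 2 with hs
  have hs0 : 0 < s := by positivity
  have h1 := ((summable_nat_add_iff M).mpr (h s hs0.le (by linarith))).mul_right (s ^ M)⁻¹
  refine Summable.of_nonneg_of_le (fun n => by positivity) (fun n => ?_) h1
  rw [coeff_X_pow_mul, pow_add, mul_assoc, mul_assoc, mul_inv_cancel₀ (by positivity), mul_one]
  gcongr
  linarith

lemma qEval_X_pow_mul {M : ℕ} (g : ℤ⟦X⟧) (hg : QSummable g) {q : ℂ} (hq : ‖q‖ < 1) :
    qEval (X ^ M * g) q = q ^ M * qEval g q := by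
  have h := hasSum_qEval hg hq
  have h1 : HasSum (fun n => ((coeff (n + M) (X ^ M * g) : ℤ) : ℂ) * q ^ (n + M))
      (q ^ M * qEval g q) := by
    refine (h.mul_left (q ^ M)).congr_fun fun n => ?_
    rw [coeff_X_pow_mul, pow_add]; ring
  rw [hasSum_nat_add_iff (f := fun n => ((coeff n (X ^ M * g) : ℤ) : ℂ) * q ^ n)] at h1
  rw [Finset.sum_eq_zero, add_zero] at h1
  · exact h1.tsum_eq
  · intro n hn
    rw [coeff_X_pow_mul', if_neg (by simpa using hn)]
    simp

/-- An integral power series of exact order `M` cannot vanish to too high an order at an interior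
point of the unit disc. -/
lemma one_le_of_iterate_qTheta_eq_zero {f : ℤ⟦X⟧} (hf : QSummable f) {M T : ℕ}
    (hM : ∀ n < M, coeff n f = 0) (hM0 : coeff M f ≠ 0) {q : ℂ} (hq0 : q ≠ 0) {r : ℝ}
    (hqr : ‖q‖ < r) (hr1 : r < 1) (h : ∀ t < T, qEval (qTheta^[t] f) q = 0) :
    1 ≤ (‖q‖ / r) ^ T * (qNorm f r / r ^ M) := by
  have hr : 0 < r := (norm_nonneg q).trans_lt hqr
  have hq : ‖q‖ < 1 := hqr.trans hr1
  obtain ⟨g, rfl⟩ := X_pow_dvd_iff.mpr hM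
  have hg := hf.of_X_pow_mul
  have h1 := le_analyticOrderAt_qEval hf hq hq0 h
  have h2 : analyticOrderAt (qEval (X ^ M * g)) q = analyticOrderAt (qEval g) q := by
    have he : qEval (X ^ M * g) =ᶠ[nhds q] (fun w => w ^ M) * qEval g := by
      filter_upwards [isOpen_ball.mem_nhds (show q ∈ ball 0 1 by simpa using hq)] with w hw
      exact qEval_X_pow_mul g hg (by simpa using hw)
    have ha : AnalyticAt ℂ (fun w : ℂ => w ^ M) q := by fun_prop
    rw [analyticOrderAt_congr he, analyticOrderAt_mul ha (analyticAt_qEval hg hq),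
      ha.analyticOrderAt_eq_zero.mpr (pow_ne_zero _ hq0), zero_add]
  rw [h2] at h1
  have h3 := norm_zero_le_of_analyticOrderAt (differentiableOn_qEval hg) hqr hr1 h1
    (C := qNorm (X ^ M * g) r / r ^ M) fun w hw => by
      have := norm_qEval_le hf (hw ▸ hr1 : ‖w‖ < 1)
      rw [qEval_X_pow_mul g hg (hw ▸ hr1), norm_mul, norm_pow, hw] at this
      rw [le_div_iff₀ (by positivity)]
      linarith
  refine le_trans ?_ h3
  have h4 : qEval g 0 = ((coeff 0 g : ℤ) : ℂ) := by
    rw [qEval, tsum_eq_single 0]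
    · simp
    · intro n hn; simp [hn]
  rw [h4, Complex.norm_intCast]
  have h5 : coeff M (X ^ M * g) = coeff 0 g := by
    have := coeff_X_pow_mul g M 0
    simpa using this
  rw [h5] at hM0
  exact_mod_cast Int.one_le_abs hM0

end Multiplicity

section Siegel

open MvPolynomial

lemma siegel_of_abs_le {α β : Type*} [Fintype α] [Fintype β] (A : Matrix α β ℤ)
    (hm : 0 < Fintype.card α) (hn : 2 * Fintype.card α ≤ Fintype.card β) {E : ℝ} (hE : 1 ≤ E)
    (hA : ∀ i j, |(A i j : ℝ)| ≤ E) :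
    ∃ t : β → ℤ, t ≠ 0 ∧ A.mulVec t = 0 ∧ ∀ j, |(t j : ℝ)| ≤ Fintype.card β * E := by
  let := Matrix.seminormedAddCommGroup (m := α) (n := β) (α := ℤ)
  obtain ⟨t, ht0, htA, ht⟩ := Int.Matrix.exists_ne_zero_int_vec_norm_le A (by lia) hm
  refine ⟨t, ht0, htA, fun j => ?_⟩
  have hAn : max 1 ‖A‖ ≤ E := by
    refine max_le hE ((Matrix.norm_le_iff (by linarith)).mpr fun i j => ?_)
    rw [Int.norm_eq_abs]
    exact hA i j
  have h1 : (1 : ℝ) ≤ Fintype.card α := by exact_mod_cast hm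
  have h2 : 2 * (Fintype.card α : ℝ) ≤ Fintype.card β := by exact_mod_cast hn
  have hexp : (Fintype.card α : ℝ) / (Fintype.card β - Fintype.card α) ≤ 1 := by
    rw [div_le_one (by linarith)]; linarith
  have hbase : 1 ≤ (Fintype.card β : ℝ) * max 1 ‖A‖ := by
    have : (1 : ℝ) ≤ max 1 ‖A‖ := le_max_left _ _
    nlinarith
  calc |(t j : ℝ)| = ‖t j‖ := (Int.norm_eq_abs _).symm
    _ ≤ ‖t‖ := norm_le_pi_norm t j
    _ ≤ _ := ht
    _ ≤ (Fintype.card β * max 1 ‖A‖) ^ (1 : ℝ) := Real.rpow_le_rpow_of_exponent_le hbase hexp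
    _ ≤ Fintype.card β * E := by rw [Real.rpow_one]; gcongr

/-- The exponent vector with given entries. -/
noncomputable def exponentOf {N : ℕ} (e : Fin 3 → Fin N) : Fin 3 →₀ ℕ :=
  Finsupp.equivFunOnFinite.symm fun j => (e j : ℕ)

lemma exponentOf_injective {N : ℕ} : Function.Injective (exponentOf (N := N)) := by
  intro e e' h
  have h1 := Finsupp.equivFunOnFinite.symm.injective h
  ext j
  exact congrFun h1 j

lemma totalDegree_monomial_exponentOf_le {N : ℕ} (e : Fin 3 → Fin N) (a : ℤ) :
    (monomial (exponentOf e) a).totalDegree ≤ 3 * N := by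
  refine (totalDegree_monomial_le _ _).trans ?_
  rw [Finsupp.sum_fintype _ _ (by simp), Fin.sum_univ_three]
  simp only [exponentOf, Finsupp.equivFunOnFinite_symm_apply_apply, id]
  lia

lemma mvLength_monomial (e : Fin 3 →₀ ℕ) (a : ℤ) : mvLength (monomial e a) ≤ |(a : ℝ)| := by
  classical
  rw [mvLength_eq_sum support_monomial_subset]; simp

lemma qNorm_eis_radius_le (j : Fin 3) {Y : ℝ} (hY : 1 ≤ Y) :
    qNorm (eis j) (1 - 1 / Y) ≤ 362880 * Y ^ 7 := by
  have h1 : 1 / Y ≤ 1 := by rw [div_le_one (by linarith)]; exact hY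
  refine (qNorm_eis_le j (by linarith) (by simp; linarith)).trans (le_of_eq ?_)
  field_simp
  ring

lemma one_half_le_pow {M : ℕ} {Y : ℝ} (hM : 1 ≤ M) (hY : 2 * M ≤ Y) {n : ℕ} (hn : n ≤ M) :
    1 / 2 ≤ (1 - 1 / Y) ^ n := by
  have hM' : (1 : ℝ) ≤ M := by exact_mod_cast hM
  have hn' : (n : ℝ) ≤ M := by exact_mod_cast hn
  have hY0 : 0 < Y := by linarith
  have hi : 1 / Y ≤ 1 := by rw [div_le_one hY0]; linarith
  have h1 := one_add_mul_le_pow (a := -(1 / Y)) (by linarith) n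
  have h2 : n * (1 / Y) ≤ 1 / 2 := by
    rw [mul_one_div, div_le_div_iff₀ hY0 two_pos]; linarith
  rw [← sub_eq_add_neg] at h1
  linarith

lemma abs_coeff_aeval_eis_le {A : MvPolynomial (Fin 3) ℤ} {D M : ℕ} (hD : A.totalDegree ≤ D)
    {Y : ℝ} (hM : 1 ≤ M) (hY : 2 * M ≤ Y) {n : ℕ} (hn : n ≤ M) :
    |((PowerSeries.coeff n (aeval eis A) : ℤ) : ℝ)| ≤
      2 * (mvLength A * (362880 * Y ^ 7) ^ D) := by
  have hM' : (1 : ℝ) ≤ M := by exact_mod_cast hM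
  have hY1 : 1 < Y := by linarith
  have hi : 1 / Y < 1 := by rw [div_lt_one (by linarith)]; exact hY1
  have hi0 : 0 < 1 / Y := by positivity
  have hS : 1 ≤ 362880 * Y ^ 7 := by
    have := one_le_pow₀ hY1.le (n := 7)
    linarith
  have h1 := abs_coeff_mul_pow_le_qNorm (qSummable_aeval qSummable_eis A) (r := 1 - 1 / Y)
    (by linarith) (by linarith) n
  have h2 := qNorm_aeval_le qSummable_eis (r := 1 - 1 / Y) (by linarith) (by linarith) hS
    (fun j => qNorm_eis_radius_le j hY1.le) hD
  have h3 := one_half_le_pow hM hY hn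
  have h4 := mul_le_mul_of_nonneg_left h3
    (abs_nonneg ((PowerSeries.coeff n (aeval eis A) : ℤ) : ℝ))
  linarith

lemma exists_auxiliary_polynomial {N M : ℕ} (hM : 1 ≤ M) (hNM : 2 * M ≤ N ^ 3) :
    ∃ A : MvPolynomial (Fin 3) ℤ, A ≠ 0 ∧ A.totalDegree ≤ 3 * N ∧
      mvLength A ≤ 2 * (N : ℝ) ^ 6 * (362880 * ((N : ℝ) ^ 3) ^ 7) ^ (3 * N) ∧
      ∀ n < M, PowerSeries.coeff n (aeval eis A) = 0 := by
  classical
  have hNM' : 2 * (M : ℝ) ≤ (N : ℝ) ^ 3 := by exact_mod_cast hNM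
  have hM' : (1 : ℝ) ≤ M := by exact_mod_cast hM
  have hN3 : (1 : ℝ) ≤ (N : ℝ) ^ 3 := by linarith
  set S : ℝ := (362880 * ((N : ℝ) ^ 3) ^ 7) ^ (3 * N) with hS
  have hS1 : 1 ≤ S := by
    refine one_le_pow₀ ?_
    have := one_le_pow₀ hN3 (n := 7)
    linarith
  let V : Matrix (Fin M) (Fin 3 → Fin N) ℤ := fun n e =>
    PowerSeries.coeff n (aeval eis (monomial (exponentOf e) (1 : ℤ)))
  have hV : ∀ n e, |(V n e : ℝ)| ≤ 2 * S := by
    intro n e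
    have h1 := abs_coeff_aeval_eis_le (totalDegree_monomial_exponentOf_le e 1) hM hNM' n.2.le
    have h2 := mvLength_monomial (exponentOf e) 1
    refine h1.trans ?_
    rw [Int.cast_one, abs_one] at h2
    have : mvLength (monomial (exponentOf e) (1 : ℤ)) * S ≤ 1 * S := by gcongr
    linarith
  obtain ⟨t, ht0, htV, ht⟩ := siegel_of_abs_le V (by simp; lia) (by simpa using hNM)
    (by linarith : 1 ≤ 2 * S) hV
  refine ⟨∑ e, monomial (exponentOf e) (t e), ?_, ?_, ?_, ?_⟩
  · intro h0
    apply ht0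
    ext e
    have := congrArg (coeff (exponentOf e)) h0
    rw [coeff_sum, coeff_zero, Finset.sum_eq_single e, coeff_monomial, if_pos rfl] at this
    · exact this
    · intro e' _ hne
      rw [coeff_monomial, if_neg (fun h => hne (exponentOf_injective h))]
    · simp
  · exact totalDegree_finsetSum_le fun e _ => totalDegree_monomial_exponentOf_le e _
  · refine (mvLength_sum_le _ _).trans ?_
    have hcard : (Fintype.card (Fin 3 → Fin N) : ℝ) = (N : ℝ) ^ 3 := by simp
    calc ∑ e : Fin 3 → Fin N, mvLength (monomial (exponentOf e) (t e))
        ≤ ∑ e : Fin 3 → Fin N, (N : ℝ) ^ 3 * (2 * S) := by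
          refine Finset.sum_le_sum fun e _ => (mvLength_monomial _ _).trans ?_
          rw [← hcard]
          exact ht e
      _ = 2 * (N : ℝ) ^ 6 * S := by
          rw [Finset.sum_const, nsmul_eq_mul, Finset.card_univ, hcard]; ring
  · intro n hn
    rw [map_sum, map_sum]
    have h1 := congrFun htV ⟨n, hn⟩
    rw [Matrix.mulVec, dotProduct, Pi.zero_apply] at h1
    rw [← h1]
    refine Finset.sum_congr rfl fun e _ => ?_
    have h2 : monomial (exponentOf e) (t e) = C (t e) * monomial (exponentOf e) (1 : ℤ) := by
      rw [C_mul_monomial, mul_one]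
    have h3 : aeval eis (C (t e)) = PowerSeries.C (t e) := by
      rw [← MvPolynomial.algebraMap_eq, AlgHom.commutes, PowerSeries.algebraMap_apply]; rfl
    rw [h2, map_mul, h3, PowerSeries.coeff_C_mul, mul_comm]

end Siegel

section ZeroEstimate

open PowerSeries

lemma exists_eis_sq_sub_cube :
    ∃ g : ℤ⟦X⟧, eis 2 ^ 2 - eis 1 ^ 3 = X * g ∧ constantCoeff g = -1728 := by
  have h0 : constantCoeff (eis 2 ^ 2 - eis 1 ^ 3) = 0 := by simp [constantCoeff_eis]
  obtain ⟨g, hg⟩ := X_dvd_iff.mpr h0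
  refine ⟨g, hg, ?_⟩
  have h1 : coeff 1 (eis 1) = 240 := by simp [eis, divisorSeries]
  have h2 : coeff 1 (eis 2) = -504 := by simp [eis, divisorSeries]
  have h3 : coeff 1 (eis 2 ^ 2 - eis 1 ^ 3) = -1728 := by
    rw [map_sub, pow_two, pow_succ, pow_two]
    simp [coeff_mul, Finset.Nat.antidiagonal_succ, h1, h2, coeff_zero_eis]
  rw [hg, show (1 : ℕ) = 0 + 1 from rfl, coeff_succ_X_mul] at h3
  simpa using h3

lemma exists_coeff_ne_zero_of_isobaric {S : Finset (Fin 3 →₀ ℕ)} (hS : S.Nonempty)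
    {a : (Fin 3 →₀ ℕ) → ℤ} (ha : ∀ e ∈ S, a e ≠ 0) {s w D : ℕ} (hs : ∀ e ∈ S, e 0 = s)
    (hw : ∀ e ∈ S, 4 * e 1 + 6 * e 2 = w) (hD : ∀ e ∈ S, e 2 ≤ D) :
    ∃ n ≤ D, coeff n (∑ e ∈ S, C (a e) * (eis 1 ^ e 1 * eis 2 ^ e 2)) ≠ 0 := by
  obtain ⟨g, hg, hg0⟩ := exists_eis_sq_sub_cube
  obtain ⟨u, hu⟩ : ∃ u : ℤ⟦X⟧, eis 1 * u = 1 := by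
    have : IsUnit (eis 1) := by
      rw [isUnit_iff_constantCoeff, constantCoeff_eis]; exact isUnit_one
    exact this.exists_right_inv
  have hu0 : constantCoeff u = 1 := by
    have := congrArg constantCoeff hu
    simpa [constantCoeff_eis] using this
  set W : ℤ⟦X⟧ := eis 2 ^ 2 * u ^ 3 with hW
  have hW1 : W - 1 = X * (g * u ^ 3) := by
    have : W - 1 = (eis 2 ^ 2 - eis 1 ^ 3) * u ^ 3 := by
      rw [hW, sub_mul, ← mul_pow (eis 1), hu, one_pow]
    rw [this, hg]; ring
  have hW0 : constantCoeff W = 1 := by simp [hW, constantCoeff_eis, hu0]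
  set p : Polynomial ℤ := ∑ e ∈ S, Polynomial.monomial (e 2 / 2) (a e) with hp
  have hinj : ∀ e ∈ S, ∀ f ∈ S, e 2 / 2 = f 2 / 2 → e = f := by
    intro e he f hf hef
    have h1 := hw e he
    have h2 := hw f hf
    have h3 := hs e he
    have h4 := hs f hf
    ext i
    fin_cases i
    · simpa using h3.trans h4.symm
    · simp only [Fin.mk_one]; omega
    · simp only [Fin.reduceFinMk]; omega
  have hp0 : p ≠ 0 := by
    obtain ⟨e, he⟩ := hS
    intro h
    have h1 : p.coeff (e 2 / 2) = a e := by
      rw [hp, Polynomial.finsetSum_coeff, Finset.sum_eq_single_of_mem e he]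
      · simp
      · intro f hf hfe
        rw [Polynomial.coeff_monomial, if_neg]
        exact fun h' => hfe (hinj f hf e he h')
    rw [h, Polynomial.coeff_zero] at h1
    exact ha e he h1.symm
  have hpD : p.natDegree ≤ D := by
    refine Polynomial.natDegree_sum_le_of_forall_le _ _ fun e he => ?_
    refine (Polynomial.natDegree_monomial_le _).trans ?_
    have := hD e he
    lia
  obtain ⟨p₁, hp₁, hnd⟩ := Polynomial.exists_eq_pow_rootMultiplicity_mul_and_not_dvd p hp0 1
  set m := p.rootMultiplicity 1 with hm
  have hmD : m ≤ D := by
    have : m ≤ p.natDegree := by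
      have hp₁0 : p₁ ≠ 0 := by rintro rfl; simp at hnd
      conv_rhs => rw [hp₁]
      rw [Polynomial.natDegree_mul (pow_ne_zero _ (Polynomial.X_sub_C_ne_zero 1)) hp₁0,
        Polynomial.natDegree_pow, Polynomial.natDegree_X_sub_C]
      lia
    lia
  refine ⟨m, hmD, ?_⟩
  have hρ : ∃ c ρ : ℕ, ∀ e ∈ S, e 2 = ρ + 2 * (e 2 / 2) ∧ e 1 + 3 * (e 2 / 2) = c := by
    refine ⟨(w / 2 - 3 * (w / 2 % 2)) / 2, w / 2 % 2, fun e he => ?_⟩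
    have := hw e he
    constructor <;> omega
  obtain ⟨c, ρ, hcρ⟩ := hρ
  have hsum : ∑ e ∈ S, C (a e) * (eis 1 ^ e 1 * eis 2 ^ e 2) =
      eis 1 ^ c * eis 2 ^ ρ * Polynomial.aeval W p := by
    rw [hp, map_sum, Finset.mul_sum]
    refine Finset.sum_congr rfl fun e he => ?_
    obtain ⟨h1, h2⟩ := hcρ e he
    set t := e 2 / 2
    have h3 : (eis 1 * u) ^ (3 * t) = 1 := by rw [hu, one_pow]
    rw [Polynomial.aeval_monomial, h1, ← h2, hW,
      show algebraMap ℤ ℤ⟦X⟧ (a e) = C (a e) by simp]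
    calc C (a e) * (eis 1 ^ e 1 * eis 2 ^ (ρ + 2 * t))
        = C (a e) * (eis 1 ^ e 1 * eis 2 ^ (ρ + 2 * t)) * (eis 1 * u) ^ (3 * t) := by
          rw [h3, mul_one]
      _ = _ := by ring
  have hpW : Polynomial.aeval W p = X ^ m * ((g * u ^ 3) ^ m * Polynomial.aeval W p₁) := by
    rw [hp₁, map_mul, map_pow]
    simp only [map_sub, Polynomial.aeval_X, map_one]
    rw [hW1, mul_pow, mul_assoc]
  have hp₁W : constantCoeff (Polynomial.aeval W p₁) = p₁.eval 1 := by
    rw [Polynomial.aeval_def, Polynomial.hom_eval₂, hW0, Polynomial.eval,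
      RingHom.ext_int (constantCoeff.comp (algebraMap ℤ ℤ⟦X⟧)) (RingHom.id ℤ)]
  have hp₁1 : p₁.eval 1 ≠ 0 := fun h => hnd (Polynomial.dvd_iff_isRoot.mpr h)
  rw [hsum, hpW, mul_left_comm, coeff_X_pow_mul', if_pos le_rfl, Nat.sub_self,
    coeff_zero_eq_constantCoeff_apply]
  simp [constantCoeff_eis, hu0, hg0, hp₁W, hp₁1]

end ZeroEstimate

section Transfer

open Polynomial

lemma norm_eval_zero_le_of_norm_eval_le {p : ℂ[X]} {K : ℕ} (hp : p.natDegree ≤ K) {w : ℂ} {ε : ℝ}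
    (h : ∀ n ≤ K, ‖p.eval (w + n)‖ ≤ ε) :
    ‖p.eval 0‖ ≤ (K + 1) * (‖w‖ + K) ^ K * ε := by
  classical
  set s := Finset.range (K + 1)
  set v : ℕ → ℂ := fun n => w + n
  have hv : Set.InjOn v s := fun i _ j _ hij => by simpa [v] using hij
  have hdeg : p.degree < s.card := by
    rw [Finset.card_range]
    exact (degree_le_natDegree).trans_lt (by exact_mod_cast Nat.lt_succ_of_le hp)
  rw [Lagrange.eq_interpolate hv hdeg, Lagrange.interpolate_apply, eval_finsetSum]
  have hε : 0 ≤ ε := (norm_nonneg _).trans (h 0 (Nat.zero_le _))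
  calc ‖∑ i ∈ s, eval 0 (C (eval (v i) p) * Lagrange.basis s v i)‖
      ≤ ∑ i ∈ s, ε * (‖w‖ + K) ^ K := by
        refine norm_sum_le_of_le _ fun i hi => ?_
        rw [eval_mul, eval_C, norm_mul]
        have hiK : i ≤ K := Nat.lt_succ_iff.mp (Finset.mem_range.mp hi)
        refine mul_le_mul (h i hiK) ?_ (norm_nonneg _) hε
        rw [Lagrange.basis, eval_prod, norm_prod]
        calc ∏ j ∈ s.erase i, ‖eval 0 (Lagrange.basisDivisor (v i) (v j))‖
            ≤ ∏ j ∈ s.erase i, (‖w‖ + K) := by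
              refine Finset.prod_le_prod (fun _ _ => norm_nonneg _) fun j hj => ?_
              obtain ⟨hji, hjs⟩ := Finset.mem_erase.mp hj
              have hjK : j ≤ K := Nat.lt_succ_iff.mp (Finset.mem_range.mp hjs)
              simp only [Lagrange.basisDivisor, eval_mul, eval_C, eval_sub, eval_X, zero_sub,
                norm_mul, norm_neg, norm_inv]
              have h1 : 1 ≤ ‖v i - v j‖ := by
                have : v i - v j = ((i - j : ℤ) : ℂ) := by simp [v]
                rw [this, Complex.norm_intCast, ← Int.cast_abs]
                exact_mod_cast Int.one_le_abs (by lia)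
              have h2 : ‖v j‖ ≤ ‖w‖ + K := by
                refine (norm_add_le _ _).trans ?_
                rw [Complex.norm_natCast]
                gcongr
              calc ‖v i - v j‖⁻¹ * ‖v j‖ ≤ 1 * ‖v j‖ := by
                    gcongr; exact inv_le_one_of_one_le₀ h1
                _ ≤ ‖w‖ + K := by rwa [one_mul]
          _ = (‖w‖ + K) ^ K := by
              rw [Finset.prod_const, Finset.card_erase_of_mem hi, Finset.card_range,
                Nat.add_sub_cancel]
    _ = (K + 1) * (‖w‖ + K) ^ K * ε := by
        rw [Finset.sum_const, Finset.card_range, nsmul_eq_mul]; push_cast; ring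

/-- The constant in the transformation law of `E₂` under `z ↦ -1/z`. -/
noncomputable def anomaly : ℂ := 6 / (Real.pi * Complex.I)

lemma one_le_norm_anomaly : 1 ≤ ‖anomaly‖ := by
  rw [anomaly, norm_div, norm_mul, Complex.norm_I, mul_one, Complex.norm_real, Real.norm_eq_abs,
    abs_of_pos Real.pi_pos, one_le_div Real.pi_pos]
  have := Real.pi_le_four
  norm_num
  linarith

/-- If a polynomial in the Eisenstein series is small at the points `-1/(w + n)`, then so is the
part of it which dominates as `n` is formally replaced by `-w`. -/
lemma norm_sum_filter_le_of_neg_inv {ι : Type*} (S : Finset ι) (a : ι → ℂ) (m j l : ι → ℕ)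
    {K a₀ : ℕ} (hK : ∀ i ∈ S, 2 * m i + 4 * j i + 6 * l i ≤ K) (ha₀K : a₀ ≤ K)
    (ha₀ : ∀ i ∈ S, a₀ ≤ m i + 4 * j i + 6 * l i) {w : ℂ} (hw : 0 < w.im) {B ε : ℝ} (hB : 1 ≤ B)
    (hBw : ∀ n : ℕ, n ≤ K → 1 ≤ B * ‖w + n‖)
    (hε : ∀ n : ℕ, n ≤ K → ‖∑ i ∈ S, a i * (eisVal 0 (-(w + n))⁻¹ ^ m i *
      eisVal 1 (-(w + n))⁻¹ ^ j i * eisVal 2 (-(w + n))⁻¹ ^ l i)‖ ≤ ε) :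
    ‖∑ i ∈ S with m i + 4 * j i + 6 * l i = a₀,
      a i * anomaly ^ m i * (eisVal 1 w ^ j i * eisVal 2 w ^ l i)‖ ≤
      (K + 1) * (‖w‖ + K) ^ K * (B ^ K * ε) := by
  set p : ℂ[X] := ∑ i ∈ S, C (a i * (eisVal 1 w ^ j i * eisVal 2 w ^ l i)) *
    (X ^ (m i + 4 * j i + 6 * l i - a₀) * (C (eisVal 0 w) * X + C anomaly) ^ m i) with hp
  have hpK : p.natDegree ≤ K := by
    refine natDegree_sum_le_of_forall_le _ _ fun i hi => ?_
    refine (natDegree_C_mul_le _ _).trans (natDegree_mul_le.trans ?_)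
    have h1 : ((C (eisVal 0 w) * X + C anomaly) ^ m i).natDegree ≤ m i :=
      (natDegree_pow_le_of_le (m i) natDegree_linear_le).trans (by simp)
    rw [natDegree_X_pow]
    have := hK i hi
    lia
  have hp0 : p.eval 0 = ∑ i ∈ S with m i + 4 * j i + 6 * l i = a₀,
      a i * anomaly ^ m i * (eisVal 1 w ^ j i * eisVal 2 w ^ l i) := by
    rw [hp, eval_finsetSum, Finset.sum_filter]
    refine Finset.sum_congr rfl fun i hi => ?_
    simp only [eval_mul, eval_C, eval_pow, eval_X, eval_add, mul_zero, zero_add]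
    split_ifs with h
    · rw [h, Nat.sub_self, pow_zero]; ring
    · have := ha₀ i hi
      rw [zero_pow (by lia)]; ring
  rw [← hp0]
  refine norm_eval_zero_le_of_norm_eval_le hpK fun n hn => ?_
  set x := w + n
  have hx : 0 < x.im := by simpa [x] using hw
  have hval : x ^ a₀ * p.eval x = ∑ i ∈ S, a i * (eisVal 0 (-x)⁻¹ ^ m i *
      eisVal 1 (-x)⁻¹ ^ j i * eisVal 2 (-x)⁻¹ ^ l i) := by
    rw [hp, eval_finsetSum, Finset.mul_sum]
    refine Finset.sum_congr rfl fun i hi => ?_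
    rw [eisVal_zero_neg_inv hx, eisVal_one_neg_inv hx, eisVal_two_neg_inv hx,
      eisVal_add_natCast, eisVal_add_natCast, eisVal_add_natCast]
    simp only [eval_mul, eval_C, eval_pow, eval_X, eval_add]
    have h1 : x ^ a₀ * x ^ (m i + 4 * j i + 6 * l i - a₀) = x ^ m i * (x ^ 4) ^ j i *
        (x ^ 6) ^ l i := by
      rw [← pow_add, ← pow_mul, ← pow_mul, ← pow_add, ← pow_add]
      congr 1
      have := ha₀ i hi
      lia
    rw [show x ^ 2 * eisVal 0 w + 6 / (Real.pi * Complex.I) * x =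
      x * (eisVal 0 w * x + anomaly) by rw [anomaly]; ring, mul_pow, mul_pow, mul_pow]
    linear_combination (a i * (eisVal 1 w ^ j i * eisVal 2 w ^ l i)) *
      (eisVal 0 w * x + anomaly) ^ m i * h1
  have hsmall : ‖x‖ ^ a₀ * ‖p.eval x‖ ≤ ε := by
    rw [← norm_pow, ← norm_mul, hval]
    exact hε n hn
  have hε0 : 0 ≤ ε := (by positivity : 0 ≤ ‖x‖ ^ a₀ * ‖p.eval x‖).trans hsmall
  calc ‖p.eval x‖ ≤ (B * ‖x‖) ^ a₀ * ‖p.eval x‖ :=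
        le_mul_of_one_le_left (norm_nonneg _) (one_le_pow₀ (hBw n hn))
    _ = B ^ a₀ * (‖x‖ ^ a₀ * ‖p.eval x‖) := by ring
    _ ≤ B ^ K * ε := by gcongr

end Transfer

section Descent

lemma im_neg_inv (z : ℂ) : ((-z)⁻¹).im = z.im / ‖z‖ ^ 2 := by
  rw [Complex.inv_im, Complex.normSq_eq_norm_sq]; simp

lemma norm_add_natCast_le {w : ℂ} {c : ℝ} (hw : ‖w‖ ≤ c) {n K : ℕ} (hn : n ≤ K) :
    ‖w + n‖ ≤ c + K := by
  refine (norm_add_le _ _).trans ?_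
  rw [Complex.norm_natCast]
  gcongr

lemma exists_isobaric_norm_le {S : Finset (Fin 3 →₀ ℕ)} (hS : S.Nonempty)
    (a : (Fin 3 →₀ ℕ) → ℂ) {K : ℕ} (hK : ∀ e ∈ S, 2 * e 0 + 4 * e 1 + 6 * e 2 ≤ K)
    {Y ε G : ℝ} (hY : 1 ≤ Y) (hG : G = Y + K + 1)
    (hε : ∀ u : ℂ, 1 / G ^ 4 ≤ u.im →
      ‖∑ e ∈ S, a e * (eisVal 0 u ^ e 0 * eisVal 1 u ^ e 1 * eisVal 2 u ^ e 2)‖ ≤ ε) :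
    ∃ S' ⊆ S, S'.Nonempty ∧ ∃ s w : ℕ, (∀ e ∈ S', e 0 = s) ∧ (∀ e ∈ S', 4 * e 1 + 6 * e 2 = w) ∧
      ‖∑ e ∈ S', a e * (eisVal 1 (Y * Complex.I) ^ e 1 * eisVal 2 (Y * Complex.I) ^ e 2)‖ ≤
        G ^ (4 * K + 2) * ε := by
  have hK0 : (0 : ℝ) ≤ K := Nat.cast_nonneg K
  have hG1 : 1 ≤ G := by linarith
  have hε0 : 0 ≤ ε := by
    refine (norm_nonneg _).trans (hε ((1 / G ^ 4 : ℝ) * Complex.I) ?_)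
    rw [Complex.im_ofReal_mul, Complex.I_im, mul_one]
  set z : ℂ := Y * Complex.I with hz
  have hzim : z.im = Y := by simp [hz]
  have hznorm : ‖z‖ = Y := by simp [hz, abs_of_pos (by linarith : 0 < Y)]
  obtain ⟨e₁, he₁, hmin⟩ := S.exists_min_image (fun e => e 0 + 4 * e 1 + 6 * e 2) hS
  set a₀ := e₁ 0 + 4 * e₁ 1 + 6 * e₁ 2 with ha₀
  have ha₀K : a₀ ≤ K := by have := hK e₁ he₁; lia
  set S₁ := S.filter fun e => e 0 + 4 * e 1 + 6 * e 2 = a₀ with hS₁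
  have hS₁ne : S₁.Nonempty := ⟨e₁, Finset.mem_filter.mpr ⟨he₁, rfl⟩⟩
  have hstep : ∀ n : ℕ, n ≤ K → ‖∑ e ∈ S₁, a e * anomaly ^ e 0 *
      (eisVal 1 (-(z + n))⁻¹ ^ e 1 * eisVal 2 (-(z + n))⁻¹ ^ e 2)‖ ≤ G ^ (3 * K + 1) * ε := by
    intro n hn
    set w := (-(z + n))⁻¹ with hw
    have hznim : (z + n).im = Y := by simp [hzim]
    have hzn1 : Y ≤ ‖z + n‖ := by
      have := Complex.abs_im_le_norm (z + n)
      rw [hznim] at this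
      exact (le_abs_self _).trans this
    have hzn2 : ‖z + n‖ ≤ Y + K := norm_add_natCast_le hznorm.le hn
    have hwnorm : ‖w‖ ≤ 1 := by
      rw [hw, norm_inv, norm_neg]
      exact inv_le_one_of_one_le₀ (hY.trans hzn1)
    have hwim : 1 / G ^ 2 ≤ w.im := by
      rw [hw, im_neg_inv, hznim]
      refine div_le_div₀ (by linarith) hY (pow_pos (by linarith) 2) ?_
      gcongr
      linarith
    have hwim0 : 0 < w.im := lt_of_lt_of_le (by positivity) hwim
    have hwn : ∀ k : ℕ, w.im ≤ ‖w + k‖ := fun k => by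
      have := Complex.abs_im_le_norm (w + k)
      simp only [Complex.add_im, Complex.natCast_im, add_zero] at this
      exact (le_abs_self _).trans this
    have h := norm_sum_filter_le_of_neg_inv S a (fun e => e 0) (fun e => e 1) (fun e => e 2) hK
      ha₀K hmin hwim0 (B := G ^ 2) (ε := ε) (one_le_pow₀ hG1) (fun k _ => by
        calc (1 : ℝ) = G ^ 2 * (1 / G ^ 2) := by field_simp
          _ ≤ G ^ 2 * ‖w + k‖ := by
            gcongr
            exact hwim.trans (hwn k)) (fun k hk => hε _ (by
        have h0 : 0 < ‖w + k‖ := hwim0.trans_le (hwn k)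
        rw [im_neg_inv, Complex.add_im, Complex.natCast_im, add_zero]
        calc 1 / G ^ 4 = 1 / G ^ 2 / G ^ 2 := by field_simp
          _ ≤ w.im / ‖w + k‖ ^ 2 := by
            refine div_le_div₀ hwim0.le hwim (by positivity) ?_
            gcongr
            exact (norm_add_natCast_le hwnorm hk).trans (by linarith)))
    refine h.trans ?_
    calc (K + 1) * (‖w‖ + K) ^ K * ((G ^ 2) ^ K * ε) ≤ G * G ^ K * ((G ^ 2) ^ K * ε) := by
          gcongr <;> linarith
      _ = G ^ (3 * K + 1) * ε := by ring
  obtain ⟨e₂, he₂, hmin₂⟩ := S₁.exists_min_image (fun e => 4 * e 1 + 6 * e 2) hS₁ne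
  set w₀ := 4 * e₂ 1 + 6 * e₂ 2 with hw₀
  have hmem : ∀ e ∈ S₁, e ∈ S ∧ e 0 + 4 * e 1 + 6 * e 2 = a₀ := fun e he => Finset.mem_filter.mp he
  have h := norm_sum_filter_le_of_neg_inv S₁ (fun e => a e * anomaly ^ e 0) (fun _ => 0)
    (fun e => e 1) (fun e => e 2) (K := K) (a₀ := w₀) (fun e he => by
      have := hK e (hmem e he).1
      lia) (by
      have := (hmem e₂ he₂).2
      lia) (fun e he => by simpa using hmin₂ e he) (w := z) (by rw [hzim]; linarith) (B := 1)
      (ε := G ^ (3 * K + 1) * ε) le_rfl (fun n _ => by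
        have := Complex.abs_im_le_norm (z + n)
        simp only [Complex.add_im, Complex.natCast_im, add_zero, hzim] at this
        rw [one_mul]
        exact hY.trans ((le_abs_self _).trans this)) (fun n hn => by simpa using hstep n hn)
  simp only [zero_add, pow_zero, mul_one, one_pow, one_mul] at h
  refine ⟨S₁.filter fun e => 4 * e 1 + 6 * e 2 = w₀, (Finset.filter_subset _ _).trans
    (Finset.filter_subset _ _), ⟨e₂, Finset.mem_filter.mpr ⟨he₂, rfl⟩⟩, a₀ - w₀, w₀, ?_, ?_, ?_⟩
  · intro e he
    obtain ⟨h1, h2⟩ := Finset.mem_filter.mp he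
    have := (hmem e h1).2
    lia
  · exact fun e he => (Finset.mem_filter.mp he).2
  · have hfac : ∑ e ∈ S₁ with 4 * e 1 + 6 * e 2 = w₀, a e * anomaly ^ e 0 *
        (eisVal 1 z ^ e 1 * eisVal 2 z ^ e 2) = anomaly ^ (a₀ - w₀) *
        ∑ e ∈ S₁ with 4 * e 1 + 6 * e 2 = w₀, a e * (eisVal 1 z ^ e 1 * eisVal 2 z ^ e 2) := by
      rw [Finset.mul_sum]
      refine Finset.sum_congr rfl fun e he => ?_
      obtain ⟨h1, h2⟩ := Finset.mem_filter.mp he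
      have h3 : e 0 = a₀ - w₀ := by
        have := (hmem e h1).2
        lia
      rw [h3]; ring
    rw [hfac, norm_mul, norm_pow] at h
    refine (le_mul_of_one_le_left (norm_nonneg _) (one_le_pow₀ one_le_norm_anomaly)).trans
      (h.trans ?_)
    rw [hznorm]
    calc (K + 1) * (Y + K) ^ K * (G ^ (3 * K + 1) * ε) ≤ G * G ^ K * (G ^ (3 * K + 1) * ε) := by
          gcongr <;> linarith
      _ = G ^ (4 * K + 2) * ε := by ring

end Descent

section LowerBound

open PowerSeries

lemma qNorm_mul_pow_le_qNorm_X_pow_mul {M : ℕ} {g : ℤ⟦X⟧} (h : QSummable (X ^ M * g)) {r : ℝ}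
    (hr : 0 ≤ r) (hr1 : r < 1) : qNorm g r * r ^ M ≤ qNorm (X ^ M * g) r := by
  have h1 := tsum_comp_le_tsum_of_inj (h r hr hr1) (fun n => by positivity)
    (add_left_injective M)
  rw [qNorm, qNorm, ← tsum_mul_right]
  refine le_trans (le_of_eq (tsum_congr fun n => ?_)) h1
  simp only [Function.comp_apply]
  rw [coeff_X_pow_mul, pow_add, mul_assoc]

lemma half_pow_le_norm_qEval {f : ℤ⟦X⟧} (hf : QSummable f) {M : ℕ} (hM : ∀ n < M, coeff n f = 0)
    (hM0 : coeff M f ≠ 0) {q : ℂ} (hq : 8 * ‖q‖ * (2 ^ M * qNorm f (1 / 2)) ≤ 1) :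
    ‖q‖ ^ M / 2 ≤ ‖qEval f q‖ := by
  obtain ⟨g, rfl⟩ := X_pow_dvd_iff.mpr hM
  have hg := hf.of_X_pow_mul
  set c := coeff 0 g with hc
  have h5 : coeff M (X ^ M * g) = c := by
    have := coeff_X_pow_mul g M 0
    simpa [hc] using this
  rw [h5] at hM0
  have hc1 : (1 : ℝ) ≤ |(c : ℝ)| := by exact_mod_cast Int.one_le_abs hM0
  have hgn := qNorm_mul_pow_le_qNorm_X_pow_mul hf (r := 1 / 2) (by norm_num) (by norm_num)
  have hgn' : qNorm g (1 / 2) ≤ 2 ^ M * qNorm (X ^ M * g) (1 / 2) := by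
    have := mul_le_mul_of_nonneg_left hgn (by positivity : (0 : ℝ) ≤ 2 ^ M)
    rwa [mul_left_comm, ← mul_pow, mul_one_div_cancel two_ne_zero, one_pow, mul_one] at this
  have hcn := abs_coeff_mul_pow_le_qNorm hg (r := 1 / 2) (by norm_num) (by norm_num) 0
  rw [pow_zero, mul_one, ← hc] at hcn
  have hq8 : 8 * ‖q‖ * qNorm g (1 / 2) ≤ 1 :=
    (mul_le_mul_of_nonneg_left hgn' (by positivity)).trans hq
  have hq1 : ‖q‖ ≤ 1 / 8 := by
    have : 8 * ‖q‖ * 1 ≤ 8 * ‖q‖ * qNorm g (1 / 2) := by gcongr; linarith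
    linarith
  set δ := g + C (-c) with hδ
  have hδs : QSummable δ := hg.add (qSummable_C _)
  have hδn := qNorm_add_le hg (qSummable_C (-c)) (r := 1 / 2) (by norm_num) (by norm_num)
  rw [qNorm_C, Int.cast_neg, abs_neg, ← hδ] at hδn
  have hδ0 : ∀ n < 1, coeff n δ = 0 := by
    intro n hn
    obtain rfl : n = 0 := by lia
    rw [hδ, map_add, ← hc]
    simp
  have hδq := norm_qEval_le_of_coeff_eq_zero hδs hδ0 (q := q) (r := 1 / 2) (by linarith)
    (by norm_num) (by norm_num)
  have hsplit : qEval δ q = qEval g q - c := by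
    rw [hδ, qEval_add hg (qSummable_C _) (by linarith), qEval_C]
    push_cast; ring
  rw [qEval_X_pow_mul g hg (by linarith), norm_mul, norm_pow]
  have hhalf : 1 / 2 ≤ ‖qEval g q‖ := by
    have h1 : ‖qEval δ q‖ ≤ 1 / 2 := by
      refine hδq.trans ?_
      have : (‖q‖ / (1 / 2)) ^ 1 * qNorm δ (1 / 2) ≤ 2 * ‖q‖ * (2 * qNorm g (1 / 2)) := by
        rw [pow_one, div_div_eq_mul_div, div_one, mul_comm ‖q‖ 2]
        gcongr
        linarith
      linarith
    have h2 : ‖(c : ℂ)‖ ≤ ‖qEval g q‖ + ‖qEval δ q‖ := by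
      rw [hsplit]
      calc ‖(c : ℂ)‖ = ‖qEval g q - (qEval g q - c)‖ := by congr 1; ring
        _ ≤ _ := norm_sub_le _ _
    rw [Complex.norm_intCast] at h2
    linarith
  rw [div_eq_mul_one_div]
  gcongr

lemma aeval_eq_sum {R : Type*} [CommRing R] (v : Fin 3 → R) (A : MvPolynomial (Fin 3) ℤ) :
    MvPolynomial.aeval v A =
      ∑ e ∈ A.support, ((A.coeff e : ℤ) : R) * (v 0 ^ e 0 * v 1 ^ e 1 * v 2 ^ e 2) := by
  rw [MvPolynomial.aeval_def, MvPolynomial.eval₂_eq']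
  refine Finset.sum_congr rfl fun e _ => ?_
  simp [Fin.prod_univ_three]

lemma one_le_radius_bound {g : ℝ} (hg : 1 ≤ g) : 1 ≤ 362880 * g ^ 7 := by
  have := one_le_pow₀ hg (n := 7)
  linarith

lemma norm_aeval_eisVal_le {A : MvPolynomial (Fin 3) ℤ} {D M : ℕ} (hD : A.totalDegree ≤ D)
    (hM : ∀ n < M, coeff n (MvPolynomial.aeval eis A) = 0) {g : ℝ} (hg : 1 ≤ g) {u : ℂ}
    (hu : 1 / g ≤ u.im) :
    ‖MvPolynomial.aeval (fun j => eisVal j u) A‖ ≤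
      Real.exp (-(M / g)) * (mvLength A * (362880 * (2 * g) ^ 7) ^ D) := by
  have hg0 : 0 < g := by linarith
  have hy0 : 0 < 1 / g := by positivity
  have hy1 : 1 / g ≤ 1 := by rw [div_le_one hg0]; exact hg
  have hu0 : 0 < u.im := hy0.trans_le hu
  have hr : 1 / (2 * g) = (1 / g) / 2 := by field_simp
  have hexp : Real.exp (-(1 / g)) ≤ 1 - 1 / (2 * g) := by
    rw [hr, Real.exp_neg]
    have h1 := Real.add_one_le_exp (1 / g)
    rw [inv_le_comm₀ (Real.exp_pos _) (by linarith)]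
    refine le_trans ?_ h1
    rw [inv_le_iff_one_le_mul₀ (by linarith)]
    nlinarith
  have hr0 : 0 < 1 - 1 / (2 * g) := (Real.exp_pos _).trans_le hexp
  have hr1 : 1 - 1 / (2 * g) < 1 := by
    have : 0 < 1 / (2 * g) := by positivity
    linarith
  have hq : ‖nome u‖ ≤ Real.exp (-(1 / g)) * Real.exp (-(1 / g)) := by
    rw [norm_nome, ← Real.exp_add, Real.exp_le_exp]
    have := Real.pi_gt_three
    nlinarith
  have hqr : ‖nome u‖ / (1 - 1 / (2 * g)) ≤ Real.exp (-(1 / g)) := by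
    rw [div_le_iff₀ hr0]
    exact hq.trans (by gcongr)
  have h := norm_qEval_le_of_coeff_eq_zero (qSummable_aeval qSummable_eis A) hM (q := nome u)
    (r := 1 - 1 / (2 * g)) (hq.trans ((mul_le_of_le_one_left (Real.exp_pos _).le (by
      rw [Real.exp_le_one_iff]; linarith)).trans hexp)) hr0 hr1
  have h2 := qNorm_aeval_le qSummable_eis (r := 1 - 1 / (2 * g)) hr0.le hr1
    (one_le_radius_bound (by linarith : 1 ≤ 2 * g))
    (fun j => qNorm_eis_radius_le j (by linarith)) hD
  rw [qEval_aeval qSummable_eis A (norm_nome_lt_one hu0)] at h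
  refine h.trans (mul_le_mul ?_ h2 (qNorm_nonneg _ hr0.le) (Real.exp_pos _).le)
  calc (‖nome u‖ / (1 - 1 / (2 * g))) ^ M ≤ Real.exp (-(1 / g)) ^ M := by gcongr
    _ = Real.exp (-(M / g)) := by
      rw [← Real.exp_nat_mul]; congr 1; ring

end LowerBound

section OrderAtInfinity

open MvPolynomial

lemma aeval_monomial_erase {R : Type*} [CommRing R] [Algebra ℤ R] (v : Fin 3 → R) (e : Fin 3 →₀ ℕ)
    (a : ℤ) : aeval v (monomial (e.erase 0) a) = (a : R) * (v 1 ^ e 1 * v 2 ^ e 2) := by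
  rw [aeval_monomial, Finsupp.prod_fintype _ _ (by simp)]
  simp [Fin.prod_univ_three, Finsupp.erase_ne]

lemma totalDegree_monomial_erase_le (e : Fin 3 →₀ ℕ) (a : ℤ) :
    (monomial (e.erase 0) a).totalDegree ≤ e 1 + e 2 := by
  refine (totalDegree_monomial_le _ _).trans ?_
  rw [Finsupp.sum_fintype _ _ (by simp)]
  simp [Fin.sum_univ_three, Finsupp.erase_ne]

lemma le_mul_exp_of_nat {c a : ℝ} {D : ℕ} (hc : 0 ≤ c) (h : c ≤ Real.exp a) :
    c ^ D ≤ Real.exp (D * a) := by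
  rw [Real.exp_nat_mul]
  gcongr

lemma pow_le_exp_natCast (n : ℕ) : (2.7182818283 : ℝ) ^ n ≤ Real.exp n := by
  have h := Real.exp_one_gt_d9.le
  have : Real.exp n = Real.exp 1 ^ n := by rw [← Real.exp_nat_mul, mul_one]
  rw [this]
  gcongr

lemma exp_one_pow_bounds : (92897280 : ℝ) ≤ Real.exp 19 ∧ (46448640 : ℝ) ≤ Real.exp 18 ∧
    (8 : ℝ) ≤ Real.exp 3 := by
  have h1 := pow_le_exp_natCast
  refine ⟨le_trans (by norm_num) (h1 19), le_trans (by norm_num) (h1 18),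
    le_trans (by norm_num) (h1 3)⟩

lemma zero_estimate_arith {h d Y G m : ℝ} (hh : 0 ≤ h) (hd : 0 ≤ d) (hY : Y = h + 19 * d + 3)
    (hG : G = Y + 6 * d + 1)
    (H : -(7 * Y * d) - 1 ≤ (24 * d + 2) * G + (-(m / G ^ 4) + (h + d * (18 + 28 * G)))) :
    m ≤ 15 * (h + 25 * d + 4) ^ 6 := by
  have hG' : G = h + 25 * d + 4 := by linarith
  rw [← hG']
  have hG4 : 4 ≤ G := by linarith
  have h1 : m / G ^ 4 ≤ 15 * G ^ 2 := by
    have e1 : Y * d ≤ G * G := mul_le_mul (by linarith) (by linarith) hd (by linarith)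
    have e2 : 25 * d * G ≤ G * G := by gcongr; linarith
    have e3 : 4 * G ≤ G * G := by gcongr
    nlinarith
  rw [div_le_iff₀ (by positivity)] at h1
  calc m ≤ 15 * G ^ 2 * G ^ 4 := h1
    _ = 15 * G ^ 6 := by ring

/-- A nonzero polynomial of bounded size in the Eisenstein series has bounded order at infinity. -/
theorem zero_estimate {A : MvPolynomial (Fin 3) ℤ} (hA : A ≠ 0) {D M : ℕ}
    (hD : A.totalDegree ≤ D) {h : ℝ} (hh : 0 ≤ h) (hL : mvLength A ≤ Real.exp h)
    (hM : ∀ n < M, PowerSeries.coeff n (aeval eis A) = 0) :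
    (M : ℝ) ≤ 15 * (h + 25 * D + 4) ^ 6 := by
  classical
  obtain ⟨hexp19, hexp18, hexp3⟩ := exp_one_pow_bounds
  have hD0 : (0 : ℝ) ≤ D := Nat.cast_nonneg D
  set Y : ℝ := h + 19 * D + 3 with hY
  set G : ℝ := Y + 6 * D + 1 with hG
  have hY1 : 1 ≤ Y := by linarith
  have hG1 : 1 ≤ G := by linarith
  have hGe : G ≤ Real.exp G := by linarith [Real.add_one_le_exp G]
  set ε : ℝ := Real.exp (-(M / G ^ 4)) * (Real.exp h * (362880 * (2 * G ^ 4) ^ 7) ^ D) with hε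
  have hdeg : ∀ e ∈ A.support, e 0 + e 1 + e 2 ≤ D := fun e he => mvDegree_le hD he
  obtain ⟨S', hS'A, hS'ne, s, w, hs, hw, hbound⟩ := exists_isobaric_norm_le
    (S := A.support) (support_nonempty.mpr hA) (fun e => ((A.coeff e : ℤ) : ℂ)) (K := 6 * D)
    (fun e he => by have := hdeg e he; lia) (Y := Y) (ε := ε) (G := G) hY1
    (by rw [hG]; push_cast; ring) (fun u hu => by
      have := norm_aeval_eisVal_le hD hM (one_le_pow₀ hG1 (n := 4)) hu
      rw [aeval_eq_sum] at this
      refine this.trans ?_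
      rw [hε]
      gcongr)
  set A' : MvPolynomial (Fin 3) ℤ := ∑ e ∈ S', monomial (e.erase 0) (A.coeff e) with hA'
  have hA'D : A'.totalDegree ≤ D := by
    refine totalDegree_finsetSum_le fun e he => (totalDegree_monomial_erase_le _ _).trans ?_
    have := hdeg e (hS'A he)
    lia
  have hA'L : mvLength A' ≤ Real.exp h := by
    refine (mvLength_sum_le _ _).trans (le_trans ?_ hL)
    refine (Finset.sum_le_sum fun e _ => mvLength_monomial _ _).trans ?_
    exact Finset.sum_le_sum_of_subset_of_nonneg hS'A fun _ _ _ => abs_nonneg _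
  have hA'v : ∀ {R : Type} [CommRing R] [Algebra ℤ R] (v : Fin 3 → R),
      aeval v A' = ∑ e ∈ S', ((A.coeff e : ℤ) : R) * (v 1 ^ e 1 * v 2 ^ e 2) := fun v => by
    rw [hA', map_sum]
    exact Finset.sum_congr rfl fun e _ => aeval_monomial_erase v e _
  obtain ⟨n₁, hn₁D, hn₁⟩ := exists_coeff_ne_zero_of_isobaric hS'ne (a := fun e => A.coeff e)
    (fun e he => mem_support_iff.mp (hS'A he)) hs hw (D := D)
    (fun e he => by have := hdeg e (hS'A he); lia)
  have hA'eis : aeval eis A' = ∑ e ∈ S', PowerSeries.C (A.coeff e) *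
      (eis 1 ^ e 1 * eis 2 ^ e 2) := by
    rw [hA'v]; simp
  rw [← hA'eis] at hn₁
  obtain ⟨n₀, hn₀D, hqN, hqlt⟩ : ∃ n₀ ≤ D, PowerSeries.coeff n₀ (aeval eis A') ≠ 0 ∧
      ∀ n < n₀, PowerSeries.coeff n (aeval eis A') = 0 := by
    have hex : ∃ n, PowerSeries.coeff n (aeval eis A') ≠ 0 := ⟨n₁, hn₁⟩
    exact ⟨Nat.find hex, (Nat.find_min' hex hn₁).trans hn₁D, Nat.find_spec hex,
      fun n hn => not_not.mp (Nat.find_min hex hn)⟩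
  set z : ℂ := Y * Complex.I with hz
  have hzim : z.im = Y := by simp [hz]
  have hq : ‖nome z‖ = Real.exp (-(2 * Real.pi * Y)) := by rw [norm_nome, hzim]
  have hqY : ‖nome z‖ ≤ Real.exp (-Y) := by
    rw [hq, Real.exp_le_exp]
    have := Real.pi_gt_three
    nlinarith
  have hnorm := qNorm_aeval_le qSummable_eis (r := 1 - 1 / 2) (by norm_num) (by norm_num)
    (one_le_radius_bound (one_le_two)) (fun j => qNorm_eis_radius_le j one_le_two) hA'D
  rw [show (1 : ℝ) - 1 / 2 = 1 / 2 by norm_num] at hnorm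
  have hsmall : 8 * ‖nome z‖ * (2 ^ n₀ * qNorm (aeval eis A') (1 / 2)) ≤ 1 := by
    have h92 : (92897280 : ℝ) ^ D ≤ Real.exp (D * 19) := le_mul_exp_of_nat (by norm_num) hexp19
    calc 8 * ‖nome z‖ * (2 ^ n₀ * qNorm (aeval eis A') (1 / 2))
        ≤ Real.exp 3 * Real.exp (-Y) *
          (2 ^ D * (Real.exp h * (362880 * 2 ^ 7) ^ D)) := by
          have : qNorm (aeval eis A') (1 / 2) ≤ Real.exp h * (362880 * 2 ^ 7) ^ D :=
            hnorm.trans (by gcongr)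
          have h0 := qNorm_nonneg (aeval eis A') (r := 1 / 2) (by norm_num)
          gcongr
          norm_num
      _ = Real.exp 3 * Real.exp (-Y) * (Real.exp h * 92897280 ^ D) := by
          rw [mul_left_comm (2 ^ D), ← mul_pow]; norm_num
      _ ≤ Real.exp 3 * Real.exp (-Y) * (Real.exp h * Real.exp (D * 19)) := by gcongr
      _ = 1 := by
          rw [← Real.exp_add, ← Real.exp_add, ← Real.exp_add, Real.exp_eq_one_iff, hY]; ring
  have hlow := half_pow_le_norm_qEval (qSummable_aeval qSummable_eis A')
    hqlt hqN hsmall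
  rw [qEval_aeval qSummable_eis A' (norm_nome_lt_one (by rw [hzim]; linarith)), hA'v] at hlow
  have hlow' := hlow.trans hbound
  have hleft : Real.exp (-(7 * Y * D) - 1) ≤ ‖nome z‖ ^ n₀ / 2 := by
    have h2 : Real.exp (-1) ≤ 1 / 2 := by
      rw [Real.exp_neg, one_div]
      exact inv_anti₀ two_pos (by linarith [Real.add_one_le_exp (1 : ℝ)])
    rw [sub_eq_add_neg, Real.exp_add, div_eq_mul_one_div]
    refine mul_le_mul ?_ h2 (Real.exp_pos _).le (by positivity)
    rw [hq, ← Real.exp_nat_mul, Real.exp_le_exp]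
    have h3 : (n₀ : ℝ) ≤ D := by exact_mod_cast hn₀D
    have h4 := Real.pi_lt_d2
    have h5 : 2 * Real.pi * Y * n₀ ≤ 7 * Y * D := by
      gcongr
      linarith
    linarith
  have hright : G ^ (4 * (6 * D) + 2) * ε ≤
      Real.exp ((24 * D + 2) * G + (-(M / G ^ 4) + (h + D * (18 + 28 * G)))) := by
    have hg1 : G ^ (4 * (6 * D) + 2) ≤ Real.exp ((24 * D + 2) * G) := by
      refine (le_mul_exp_of_nat (by linarith) hGe).trans (le_of_eq ?_)
      congr 1; push_cast; ring
    have hg2 : (362880 * (2 * G ^ 4) ^ 7) ^ D ≤ Real.exp (D * (18 + 28 * G)) := by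
      refine le_mul_exp_of_nat (by positivity) ?_
      have hg3 : G ^ 28 ≤ Real.exp (28 * G) := by
        refine (le_mul_exp_of_nat (by linarith) hGe).trans (le_of_eq ?_)
        norm_num
      calc 362880 * (2 * G ^ 4) ^ 7 = 46448640 * G ^ 28 := by ring
        _ ≤ Real.exp 18 * Real.exp (28 * G) := by gcongr
        _ = _ := by rw [← Real.exp_add]
    rw [hε, Real.exp_add, Real.exp_add, Real.exp_add]
    gcongr
  have hfin := (hleft.trans hlow').trans hright
  rw [Real.exp_le_exp] at hfin
  exact zero_estimate_arith hh hD0 hY hG hfin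

end OrderAtInfinity

section Construction

open MvPolynomial

lemma natCast_pow_le_exp (n m : ℕ) : (n : ℝ) ^ m ≤ Real.exp (m * n) :=
  le_mul_exp_of_nat (Nat.cast_nonneg n) (by linarith [Real.add_one_le_exp (n : ℝ)])

lemma exp_nat_bounds : (2 : ℝ) ≤ Real.exp 1 ∧ (362880 : ℝ) ≤ Real.exp 13 ∧
    (30 * 1223 ^ 6 : ℝ) ≤ Real.exp 47 := by
  have h1 := pow_le_exp_natCast
  refine ⟨le_trans (by norm_num) ((h1 1).trans_eq (by norm_num)), le_trans (by norm_num) (h1 13),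
    le_trans (by norm_num) (h1 47)⟩

lemma exists_exact_auxiliary_polynomial {n : ℕ} (hn : 2 ≤ n) :
    ∃ (A : MvPolynomial (Fin 3) ℤ) (M : ℕ), A.totalDegree ≤ 3 * n ^ 16 ∧
      mvLength A ≤ Real.exp (1144 * (n : ℝ) ^ 17) ∧
      (∀ m < M, PowerSeries.coeff m (aeval eis A) = 0) ∧
      PowerSeries.coeff M (aeval eis A) ≠ 0 ∧ (n : ℝ) ^ 48 ≤ 4 * M ∧
      2 * (M : ℝ) ≤ Real.exp (149 * n) := by
  obtain ⟨h2, h13, h47⟩ := exp_nat_bounds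
  have hn2 : (2 : ℝ) ≤ n := by exact_mod_cast hn
  have hn1 : (1 : ℝ) ≤ n := by linarith
  have h4 : 4 ≤ (n ^ 16) ^ 3 := by
    calc 4 ≤ 2 ^ 48 := by norm_num
      _ ≤ n ^ 48 := Nat.pow_le_pow_left hn 48
      _ = (n ^ 16) ^ 3 := by ring
  obtain ⟨A, hA, hD, hL, hvan⟩ := exists_auxiliary_polynomial (N := n ^ 16)
    (M := (n ^ 16) ^ 3 / 2) (by lia) (by lia)
  have hL' : mvLength A ≤ Real.exp (1144 * (n : ℝ) ^ 17) := by
    refine hL.trans ?_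
    push_cast
    have e1 : 2 * ((n : ℝ) ^ 16) ^ 6 ≤ Real.exp (1 + 96 * n) := by
      rw [Real.exp_add, ← pow_mul]
      have := natCast_pow_le_exp n 96
      norm_num at this ⊢
      gcongr
    have e2 : (362880 * (((n : ℝ) ^ 16) ^ 3) ^ 7) ^ (3 * n ^ 16) ≤
        Real.exp (((3 * n ^ 16 : ℕ) : ℝ) * (13 + 336 * n)) := by
      refine le_mul_exp_of_nat (by positivity) ?_
      rw [Real.exp_add, ← pow_mul, ← pow_mul]
      have := natCast_pow_le_exp n 336
      norm_num at this ⊢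
      gcongr
    refine (mul_le_mul e1 e2 (by positivity) (by positivity)).trans ?_
    rw [← Real.exp_add, Real.exp_le_exp]
    push_cast
    have e3 : (1 : ℝ) ≤ (n : ℝ) ^ 16 := one_le_pow₀ hn1
    have e4 : (n : ℝ) ^ 17 = n ^ 16 * n := by ring
    rw [e4]
    nlinarith
  have hn17 : (1 : ℝ) ≤ (n : ℝ) ^ 17 := one_le_pow₀ hn1
  have hbound : ∀ M : ℕ, (∀ m < M, PowerSeries.coeff m (aeval eis A) = 0) →
      (M : ℝ) ≤ 15 * (1223 * (n : ℝ) ^ 17) ^ 6 := by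
    intro M hM
    refine (zero_estimate hA hD (by positivity) hL' hM).trans ?_
    gcongr
    push_cast
    have : (n : ℝ) ^ 16 ≤ (n : ℝ) ^ 17 := pow_le_pow_right₀ hn1 (by norm_num)
    linarith
  have hex : ∃ m, PowerSeries.coeff m (aeval eis A) ≠ 0 := by
    by_contra! hall
    obtain ⟨M, hM⟩ := exists_nat_gt (15 * (1223 * (n : ℝ) ^ 17) ^ 6)
    exact absurd (hbound M fun m _ => hall m) (not_le.mpr hM)
  have hlt : ∀ m < Nat.find hex, PowerSeries.coeff m (aeval eis A) = 0 :=
    fun m hm => not_not.mp (Nat.find_min hex hm)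
  refine ⟨A, Nat.find hex, hD, hL', hlt, Nat.find_spec hex, ?_, ?_⟩
  · have h5 : (n ^ 16) ^ 3 / 2 ≤ Nat.find hex := by
      by_contra! h
      exact Nat.find_spec hex (hvan _ h)
    have h6 : (n ^ 16) ^ 3 ≤ 4 * Nat.find hex := by lia
    rw [← pow_mul] at h6
    exact_mod_cast h6
  · calc 2 * (Nat.find hex : ℝ) ≤ 2 * (15 * (1223 * (n : ℝ) ^ 17) ^ 6) := by
          gcongr
          exact hbound _ hlt
      _ = 30 * 1223 ^ 6 * (n : ℝ) ^ 102 := by ring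
      _ ≤ Real.exp 47 * Real.exp ((102 : ℕ) * n) := by
          gcongr
          exact natCast_pow_le_exp n 102
      _ ≤ Real.exp (149 * n) := by
          rw [← Real.exp_add, Real.exp_le_exp]
          push_cast
          linarith

lemma qSummable_iterate_qTheta {f : PowerSeries ℤ} (hf : QSummable f) (t : ℕ) :
    QSummable (qTheta^[t] f) := by
  induction t with
  | zero => exact hf
  | succ t ih => rw [Function.iterate_succ_apply']; exact ih.qTheta

lemma coeff_iterate_qTheta (f : PowerSeries ℤ) (t m : ℕ) :
    PowerSeries.coeff m (qTheta^[t] f) = (m : ℤ) ^ t * PowerSeries.coeff m f := by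
  induction t with
  | zero => simp
  | succ t ih => rw [Function.iterate_succ_apply', coeff_qTheta, ih]; ring

lemma aeval_iterate_ramanujanDeriv_ne_zero {A : MvPolynomial (Fin 3) ℤ} {t : ℕ} {q : ℂ}
    (hq : ‖q‖ < 1) (h : qEval (qTheta^[t] (aeval eis A)) q ≠ 0) :
    aeval (fun j => qEval (eis j) q) (ramanujanDeriv^[t] A) ≠ 0 := by
  have h1 : aeval eis (ramanujanDeriv^[t] A) =
      PowerSeries.C (12 ^ t : ℤ) * qTheta^[t] (aeval eis A) := by
    ext m
    rw [coeff_aeval_iterate_ramanujanDeriv, PowerSeries.coeff_C_mul, coeff_iterate_qTheta]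
    ring
  rw [← qEval_aeval qSummable_eis _ hq, h1, qEval_mul (qSummable_C _)
    (qSummable_iterate_qTheta (qSummable_aeval qSummable_eis A) t) hq, qEval_C]
  push_cast
  exact mul_ne_zero (pow_ne_zero _ (by norm_num)) h

lemma exists_iterate_qTheta_ne_zero {q : ℂ} (hq0 : q ≠ 0) {ρ b : ℝ} (hqρ : ‖q‖ < ρ) (hρ1 : ρ < 1)
    (hb : ‖q‖ / ρ ≤ Real.exp (-b)) {k n : ℕ} (hn : 2 ≤ n) (hk : 4313 < b * k)
    (hnρ : 1 ≤ (1 - ρ) * n) {A : MvPolynomial (Fin 3) ℤ} {M : ℕ}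
    (hD : A.totalDegree ≤ 3 * n ^ 16) (hL : mvLength A ≤ Real.exp (1144 * (n : ℝ) ^ 17))
    (hlt : ∀ m < M, PowerSeries.coeff m (aeval eis A) = 0)
    (hM : PowerSeries.coeff M (aeval eis A) ≠ 0) (hnM : (n : ℝ) ^ 48 ≤ 4 * M)
    (hMn : 2 * (M : ℝ) ≤ Real.exp (149 * n)) :
    ∃ t < k * n ^ 17, qEval (qTheta^[t] (aeval eis A)) q ≠ 0 := by
  by_contra! hall
  obtain ⟨h2, h13, h47⟩ := exp_nat_bounds
  have hn2 : (2 : ℝ) ≤ n := by exact_mod_cast hn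
  have hρ0 : 0 < ρ := (norm_nonneg q).trans_lt hqρ
  have hn48 : 2 * (n : ℝ) ≤ (n : ℝ) ^ 48 := by
    calc 2 * (n : ℝ) ≤ n * n := by gcongr
      _ = (n : ℝ) ^ 2 := by ring
      _ ≤ (n : ℝ) ^ 48 := pow_le_pow_right₀ (by linarith) (by norm_num)
  have hnM' : (n : ℝ) ≤ 2 * M := by linarith
  have hM1 : 1 ≤ M := by
    have : (1 : ℝ) ≤ M := by linarith
    exact_mod_cast this
  have hr : ρ ≤ 1 - 1 / (2 * M) := by
    have h1 : 1 / (2 * (M : ℝ)) ≤ 1 - ρ := by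
      rw [div_le_iff₀ (by linarith)]
      exact hnρ.trans (by gcongr)
    linarith
  have hr1 : 1 - 1 / (2 * (M : ℝ)) < 1 := by
    have : 0 < 1 / (2 * (M : ℝ)) := one_div_pos.mpr (by linarith)
    linarith
  have hr0 : 0 < 1 - 1 / (2 * (M : ℝ)) := hρ0.trans_le hr
  have h := one_le_of_iterate_qTheta_eq_zero (qSummable_aeval qSummable_eis A) hlt hM hq0
    (hqρ.trans_le hr) hr1 hall
  have hhalf := one_half_le_pow hM1 (le_refl (2 * (M : ℝ))) le_rfl
  have hnorm := qNorm_aeval_le qSummable_eis hr0.le hr1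
    (one_le_radius_bound (by linarith : 1 ≤ 2 * (M : ℝ)))
    (fun j => qNorm_eis_radius_le j (by linarith)) hD
  have hS : (362880 * (2 * (M : ℝ)) ^ 7) ^ (3 * n ^ 16) ≤
      Real.exp (((3 * n ^ 16 : ℕ) : ℝ) * (13 + 7 * (149 * n))) := by
    refine le_mul_exp_of_nat (by positivity) ?_
    rw [Real.exp_add]
    gcongr
    exact_mod_cast le_mul_exp_of_nat (D := 7) (by positivity) hMn
  have hn16 : (1 : ℝ) ≤ (n : ℝ) ^ 16 := one_le_pow₀ (by linarith)
  have hn17 : (n : ℝ) ^ 17 = n ^ 16 * n := by ring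
  have hA : qNorm (aeval eis A) (1 - 1 / (2 * M)) / (1 - 1 / (2 * M)) ^ M ≤
      Real.exp (4313 * (n : ℝ) ^ 17) := by
    rw [div_le_iff₀ (by positivity)]
    calc qNorm (aeval eis A) (1 - 1 / (2 * M))
        ≤ Real.exp (1144 * (n : ℝ) ^ 17) *
          Real.exp (((3 * n ^ 16 : ℕ) : ℝ) * (13 + 7 * (149 * n))) :=
          hnorm.trans (by gcongr)
      _ ≤ Real.exp (4313 * (n : ℝ) ^ 17 - 1) := by
          rw [← Real.exp_add, Real.exp_le_exp, hn17]
          push_cast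
          nlinarith
      _ ≤ Real.exp (4313 * (n : ℝ) ^ 17) * (1 / 2) := by
          rw [sub_eq_add_neg, Real.exp_add, Real.exp_neg, one_div]
          gcongr
      _ ≤ _ := by gcongr
  have hT : (‖q‖ / (1 - 1 / (2 * M))) ^ (k * n ^ 17) ≤ Real.exp (-(b * k) * (n : ℝ) ^ 17) := by
    refine (le_mul_exp_of_nat (a := -b) (by positivity) (le_trans (by gcongr) hb)).trans
      (le_of_eq ?_)
    congr 1; push_cast; ring
  have h1 : (1 : ℝ) ≤ Real.exp (-(b * k) * (n : ℝ) ^ 17) * Real.exp (4313 * (n : ℝ) ^ 17) :=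
    h.trans (mul_le_mul hT hA (div_nonneg (qNorm_nonneg _ hr0.le) (by positivity))
      (Real.exp_pos _).le)
  rw [← Real.exp_add, Real.one_le_exp_iff] at h1
  have : 0 < (n : ℝ) ^ 17 := by positivity
  nlinarith

end Construction

section Conclusion

open MvPolynomial

lemma mvLength_iterate_ramanujanDeriv_le_exp {A : MvPolynomial (Fin 3) ℤ} {k n t : ℕ} (hn : 2 ≤ n)
    (hD : A.totalDegree ≤ 3 * n ^ 16) (hL : mvLength A ≤ Real.exp (1144 * (n : ℝ) ^ 17))
    (ht : t ≤ k * n ^ 17) :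
    mvLength (ramanujanDeriv^[t] A) ≤
      Real.exp ((k * (12 * (k + 3) + 17) + 1144) * (n : ℝ) ^ 18) := by
  have hn1 : (1 : ℝ) ≤ n := by
    have : (2 : ℝ) ≤ n := by exact_mod_cast hn
    linarith
  have ht' : (t : ℝ) ≤ k * (n : ℝ) ^ 17 := by exact_mod_cast ht
  refine (mvLength_iterate_ramanujanDeriv_le hD t).trans ?_
  have h1 : 12 * (((3 * n ^ 16 : ℕ) : ℝ) + t) ≤ Real.exp ((12 * (k + 3) + 17) * n) := by
    have e1 : (n : ℝ) ^ 16 ≤ (n : ℝ) ^ 17 := pow_le_pow_right₀ hn1 (by norm_num)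
    have e2 : (12 * ((k : ℝ) + 3)) ≤ Real.exp (12 * (k + 3) * n) := by
      have := Real.add_one_le_exp (12 * ((k : ℝ) + 3) * n)
      have e3 : 12 * ((k : ℝ) + 3) * 1 ≤ 12 * (k + 3) * n := by gcongr
      linarith
    calc 12 * (((3 * n ^ 16 : ℕ) : ℝ) + t) ≤ 12 * ((k : ℝ) + 3) * (n : ℝ) ^ 17 := by
          push_cast
          linarith
      _ ≤ Real.exp (12 * (k + 3) * n) * Real.exp ((17 : ℕ) * n) := by
          gcongr
          exact natCast_pow_le_exp n 17
      _ = _ := by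
          rw [← Real.exp_add]; congr 1; push_cast; ring
  have h2 := le_mul_exp_of_nat (D := t) (by positivity) h1
  refine (mul_le_mul h2 hL (mvLength_nonneg _) (Real.exp_pos _).le).trans ?_
  rw [← Real.exp_add, Real.exp_le_exp]
  have e4 : (n : ℝ) ^ 17 ≤ (n : ℝ) ^ 18 := pow_le_pow_right₀ hn1 (by norm_num)
  have e5 : t * ((12 * ((k : ℝ) + 3) + 17) * n) ≤
      k * (n : ℝ) ^ 17 * ((12 * (k + 3) + 17) * n) := by gcongr
  calc _ ≤ k * (n : ℝ) ^ 17 * ((12 * (k + 3) + 17) * n) + 1144 * (n : ℝ) ^ 18 := by linarith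
    _ = _ := by ring

lemma exists_small_polynomials {q : ℂ} (hq0 : q ≠ 0) (hq : ‖q‖ < 1) :
    ∃ c b : ℝ, 0 < c ∧ 0 < b ∧ ∃ n₁ : ℕ, 2 ≤ n₁ ∧ ∀ n ≥ n₁,
      ∃ (B : MvPolynomial (Fin 3) ℤ) (D : ℕ) (h : ℝ), 0 ≤ h ∧ B.totalDegree ≤ D ∧
        mvLength B ≤ Real.exp h ∧ aeval (fun j => qEval (eis j) q) B ≠ 0 ∧
        D + h + 1 ≤ c * (n : ℝ) ^ 18 ∧
        ‖aeval (fun j => qEval (eis j) q) B‖ ≤ Real.exp (-(b * (n : ℝ) ^ 48) + c * (n : ℝ) ^ 18) := by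
  set ρ := (1 + ‖q‖) / 2 with hρ
  have hq0' : 0 < ‖q‖ := norm_pos_iff.mpr hq0
  have hqρ : ‖q‖ < ρ := by linarith
  have hρ1 : ρ < 1 := by linarith
  have hρ0 : 0 < ρ := by linarith
  set b := -Real.log (‖q‖ / ρ) with hb
  have hβ : ‖q‖ / ρ = Real.exp (-b) := by
    rw [hb, neg_neg, Real.exp_log (by positivity)]
  have hb0 : 0 < b := by
    have : Real.log (‖q‖ / ρ) < 0 := Real.log_neg (by positivity) (by rwa [div_lt_one hρ0])
    linarith
  obtain ⟨k, hk⟩ := exists_nat_gt (4313 / b)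
  have hk' : 4313 < b * k := by rwa [div_lt_iff₀' hb0] at hk
  obtain ⟨n₁, hn₁⟩ := exists_nat_ge (1 / (1 - ρ))
  obtain ⟨σ, hσ⟩ := exists_nat_ge (362880 / (1 - ρ) ^ 7)
  have hσ1 : (362880 / (1 - ρ) ^ 7) ≤ Real.exp σ :=
    hσ.trans (by linarith [Real.add_one_le_exp (σ : ℝ)])
  set c₁ : ℝ := k * (12 * (k + 3) + 17) + 1144 with hc₁
  set c : ℝ := c₁ + (σ + 1) * (k + 3) + 1 with hc
  have hc₁0 : 0 < c₁ := by positivity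
  refine ⟨c, b / 4, by positivity, by positivity, max 2 n₁, le_max_left _ _, fun n hn => ?_⟩
  have hn2 : 2 ≤ n := (le_max_left _ _).trans hn
  have hnn₁ : (n₁ : ℝ) ≤ n := by exact_mod_cast (le_max_right _ _).trans hn
  have hn1 : (1 : ℝ) ≤ n := by
    have : (2 : ℝ) ≤ n := by exact_mod_cast hn2
    linarith
  obtain ⟨A, M, hD, hL, hlt, hM, hnM, hMn⟩ := exists_exact_auxiliary_polynomial hn2
  obtain ⟨t, ht, hne⟩ := exists_iterate_qTheta_ne_zero hq0 hqρ hρ1 hβ.le hn2 hk' (by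
    have := hn₁.trans hnn₁
    rwa [div_le_iff₀' (by linarith)] at this) hD hL hlt hM hnM hMn
  have hlen := mvLength_iterate_ramanujanDeriv_le_exp hn2 hD hL ht.le
  have hdeg := totalDegree_iterate_ramanujanDeriv_le hD t
  have hDt : ((3 * n ^ 16 + t : ℕ) : ℝ) ≤ (k + 3) * (n : ℝ) ^ 18 := by
    have ht' : (t : ℝ) ≤ k * (n : ℝ) ^ 17 := by exact_mod_cast ht.le
    have e1 : (n : ℝ) ^ 16 ≤ (n : ℝ) ^ 18 := pow_le_pow_right₀ hn1 (by norm_num)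
    have e2 : k * (n : ℝ) ^ 17 ≤ k * (n : ℝ) ^ 18 := by
      gcongr
      norm_num
    push_cast
    linarith
  have hn18 : (1 : ℝ) ≤ (n : ℝ) ^ 18 := one_le_pow₀ hn1
  refine ⟨ramanujanDeriv^[t] A, 3 * n ^ 16 + t, c₁ * (n : ℝ) ^ 18, by positivity, hdeg, hlen,
    aeval_iterate_ramanujanDeriv_ne_zero hq hne, ?_, ?_⟩
  · have : 0 ≤ σ * ((k : ℝ) + 3) * (n : ℝ) ^ 18 := by positivity
    rw [hc]
    linarith
  · have hvan : ∀ m < M, PowerSeries.coeff m (aeval eis (ramanujanDeriv^[t] A)) = 0 := by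
      intro m hm
      rw [coeff_aeval_iterate_ramanujanDeriv, hlt m hm, mul_zero]
    have h1 := norm_qEval_le_of_coeff_eq_zero (qSummable_aeval qSummable_eis _) hvan hqρ.le hρ0 hρ1
    rw [qEval_aeval qSummable_eis _ hq] at h1
    have h2 := qNorm_aeval_le qSummable_eis hρ0.le hρ1 (Real.one_le_exp (Nat.cast_nonneg σ))
      (fun j => (qNorm_eis_le j hρ0.le hρ1).trans hσ1) hdeg
    have h3 : Real.exp σ ^ (3 * n ^ 16 + t) ≤ Real.exp (σ * (k + 3) * (n : ℝ) ^ 18) := by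
      rw [← Real.exp_nat_mul, Real.exp_le_exp, mul_comm, mul_assoc]
      gcongr
    have h4 : (‖q‖ / ρ) ^ M ≤ Real.exp (-(b / 4 * (n : ℝ) ^ 48)) := by
      rw [hβ, ← Real.exp_nat_mul, Real.exp_le_exp]
      have := mul_le_mul_of_nonneg_left hnM hb0.le
      linarith
    calc _ ≤ _ := h1
      _ ≤ Real.exp (-(b / 4 * (n : ℝ) ^ 48)) *
          (Real.exp (c₁ * (n : ℝ) ^ 18) * Real.exp (σ * (k + 3) * (n : ℝ) ^ 18)) := by
        refine mul_le_mul h4 (h2.trans ?_) (qNorm_nonneg _ hρ0.le) (Real.exp_pos _).le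
        gcongr
      _ ≤ _ := by
        rw [← Real.exp_add, ← Real.exp_add, Real.exp_le_exp, hc]
        have : 0 ≤ ((k : ℝ) + 3 + 1) * (n : ℝ) ^ 18 := by positivity
        linarith

theorem false_of_isAlgebraic_adjoin {q : ℂ} (hq0 : q ≠ 0) (hq : ‖q‖ < 1) (θ : ℂ)
    (halg : ∀ j, IsAlgebraic (Algebra.adjoin ℤ {θ}) (qEval (eis j) q)) : False := by
  obtain ⟨K, hK1, hK⟩ := norm_reduction θ (fun j => qEval (eis j) q) halg
  obtain ⟨c, b, hc, hb, n₁, hn₁, h⟩ := exists_small_polynomials hq0 hq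
  obtain ⟨n₂, hn₂⟩ := exists_nat_ge (K * c)
  obtain ⟨n₃, hn₃⟩ := exists_nat_ge ((1 + c + K * c) / b)
  have hR : ∀ n : ℕ, ∃ R : Polynomial ℤ, n ≥ max n₁ (max n₂ n₃) →
      polySize R ≤ (n : ℝ) ^ 20 ∧ Polynomial.aeval θ R ≠ 0 ∧
      ‖Polynomial.aeval θ R‖ ≤ Real.exp (-(n : ℝ) ^ 44) := by
    intro n
    by_cases hn : n ≥ max n₁ (max n₂ n₃)
    swap
    · exact ⟨0, fun h => absurd h hn⟩
    have hnn₁ : n₁ ≤ n := (le_max_left _ _).trans hn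
    have hnn₂ : (n₂ : ℝ) ≤ n := by
      exact_mod_cast ((le_max_left _ _).trans (le_max_right _ _)).trans hn
    have hnn₃ : (n₃ : ℝ) ≤ n := by
      exact_mod_cast ((le_max_right _ _).trans (le_max_right _ _)).trans hn
    have hn1 : (1 : ℝ) ≤ n := by exact_mod_cast (by lia : 1 ≤ n)
    obtain ⟨B, D, η, hη, hD, hL, hne, hsize, hsmall⟩ := h n hnn₁
    obtain ⟨R, hR0, hRs, hRv⟩ := hK D η B hη hD hL hne
    have hKn : K * (D + η + 1) ≤ K * c * (n : ℝ) ^ 18 := by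
      rw [mul_assoc]
      gcongr
    refine ⟨R, fun _ => ⟨?_, hR0, ?_⟩⟩
    · calc polySize R ≤ K * c * (n : ℝ) ^ 18 := hRs.trans hKn
        _ ≤ n * (n : ℝ) ^ 18 := by gcongr; exact hn₂.trans hnn₂
        _ = (n : ℝ) ^ 19 := by ring
        _ ≤ (n : ℝ) ^ 20 := pow_le_pow_right₀ hn1 (by norm_num)
    · refine hRv.trans ((mul_le_mul hsmall (Real.exp_le_exp.mpr hKn) (Real.exp_pos _).le
        (Real.exp_pos _).le).trans ?_)
      rw [← Real.exp_add, Real.exp_le_exp]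
      have hbn : 1 + c + K * c ≤ b * n := by
        have := hn₃.trans hnn₃
        rwa [div_le_iff₀' hb] at this
      have e1 : (n : ℝ) ^ 18 ≤ (n : ℝ) ^ 44 := pow_le_pow_right₀ hn1 (by norm_num)
      have e2 : (c + K * c) * (n : ℝ) ^ 18 ≤ (c + K * c) * (n : ℝ) ^ 44 := by gcongr
      have e3 : (1 + c + K * c) * (n : ℝ) ^ 44 ≤ b * (n : ℝ) ^ 48 := by
        calc (1 + c + K * c) * (n : ℝ) ^ 44 ≤ b * n * (n : ℝ) ^ 44 := by gcongr
          _ = b * (n : ℝ) ^ 45 := by ring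
          _ ≤ b * (n : ℝ) ^ 48 := by
            gcongr
            norm_num
      linarith
  choose R hR using hR
  exact gelfond_criterion θ R (max n₁ (max n₂ n₃)) (fun n hn => (hR n hn).1)
    (fun n hn => (hR n hn).2.1) (fun n hn => (hR n hn).2.2)

end Conclusion

end RamanujanTranscendence

/- Here `AlgebraicClosure ℚ` plays the role of the field `Q̄` of algebraic numbers; any
ring homomorphism `ι : AlgebraicClosure ℚ →+* ℂ` identifies it with the algebraic
closure of `ℚ` inside `ℂ`. -/
theorem stmt12 (ι : AlgebraicClosure ℚ →+* ℂ)
    (P Q : MvPolynomial (Fin 3) (AlgebraicClosure ℚ))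
    (hP : P ≠ 0) (hQ : Q ≠ 0)
    (hPQ : ∀ R : MvPolynomial (Fin 3) (AlgebraicClosure ℚ),
      Irreducible R → R ∣ P → ¬ R ∣ Q) :
    ¬ ∃ a : ℂ, 0 < a.im ∧ psi (P.map ι) a = 0 ∧ psi (Q.map ι) a = 0 := by
  rintro ⟨a, ha, hPa, hQa⟩
  obtain ⟨θ, hθ⟩ := RamanujanTranscendence.exists_isAlgebraic_adjoin_of_common_zero ι P Q hP hQ hPQ
    ![Ek 2 a, Ek 4 a, Ek 6 a] hPa hQa
  rw [RamanujanTranscendence.Ek_eq_qEval ha] at hθ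
  exact RamanujanTranscendence.false_of_isAlgebraic_adjoin (Complex.exp_ne_zero _)
    (RamanujanTranscendence.norm_nome_lt_one ha) θ hθ
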